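/- Assume the local multiplier setup with g of the standard form, and suppose that the strip exponent δ_v is at least 1/2 for every unit direction v. Then, provided the support of φ is sufficiently small, there is a constant C (depending on g, φ, and A) such that |K_φ(t,u)| ≤ C (2+|(t,u)|)^{−1/2} (ln(2+|(t,u)|))^{2} for all (t,u) ∈ ℝ². -/

import Mathlib

open MeasureTheory Real Set Filter Metric
open scoped Topology ENNReal

noncomputable section

/-- The Euclidean magnitude `|(x,y)| = √(x²+y²)` of a point of `ℝ²`. -/
def nrm2 (p : ℝ × ℝ) : ℝ := Real.sqrt (p.1 ^ 2 + p.2 ^ 2)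

/-- The open Euclidean disk `{(x,y) : x²+y² < r²}` centered at the origin. -/
def disk2 (r : ℝ) : Set (ℝ × ℝ) := {p : ℝ × ℝ | p.1 ^ 2 + p.2 ^ 2 < r ^ 2}

/-- The closed Euclidean disk `{(x,y) : x²+y² ≤ r²}` centered at the origin. -/
def closedDisk2 (r : ℝ) : Set (ℝ × ℝ) := {p : ℝ × ℝ | p.1 ^ 2 + p.2 ^ 2 ≤ r ^ 2}

/-- The circle `{(x,y) : x²+y² = r²}` centered at the origin. -/
def circle2 (r : ℝ) : Set (ℝ × ℝ) := {p : ℝ × ℝ | p.1 ^ 2 + p.2 ^ 2 = r ^ 2}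

/-- Dot product on `ℝ²`. -/
def dot2 (p q : ℝ × ℝ) : ℝ := p.1 * q.1 + p.2 * q.2

/-- The perpendicular vector `v^⊥ = (v₂, −v₁)`. -/
def perp2 (v : ℝ × ℝ) : ℝ × ℝ := (v.2, -v.1)

/-- The function `g = χ_E · ∏ᵢ |fᵢ|^(γᵢ)`. -/
def stdFun (n : ℕ) (f : Fin n → ℝ × ℝ → ℝ) (γ : Fin n → ℝ) (E : Set (ℝ × ℝ)) :
    ℝ × ℝ → ℝ :=
  E.indicator fun p => ∏ i, |f i p| ^ (γ i)

/-- A boundary curve for the region `E`: one half of a graph `y = h(|x|^{1/N})` or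
`x = h(|y|^{1/N})` with `h` real analytic, `h 0 = 0`, joining the origin to the circle
of radius `r₀`. -/
def IsPuiseuxBdryCurve (r₀ : ℝ) (C : Set (ℝ × ℝ)) : Prop :=
  ∃ (N : ℕ) (h : ℝ → ℝ) (I : Set ℝ) (σ : ℝ),
    0 < N ∧ (σ = 1 ∨ σ = -1) ∧ IsOpen I ∧ Icc (0:ℝ) (r₀ ^ ((N:ℝ)⁻¹)) ⊆ I ∧
    AnalyticOnNhd ℝ h I ∧ h 0 = 0 ∧
    (C = {p : ℝ × ℝ | p ∈ closedDisk2 r₀ ∧ 0 ≤ σ * p.1 ∧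
            p.2 = h (|p.1| ^ ((N:ℝ)⁻¹))} ∨
     C = {p : ℝ × ℝ | p ∈ closedDisk2 r₀ ∧ 0 ≤ σ * p.2 ∧
            p.1 = h (|p.2| ^ ((N:ℝ)⁻¹))}) ∧
    (0:ℝ×ℝ) ∈ C ∧ ∃ p ∈ C, nrm2 p = r₀

/-- The admissible form of the set `E`: either a disk centered at the origin, or a finite
disjoint union of open regions, each bounded by two Puiseux boundary curves joining the
origin to the circle of radius `r₀` together with an arc of that circle, where all the
boundary curves are pairwise disjoint in the closed disk minus the origin. -/
def IsStdDomain (E : Set (ℝ × ℝ)) : Prop :=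
  (∃ r₀ > (0:ℝ), E = disk2 r₀) ∨
  (∃ r₀ > (0:ℝ), ∃ m : ℕ, ∃ Es : Fin m → Set (ℝ × ℝ), ∃ Cs : Fin m → Fin 2 → Set (ℝ × ℝ),
    E = Set.iUnion Es ∧
    (Pairwise fun i j => Disjoint (Es i) (Es j)) ∧
    (∀ i, IsOpen (Es i) ∧ Es i ⊆ disk2 r₀ ∧ (0:ℝ×ℝ) ∈ closure (Es i) ∧
      frontier (Es i) ⊆ Cs i 0 ∪ Cs i 1 ∪ circle2 r₀) ∧
    (∀ i j, IsPuiseuxBdryCurve r₀ (Cs i j)) ∧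
    (Pairwise fun (q q' : Fin m × Fin 2) =>
      Disjoint (Cs q.1 q.2 ∩ (closedDisk2 r₀ \ {0}))
               (Cs q'.1 q'.2 ∩ (closedDisk2 r₀ \ {0}))))

/-- The standard form of the paper: the `fᵢ` are real analytic and not identically zero
near the origin, `g = χ_E ∏ |fᵢ|^(γᵢ)` is integrable near the origin, and `E` is an
admissible domain. -/
structure StandardForm (n : ℕ) (f : Fin n → ℝ × ℝ → ℝ) (γ : Fin n → ℝ)
    (E : Set (ℝ × ℝ)) : Prop where
  analytic : ∃ U ∈ 𝓝 (0 : ℝ × ℝ), ∀ i, AnalyticOnNhd ℝ (f i) U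
  nontriv : ∀ i, ¬ (∀ᶠ p in 𝓝 (0 : ℝ × ℝ), f i p = 0)
  integ : ∃ U ∈ 𝓝 (0 : ℝ × ℝ), IntegrableOn (stdFun n f γ E) U
  domain : IsStdDomain E

/-- The two-sided bound `c₁ rᵉ |log r|^d ≤ ∫_{x²+y²<r²} g ≤ c₂ rᵉ |log r|^d` for all small
`r` ("ball exponents" `ε`, `d` of `g`, as in Lemma 1.1). -/
def BallBound (g : ℝ × ℝ → ℝ) (ε : ℝ) (d : ℕ) : Prop :=
  0 < ε ∧ d ≤ 1 ∧ ∃ c₁ > (0:ℝ), ∃ c₂ > (0:ℝ), ∃ c₃ > (0:ℝ), ∀ r : ℝ, 0 < r → r < c₃ →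
    c₁ * r ^ ε * |Real.log r| ^ d ≤ (∫ p in disk2 r, g p) ∧
    (∫ p in disk2 r, g p) ≤ c₂ * r ^ ε * |Real.log r| ^ d

/-- The strip `{(x,y) : |(x,y)·v| < r, |(x,y)·v^⊥| < c}`. -/
def strip2 (v : ℝ × ℝ) (r c : ℝ) : Set (ℝ × ℝ) :=
  {p : ℝ × ℝ | |dot2 p v| < r ∧ |dot2 p (perp2 v)| < c}

/-- The two-sided bound `a r^δ |log r|^e ≤ ∫_{strip} g ≤ b r^δ |log r|^e` for all small `r`,
for every small `c` ("strip exponents" `δ_v`, `e_v` of `g` in the direction `v`, as in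
Lemma 1.2). -/
def StripBound (g : ℝ × ℝ → ℝ) (v : ℝ × ℝ) (δ : ℝ) (e : ℕ) : Prop :=
  0 < δ ∧ e ≤ 1 ∧ ∃ cv > (0:ℝ), ∀ c : ℝ, 0 < c → c < cv →
    ∃ a > (0:ℝ), ∃ b > (0:ℝ), ∀ r : ℝ, 0 < r → r < c →
      a * r ^ δ * |Real.log r| ^ e ≤ (∫ p in strip2 v r c, g p) ∧
      (∫ p in strip2 v r c, g p) ≤ b * r ^ δ * |Real.log r| ^ e

/-- The order of vanishing of `f` at the origin. -/
def vanishingOrder (f : ℝ × ℝ → ℝ) : ℕ :=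
  sInf {k : ℕ | iteratedFDeriv ℝ k f 0 ≠ 0}

/-- (A constant multiple of) the sum of the terms of lowest total degree in the Taylor
expansion of `f` at the origin, as a homogeneous function on `ℝ²`. -/
def lowestPart (f : ℝ × ℝ → ℝ) (p : ℝ × ℝ) : ℝ :=
  iteratedFDeriv ℝ (vanishingOrder f) f 0 (fun _ => p)

/-- `w` is a tangent direction of the set `C` at the origin. -/
def IsTangentDirAt (C : Set (ℝ × ℝ)) (w : ℝ × ℝ) : Prop :=
  ∃ p : ℕ → ℝ × ℝ, (∀ k, p k ∈ C ∧ p k ≠ 0) ∧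
    Tendsto p atTop (𝓝 (0:ℝ×ℝ)) ∧
    (Tendsto (fun k => (nrm2 (p k))⁻¹ • p k) atTop (𝓝 w) ∨
     Tendsto (fun k => (nrm2 (p k))⁻¹ • p k) atTop (𝓝 (-w)))

/-- `w` is the direction of one of the lines `l₁, …, l_p`: a line through the origin in the
zero set of the lowest-degree Taylor part of some `fᵢ`, or a tangent line at the origin to
one of the boundary curves of `E`. -/
def ExceptionalDir (n : ℕ) (f : Fin n → ℝ × ℝ → ℝ) (E : Set (ℝ × ℝ)) (w : ℝ × ℝ) : Prop :=
  (∃ i, lowestPart (f i) w = 0) ∨ IsTangentDirAt (frontier E) w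

/-- Conditions (1.2)-(1.3) on the factor `α`: `C¹` away from the origin, bounded by `A`,
with gradient bounded by `A (x²+y²)^{-1/2}`. -/
def AlphaBound (α : ℝ × ℝ → ℝ) (A : ℝ) : Prop :=
  ContDiffOn ℝ 1 α {(0:ℝ×ℝ)}ᶜ ∧ (∀ p, |α p| ≤ A) ∧
  ∀ p : ℝ × ℝ, p ≠ 0 → ‖fderiv ℝ α p‖ ≤ A * (nrm2 p)⁻¹

/-- A smooth bump function equal to `1` near `(x₀, y₀)`, supported within (Euclidean)
distance `r` of `(x₀, y₀)`. -/
def IsBump (φ : ℝ × ℝ → ℝ) (x₀ y₀ : ℝ) (r : ℝ) : Prop :=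
  ContDiff ℝ (⊤ : ℕ∞) φ ∧ HasCompactSupport φ ∧ (∀ᶠ p in 𝓝 ((x₀, y₀) : ℝ × ℝ), φ p = 1) ∧
    tsupport φ ⊆ {p : ℝ × ℝ | (p.1 - x₀) ^ 2 + (p.2 - y₀) ^ 2 < r ^ 2}

/-- The oscillatory integral `∫_S h(x,y) e^{i(tx+uy)} dx dy`. -/
def oscInt (h : ℝ × ℝ → ℝ) (S : Set (ℝ × ℝ)) (t u : ℝ) : ℂ :=
  ∫ p in S, (h p : ℂ) * Complex.exp (Complex.I * ((t : ℂ) * (p.1 : ℂ) + (u : ℂ) * (p.2 : ℂ)))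

/-- The convolution kernel `K(t,u) = ∫ m(x,y) e^{i(tx+uy)} dx dy`. -/
def Kfull (m : ℝ × ℝ → ℝ) (t u : ℝ) : ℂ :=
  oscInt m Set.univ t u

/-- The localized kernel `K_φ(t,u) = ∫ φ(x,y) m(x,y) e^{i(tx+uy)} dx dy`. -/
def Kphi (φ m : ℝ × ℝ → ℝ) (t u : ℝ) : ℂ :=
  oscInt (fun p => φ p * m p) Set.univ t u

/-- `k` is a Puiseux function of index `N` on `[0,a]`: `k(x) = k'(x^{1/N})` for a function
`k'` real analytic on an open set containing `[0, a^{1/N}]`; equivalently `x ↦ k(x^N)` is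
real analytic. -/
def PuiseuxOn (N : ℕ) (a : ℝ) (k : ℝ → ℝ) : Prop :=
  ∃ (k' : ℝ → ℝ) (I : Set ℝ), IsOpen I ∧ Icc (0:ℝ) (a ^ ((N:ℝ)⁻¹)) ⊆ I ∧
    AnalyticOnNhd ℝ k' I ∧ ∀ x ∈ Icc (0:ℝ) a, k x = k' (x ^ ((N:ℝ)⁻¹))

/-- `k(x) = l·x^s + higher order terms` as `x → 0⁺`. -/
def LeadingTerm (k : ℝ → ℝ) (l s : ℝ) : Prop :=
  Tendsto (fun x => k x / x ^ s) (𝓝[>] (0:ℝ)) (𝓝 l)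

/-- The mixed partial derivative `∂_x^l ∂_y^m F`. -/
def pderiv2 (l m : ℕ) (F : ℝ × ℝ → ℝ) (p : ℝ × ℝ) : ℝ :=
  iteratedDeriv l (fun x => iteratedDeriv m (fun y => F (x, y)) p.2) p.1

/-- The descending product `α(α−1)⋯(α−l+1)`. -/
def descProd (α : ℝ) (l : ℕ) : ℝ := ∏ j ∈ Finset.range l, (α - (j : ℝ))

/-- The sliver `{(x,y) : 0 < x < a, g(x) < y < G(x)}`. -/
def sliverSet (a : ℝ) (g G : ℝ → ℝ) : Set (ℝ × ℝ) :=
  {q : ℝ × ℝ | 0 < q.1 ∧ q.1 < a ∧ g q.1 < q.2 ∧ q.2 < G q.1}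

/-- A wedge of radius `r₀` at the origin: a region bounded by two lines through the origin
and the circle of radius `r₀`. -/
def IsWedge (r₀ : ℝ) (W : Set (ℝ × ℝ)) : Prop :=
  ∃ θ₁ θ₂ : ℝ, θ₁ < θ₂ ∧ θ₂ ≤ θ₁ + 2 * π ∧
    W = {p : ℝ × ℝ | ∃ ρ θ : ℝ, 0 < ρ ∧ ρ < r₀ ∧ θ₁ < θ ∧ θ < θ₂ ∧
      p = (ρ * Real.cos θ, ρ * Real.sin θ)}

local notation "V2" => ℝ × ℝ

lemma vdc1 {a b : ℝ} (hab : a ≤ b) (B B' ψ ψ' ψ'' : ℝ → ℝ) {G G1 μ : ℝ} (hμ : 0 < μ)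
    (hB : ∀ x ∈ Icc a b, HasDerivAt B (B' x) x)
    (hψ : ∀ x ∈ Icc a b, HasDerivAt ψ (ψ' x) x)
    (hψ' : ∀ x ∈ Icc a b, HasDerivAt ψ' (ψ'' x) x)
    (bB : ∀ x ∈ Icc a b, |B x| ≤ G) (bB' : ∀ x ∈ Icc a b, |B' x| ≤ G1)
    (bψ : ∀ x ∈ Icc a b, μ ≤ |ψ' x|) (bψ' : ∀ x ∈ Icc a b, 0 ≤ ψ'' x) :
    ‖∫ x in a..b, (B x : ℂ) * Complex.exp (Complex.I * (ψ x : ℂ))‖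
      ≤ (4 * G + (b - a) * G1) / μ := by
  have hG : 0 ≤ G := (abs_nonneg _).trans (bB a ⟨le_rfl, hab⟩)
  have hG1 : 0 ≤ G1 := (abs_nonneg _).trans (bB' a ⟨le_rfl, hab⟩)
  have hne : ∀ x ∈ Icc a b, ψ' x ≠ 0 := fun x hx h => by
    have := bψ x hx; rw [h, abs_zero] at this; linarith
  have sub : Ioo (min a b) (max a b) ⊆ Icc a b := by
    rw [min_eq_left hab, max_eq_right hab]; exact Ioo_subset_Icc_self
  have usub : uIcc a b = Icc a b := uIcc_of_le hab
  have ocsub : uIoc a b ⊆ Icc a b := by rw [uIoc_of_le hab]; exact Ioc_subset_Icc_self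
  have hinv : ∀ x ∈ Icc a b, HasDerivAt (fun x => - (ψ' x)⁻¹) (ψ'' x / ψ' x ^ 2) x := by
    intro x hx
    have := ((hψ' x hx).inv (hne x hx)).neg
    rw [neg_div, neg_neg] at this
    exact this
  have hpos : ∀ x ∈ Icc a b, 0 ≤ ψ'' x / ψ' x ^ 2 := fun x hx =>
    div_nonneg (bψ' x hx) (sq_nonneg _)
  have cinv : ContinuousOn (fun x => - (ψ' x)⁻¹) (uIcc a b) := by
    rw [usub]; exact fun x hx => (hinv x hx).continuousAt.continuousWithinAt
  have iinv : IntervalIntegrable (fun x => ψ'' x / ψ' x ^ 2) volume a b :=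
    intervalIntegral.intervalIntegrable_deriv_of_nonneg cinv (fun x hx => hinv x (sub hx))
      (fun x hx => hpos x (sub hx))
  have einv : ∫ x in a..b, ψ'' x / ψ' x ^ 2 = - (ψ' b)⁻¹ - - (ψ' a)⁻¹ :=
    intervalIntegral.integral_eq_sub_of_hasDerivAt (fun x hx => hinv x (usub ▸ hx)) iinv
  have binv : ∀ x ∈ Icc a b, |(ψ' x)⁻¹| ≤ μ⁻¹ := by
    intro x hx; rw [abs_inv]; exact inv_anti₀ hμ (bψ x hx)
  have einv' : ∫ x in a..b, ψ'' x / ψ' x ^ 2 ≤ 2 * μ⁻¹ := by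
    rw [einv]
    have h1 := abs_le.1 (binv a ⟨le_rfl, hab⟩)
    have h2 := abs_le.1 (binv b ⟨hab, le_rfl⟩)
    linarith [h1.1, h1.2, h2.1, h2.2]
  have iB' : IntervalIntegrable B' volume a b := by
    have h1 : IntervalIntegrable (fun _ : ℝ => G1) volume a b := intervalIntegrable_const
    refine h1.mono_fun ?_ ?_
    · have : AEStronglyMeasurable (deriv B) (volume.restrict (uIoc a b)) :=
        (measurable_deriv B).aestronglyMeasurable
      refine this.congr ?_
      filter_upwards [ae_restrict_mem measurableSet_uIoc] with x hx
      exact (hB x (ocsub hx)).deriv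
    · filter_upwards [ae_restrict_mem measurableSet_uIoc] with x hx
      rw [norm_eq_abs, norm_eq_abs, abs_of_nonneg hG1]
      exact bB' x (ocsub hx)
  have cB : ContinuousOn B (uIcc a b) := by
    rw [usub]; exact fun x hx => (hB x hx).continuousAt.continuousWithinAt
  have cψ : ContinuousOn ψ (uIcc a b) := by
    rw [usub]; exact fun x hx => (hψ x hx).continuousAt.continuousWithinAt
  have cψ' : ContinuousOn ψ' (uIcc a b) := by
    rw [usub]; exact fun x hx => (hψ' x hx).continuousAt.continuousWithinAt
  set u : ℝ → ℂ := fun x => ((B x * (ψ' x)⁻¹ : ℝ) : ℂ) with hu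
  set u' : ℝ → ℂ := fun x => ((B' x * (ψ' x)⁻¹ - B x * (ψ'' x / ψ' x ^ 2) : ℝ) : ℂ) with hu'
  set v : ℝ → ℂ := fun x => -Complex.I * Complex.exp (Complex.I * (ψ x : ℂ)) with hv
  set v' : ℝ → ℂ := fun x => (ψ' x : ℂ) * Complex.exp (Complex.I * (ψ x : ℂ)) with hv'
  have du : ∀ x ∈ Icc a b, HasDerivAt u (u' x) x := by
    intro x hx
    have h := (hB x hx).mul ((hψ' x hx).inv (hne x hx))
    have h2 := h.ofReal_comp
    refine h2.congr_deriv ?_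
    show _ = (((B' x * (ψ' x)⁻¹ - B x * (ψ'' x / ψ' x ^ 2) : ℝ)) : ℂ)
    congr 1
    simp only [Pi.inv_apply]; ring
  have dv : ∀ x ∈ Icc a b, HasDerivAt v (v' x) x := by
    intro x hx
    have h := (((hψ x hx).ofReal_comp.const_mul Complex.I).cexp).const_mul (-Complex.I)
    refine h.congr_deriv ?_
    show _ = (ψ' x : ℂ) * Complex.exp (Complex.I * (ψ x : ℂ))
    linear_combination (-(ψ' x : ℂ) * Complex.exp (Complex.I * (ψ x : ℂ))) * Complex.I_sq
  have ib1 : IntervalIntegrable (fun x => B' x * (ψ' x)⁻¹) volume a b :=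
    iB'.mul_continuousOn (cψ'.inv₀ (fun x hx => hne x (usub ▸ hx)))
  have ib2 : IntervalIntegrable (fun x => B x * (ψ'' x / ψ' x ^ 2)) volume a b :=
    iinv.continuousOn_mul cB
  have iu' : IntervalIntegrable u' volume a b := ⟨(ib1.sub ib2).1.ofReal, (ib1.sub ib2).2.ofReal⟩
  have iv' : IntervalIntegrable v' volume a b := by
    apply ContinuousOn.intervalIntegrable
    refine (Complex.continuous_ofReal.comp_continuousOn cψ').mul
      (Complex.continuous_exp.comp_continuousOn (continuousOn_const.mul
        (Complex.continuous_ofReal.comp_continuousOn cψ)))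
  have key := intervalIntegral.integral_mul_deriv_eq_deriv_mul_of_hasDerivAt
    (u := u) (v := v) (u' := u') (v' := v') (a := a) (b := b)
    (by rw [usub]; exact fun x hx => (du x hx).continuousAt.continuousWithinAt)
    (by rw [usub]; exact fun x hx => (dv x hx).continuousAt.continuousWithinAt)
    (fun x hx => du x (sub hx)) (fun x hx => dv x (sub hx)) iu' iv'
  have e1 : ∫ x in a..b, (B x : ℂ) * Complex.exp (Complex.I * (ψ x : ℂ))
      = ∫ x in a..b, u x * v' x := by
    apply intervalIntegral.integral_congr
    intro x hx
    have : (ψ' x : ℂ) ≠ 0 := by exact_mod_cast hne x (usub ▸ hx)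
    simp only [hu, hv']; push_cast; field_simp
  have nv : ∀ x, ‖v x‖ = 1 := by
    intro x; simp only [hv, norm_mul, norm_neg, Complex.norm_I, one_mul]
    rw [mul_comm]; exact Complex.norm_exp_ofReal_mul_I _
  have nu : ∀ x ∈ Icc a b, ‖u x‖ ≤ G * μ⁻¹ := by
    intro x hx
    simp only [hu, Complex.norm_real, norm_eq_abs, abs_mul]
    exact mul_le_mul (bB x hx) (binv x hx) (abs_nonneg _) hG
  have n3 : ‖∫ x in a..b, u' x * v x‖ ≤ ∫ x in a..b, (G1 * μ⁻¹ + G * (ψ'' x / ψ' x ^ 2)) := by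
    apply intervalIntegral.norm_integral_le_of_norm_le hab
    · filter_upwards with x hx
      have hx' := Ioc_subset_Icc_self hx
      rw [norm_mul, nv, mul_one]
      simp only [hu', Complex.norm_real, norm_eq_abs]
      refine (abs_sub _ _).trans (add_le_add ?_ ?_)
      · rw [abs_mul]; exact mul_le_mul (bB' x hx') (binv x hx') (abs_nonneg _) hG1
      · rw [abs_mul, abs_of_nonneg (hpos x hx')]
        exact mul_le_mul_of_nonneg_right (bB x hx') (hpos x hx')
    · exact intervalIntegrable_const.add (iinv.const_mul G)
  have n4 : ∫ x in a..b, (G1 * μ⁻¹ + G * (ψ'' x / ψ' x ^ 2)) ≤ (b - a) * (G1 * μ⁻¹) + G * (2 * μ⁻¹) := by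
    rw [intervalIntegral.integral_add intervalIntegrable_const (iinv.const_mul G),
      intervalIntegral.integral_const, intervalIntegral.integral_const_mul, smul_eq_mul]
    exact add_le_add le_rfl (mul_le_mul_of_nonneg_left einv' hG)
  rw [e1, key]
  have nb := nu b ⟨hab, le_rfl⟩
  have na := nu a ⟨le_rfl, hab⟩
  calc _ ≤ ‖u b * v b‖ + ‖u a * v a‖ + ‖∫ x in a..b, u' x * v x‖ :=
        (norm_sub_le _ _).trans (add_le_add (norm_sub_le _ _) le_rfl)
    _ ≤ G * μ⁻¹ + G * μ⁻¹ + ((b - a) * (G1 * μ⁻¹) + G * (2 * μ⁻¹)) := by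
        rw [norm_mul (u b) (v b), norm_mul (u a) (v a), nv, nv, mul_one, mul_one]
        linarith
    _ = _ := by field_simp; ring

lemma osc_trivial {a b : ℝ} (hab : a ≤ b) (B ψ : ℝ → ℝ) {G : ℝ}
    (bB : ∀ x ∈ Icc a b, |B x| ≤ G) :
    ‖∫ x in a..b, (B x : ℂ) * Complex.exp (Complex.I * (ψ x : ℂ))‖ ≤ G * (b - a) := by
  have := intervalIntegral.norm_integral_le_of_norm_le_const (a := a) (b := b) (C := G)
    (f := fun x => (B x : ℂ) * Complex.exp (Complex.I * (ψ x : ℂ))) ?_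
  · rwa [abs_of_nonneg (by linarith)] at this
  · intro x hx
    rw [uIoc_of_le hab] at hx
    rw [norm_mul, mul_comm Complex.I, Complex.norm_exp_ofReal_mul_I, mul_one, Complex.norm_real]
    exact bB x (Ioc_subset_Icc_self hx)

lemma vdc2 {a b : ℝ} (hab : a ≤ b) (B B' ψ ψ' ψ'' : ℝ → ℝ) {G G1 ρ : ℝ} (hρ : 0 < ρ)
    (hB : ∀ x ∈ Icc a b, HasDerivAt B (B' x) x)
    (hψ : ∀ x ∈ Icc a b, HasDerivAt ψ (ψ' x) x)
    (hψ' : ∀ x ∈ Icc a b, HasDerivAt ψ' (ψ'' x) x)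
    (bB : ∀ x ∈ Icc a b, |B x| ≤ G) (bB' : ∀ x ∈ Icc a b, |B' x| ≤ G1)
    (bψ' : ∀ x ∈ Icc a b, ρ ≤ ψ'' x) :
    ‖∫ x in a..b, (B x : ℂ) * Complex.exp (Complex.I * (ψ x : ℂ))‖
      ≤ (10 * G + 2 * (b - a) * G1) / √ρ := by
  have hG : 0 ≤ G := (abs_nonneg _).trans (bB a ⟨le_rfl, hab⟩)
  have hG1 : 0 ≤ G1 := (abs_nonneg _).trans (bB' a ⟨le_rfl, hab⟩)
  have hs : 0 < √ρ := sqrt_pos.2 hρ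
  have hss : √ρ * √ρ = ρ := mul_self_sqrt hρ.le
  have cψ' : ContinuousOn ψ' (Icc a b) :=
    fun x hx => (hψ' x hx).continuousAt.continuousWithinAt
  have mono : ∀ x ∈ Icc a b, ∀ y ∈ Icc a b, x ≤ y → ρ * (y - x) ≤ ψ' y - ψ' x := by
    intro x hx y hy hxy
    have := (convex_Icc a b).mul_sub_le_image_sub_of_le_deriv (f := ψ') (C := ρ) cψ'
      (fun z hz => (hψ' z (interior_subset hz)).differentiableAt.differentiableWithinAt)
      (fun z hz => by rw [(hψ' z (interior_subset hz)).deriv]; exact bψ' z (interior_subset hz))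
      x hx y hy hxy
    exact this
  obtain ⟨c, hc, hc1, hc2⟩ : ∃ c ∈ Icc a b, (∀ x ∈ Icc a b, c < x → ρ * (x - c) ≤ ψ' x) ∧
      (∀ x ∈ Icc a b, x < c → ρ * (c - x) ≤ - ψ' x) := by
    have ha : a ∈ Icc a b := ⟨le_rfl, hab⟩
    have hb : b ∈ Icc a b := ⟨hab, le_rfl⟩
    rcases le_or_gt 0 (ψ' a) with h | h
    · refine ⟨a, ha, fun x hx hax => ?_, fun x hx hax => ?_⟩
      · linarith [mono a ha x hx hax.le]
      · linarith [hx.1]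
    · rcases le_or_gt (ψ' b) 0 with h' | h'
      · refine ⟨b, hb, fun x hx hax => ?_, fun x hx hax => ?_⟩
        · linarith [hx.2]
        · linarith [mono x hx b hb hax.le]
      · obtain ⟨c, hc, h0⟩ := intermediate_value_Icc hab cψ' ⟨h.le, h'.le⟩
        exact ⟨c, hc, fun x hx hax => by linarith [mono c hc x hx hax.le],
          fun x hx hax => by linarith [mono x hx c hc hax.le]⟩
  have hδ : 0 < (√ρ)⁻¹ := inv_pos.2 hs
  have hρδ : ρ * (√ρ)⁻¹ = √ρ := by
    rw [mul_inv_eq_iff_eq_mul₀ hs.ne', hss]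
  set δ := (√ρ)⁻¹ with hδd
  obtain ⟨hca, hcb⟩ := hc
  set p := max a (c - δ) with hp
  set q := min b (c + δ) with hq
  have hap : a ≤ p := le_max_left _ _
  have hpc : p ≤ c := max_le hca (by linarith)
  have hcq : c ≤ q := le_min hcb (by linarith)
  have hqb : q ≤ b := min_le_left _ _
  have hpδ : c - δ ≤ p := le_max_right _ _
  have hqδ : q ≤ c + δ := min_le_right _ _
  set F : ℝ → ℂ := fun x => (B x : ℂ) * Complex.exp (Complex.I * (ψ x : ℂ)) with hF
  have cF : ContinuousOn F (Icc a b) := by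
    have cB : ContinuousOn B (Icc a b) :=
      fun x hx => (hB x hx).continuousAt.continuousWithinAt
    have cψ : ContinuousOn ψ (Icc a b) :=
      fun x hx => (hψ x hx).continuousAt.continuousWithinAt
    exact (Complex.continuous_ofReal.comp_continuousOn cB).mul
      (Complex.continuous_exp.comp_continuousOn (continuousOn_const.mul
        (Complex.continuous_ofReal.comp_continuousOn cψ)))
  have ii : ∀ x y, a ≤ x → x ≤ y → y ≤ b → IntervalIntegrable F volume x y := by
    intro x y h1 h2 h3
    apply ContinuousOn.intervalIntegrable
    rw [uIcc_of_le h2]; exact cF.mono (Icc_subset_Icc h1 h3)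
  have split : ∫ x in a..b, F x = (∫ x in a..p, F x) + (∫ x in p..q, F x) + ∫ x in q..b, F x := by
    rw [intervalIntegral.integral_add_adjacent_intervals (ii a p le_rfl hap (by linarith))
      (ii p q hap (by linarith) hqb),
      intervalIntegral.integral_add_adjacent_intervals (ii a q le_rfl (by linarith) hqb)
      (ii q b (by linarith) hqb le_rfl)]
  have n1 : ‖∫ x in a..p, F x‖ ≤ (4 * G + (b - a) * G1) / √ρ := by
    rcases le_or_gt (c - δ) a with h | h
    · have : p = a := max_eq_left h
      rw [this, intervalIntegral.integral_same, norm_zero]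
      exact div_nonneg (by nlinarith [mul_nonneg (sub_nonneg.2 hab) hG1]) hs.le
    · have hpe : p = c - δ := max_eq_right h.le
      have sub : ∀ x ∈ Icc a p, x ∈ Icc a b := fun x hx => ⟨hx.1, by linarith [hx.2]⟩
      refine (vdc1 hap B B' ψ ψ' ψ'' hs (fun x hx => hB x (sub x hx)) (fun x hx => hψ x (sub x hx))
        (fun x hx => hψ' x (sub x hx)) (fun x hx => bB x (sub x hx)) (fun x hx => bB' x (sub x hx))
        ?_ (fun x hx => hρ.le.trans (bψ' x (sub x hx)))).trans ?_
      · intro x hx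
        have h1 := hc2 x (sub x hx) (by linarith [hx.2])
        have h2 : ρ * δ ≤ ρ * (c - x) := mul_le_mul_of_nonneg_left (by linarith [hx.2]) hρ.le
        rw [hρδ] at h2
        exact (h2.trans h1).trans (neg_le_abs _)
      · gcongr; linarith
  have n3 : ‖∫ x in q..b, F x‖ ≤ (4 * G + (b - a) * G1) / √ρ := by
    rcases le_or_gt b (c + δ) with h | h
    · have : q = b := min_eq_left h
      rw [this, intervalIntegral.integral_same, norm_zero]
      exact div_nonneg (by nlinarith [mul_nonneg (sub_nonneg.2 hab) hG1]) hs.le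
    · have hpe : q = c + δ := min_eq_right h.le
      have sub : ∀ x ∈ Icc q b, x ∈ Icc a b := fun x hx => ⟨by linarith [hx.1], hx.2⟩
      refine (vdc1 hqb B B' ψ ψ' ψ'' hs (fun x hx => hB x (sub x hx)) (fun x hx => hψ x (sub x hx))
        (fun x hx => hψ' x (sub x hx)) (fun x hx => bB x (sub x hx)) (fun x hx => bB' x (sub x hx))
        ?_ (fun x hx => hρ.le.trans (bψ' x (sub x hx)))).trans ?_
      · intro x hx
        have h1 := hc1 x (sub x hx) (by linarith [hx.1])
        have h2 : ρ * δ ≤ ρ * (x - c) := mul_le_mul_of_nonneg_left (by linarith [hx.1]) hρ.le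
        rw [hρδ] at h2
        exact (h2.trans h1).trans (le_abs_self _)
      · gcongr; linarith
  have n2 : ‖∫ x in p..q, F x‖ ≤ 2 * G / √ρ := by
    refine (osc_trivial (hpc.trans hcq) B ψ
      (fun x hx => bB x ⟨hap.trans hx.1, hx.2.trans hqb⟩)).trans ?_
    calc G * (q - p) ≤ G * (2 * δ) := mul_le_mul_of_nonneg_left (by linarith) hG
      _ = _ := by rw [hδd]; ring
  rw [split]
  calc _ ≤ _ := norm_add₃_le
    _ ≤ (4 * G + (b - a) * G1) / √ρ + 2 * G / √ρ + (4 * G + (b - a) * G1) / √ρ := by linarith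
    _ = _ := by ring

lemma osc_neg (a b : ℝ) (B ψ : ℝ → ℝ) :
    ‖∫ x in a..b, (B x : ℂ) * Complex.exp (Complex.I * ((-ψ x : ℝ) : ℂ))‖ =
    ‖∫ x in a..b, (B x : ℂ) * Complex.exp (Complex.I * (ψ x : ℂ))‖ := by
  rw [← Complex.norm_conj, ← intervalIntegral.intervalIntegral_conj]
  congr 1
  apply intervalIntegral.integral_congr
  intro x _
  simp only [map_mul, Complex.conj_ofReal, ← Complex.exp_conj, Complex.conj_I]
  push_cast; ring_nf

lemma vdc1s {a b : ℝ} (hab : a ≤ b) (B B' ψ ψ' ψ'' : ℝ → ℝ) {G G1 μ s : ℝ} (hμ : 0 < μ)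
    (hs : s = 1 ∨ s = -1)
    (hB : ∀ x ∈ Icc a b, HasDerivAt B (B' x) x)
    (hψ : ∀ x ∈ Icc a b, HasDerivAt ψ (ψ' x) x)
    (hψ' : ∀ x ∈ Icc a b, HasDerivAt ψ' (ψ'' x) x)
    (bB : ∀ x ∈ Icc a b, |B x| ≤ G) (bB' : ∀ x ∈ Icc a b, |B' x| ≤ G1)
    (bψ : ∀ x ∈ Icc a b, μ ≤ |ψ' x|) (bψ' : ∀ x ∈ Icc a b, 0 ≤ s * ψ'' x) :
    ‖∫ x in a..b, (B x : ℂ) * Complex.exp (Complex.I * (ψ x : ℂ))‖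
      ≤ (4 * G + (b - a) * G1) / μ := by
  rcases hs with rfl | rfl
  · exact vdc1 hab B B' ψ ψ' ψ'' hμ hB hψ hψ' bB bB' bψ (by simpa using bψ')
  · rw [← osc_neg]
    exact vdc1 hab B B' (fun x => -ψ x) (fun x => -ψ' x) (fun x => -ψ'' x) hμ hB
      (fun x hx => (hψ x hx).neg) (fun x hx => (hψ' x hx).neg) bB bB' (by simpa using bψ)
      (by simpa using bψ')

lemma vdc2s {a b : ℝ} (hab : a ≤ b) (B B' ψ ψ' ψ'' : ℝ → ℝ) {G G1 ρ s : ℝ} (hρ : 0 < ρ)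
    (hs : s = 1 ∨ s = -1)
    (hB : ∀ x ∈ Icc a b, HasDerivAt B (B' x) x)
    (hψ : ∀ x ∈ Icc a b, HasDerivAt ψ (ψ' x) x)
    (hψ' : ∀ x ∈ Icc a b, HasDerivAt ψ' (ψ'' x) x)
    (bB : ∀ x ∈ Icc a b, |B x| ≤ G) (bB' : ∀ x ∈ Icc a b, |B' x| ≤ G1)
    (bψ' : ∀ x ∈ Icc a b, ρ ≤ s * ψ'' x) :
    ‖∫ x in a..b, (B x : ℂ) * Complex.exp (Complex.I * (ψ x : ℂ))‖
      ≤ (10 * G + 2 * (b - a) * G1) / √ρ := by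
  rcases hs with rfl | rfl
  · exact vdc2 hab B B' ψ ψ' ψ'' hρ hB hψ hψ' bB bB' (by simpa using bψ')
  · rw [← osc_neg]
    exact vdc2 hab B B' (fun x => -ψ x) (fun x => -ψ' x) (fun x => -ψ'' x) hρ hB
      (fun x hx => (hψ x hx).neg) (fun x hx => (hψ' x hx).neg) bB bB'
      (by simpa using bψ')

lemma mul_sqrt_le_of {N a P : ℝ} (k : ℝ) (hN : 0 ≤ N) (ha : 0 ≤ a) (hP : 0 ≤ P) (hk : 0 ≤ k)
    (h1 : N ≤ P) (h2 : N * a ≤ k ^ 2 * P) : N * √a ≤ k * P := by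
  have : N * √a = √((N * √a)^2) := (sqrt_sq (by positivity)).symm
  rw [this]
  apply sqrt_le_iff.2
  refine ⟨by positivity, ?_⟩
  rw [mul_pow, sq_sqrt ha]
  calc N ^ 2 * a = N * (N * a) := by ring
    _ ≤ P * (k ^ 2 * P) := mul_le_mul h1 h2 (by positivity) hP
    _ = _ := by ring

lemma box_final {N G X Z H Λ L C0 C1 : ℝ} (hN : 0 ≤ N) (hG : 0 ≤ G) (hX : 0 < X) (hX1 : X ≤ 1)
    (hZ : 0 < Z) (hZ1 : Z ≤ 1) (hZX : Z ≤ 4 * X) (hH : 0 ≤ H) (hHX : H ≤ X) (hΛ : 0 ≤ Λ)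
    (hC0 : 1 ≤ C0) (hC1 : 1 ≤ C1) (hL : L ≤ C1 * (Λ + 1))
    (h0 : N ≤ G * X * Z)
    (h : N * Λ ≤ 10 * G * Z ∨ (N * Λ ≤ 5 * G * X ∧ N * √(Λ * H) ≤ 12 * G * X * Z)) :
    N * (1 + √(L * (C0 * H + 2 * Z))) ≤ 23 * (C1 * (C0 + 2)) * (G * X * Z) := by
  have hP : 0 ≤ G * X * Z := by positivity
  have key : N * √(Λ * H) ≤ 12 * (G * X * Z) ∧ N * √(Λ * Z) ≤ 8 * (G * X * Z) := by
    rcases h with h | ⟨h, h'⟩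
    · have e1 : N * √(Λ * X) ≤ 4 * (G * X * Z) := by
        apply mul_sqrt_le_of 4 hN (by positivity) hP (by norm_num) h0
        nlinarith [mul_le_mul_of_nonneg_right h hX.le]
      constructor
      · have : √(Λ * H) ≤ √(Λ * X) := sqrt_le_sqrt (by gcongr)
        nlinarith
      · have : √(Λ * Z) ≤ 2 * √(Λ * X) := by
          apply sqrt_le_iff.2
          refine ⟨by positivity, ?_⟩
          rw [mul_pow, sq_sqrt (by positivity)]; nlinarith
        nlinarith
    · refine ⟨by linarith, ?_⟩
      have := mul_sqrt_le_of 3 hN (a := Λ * Z) (by positivity) hP (by norm_num) h0 (by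
        nlinarith [mul_le_mul_of_nonneg_right h hZ.le])
      linarith
  have hD : 1 ≤ C1 * (C0 + 2) := by nlinarith
  set D := C1 * (C0 + 2) with hDd
  have e2 : L * (C0 * H + 2 * Z) ≤ D * (Λ * H + Λ * Z + 2) := by
    have a1 : 0 ≤ C0 * H + 2 * Z := by positivity
    have a2 : C0 * H + 2 * Z ≤ (C0 + 2) * (H + Z) := by nlinarith
    have a3 : (Λ + 1) * (H + Z) ≤ Λ * H + Λ * Z + 2 := by nlinarith
    calc L * (C0 * H + 2 * Z) ≤ C1 * (Λ + 1) * ((C0 + 2) * (H + Z)) :=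
          mul_le_mul hL a2 a1 (by positivity)
      _ = D * ((Λ + 1) * (H + Z)) := by rw [hDd]; ring
      _ ≤ _ := mul_le_mul_of_nonneg_left a3 (by linarith)
  have e3 : √(L * (C0 * H + 2 * Z)) ≤ D * (√(Λ * H) + √(Λ * Z) + 2) := by
    apply sqrt_le_iff.2
    refine ⟨by positivity, e2.trans ?_⟩
    have s1 := sq_sqrt (show 0 ≤ Λ * H by positivity)
    have s2 := sq_sqrt (show 0 ≤ Λ * Z by positivity)
    have p1 := sqrt_nonneg (Λ * H)
    have p2 := sqrt_nonneg (Λ * Z)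
    set r1 := √(Λ * H)
    set r2 := √(Λ * Z)
    rw [mul_pow]
    have : D ≤ D ^ 2 := by nlinarith
    calc D * (Λ * H + Λ * Z + 2) ≤ D ^ 2 * (Λ * H + Λ * Z + 2) :=
          mul_le_mul_of_nonneg_right this (by positivity)
      _ ≤ _ := by
        apply mul_le_mul_of_nonneg_left _ (by positivity)
        rw [← s1, ← s2]; nlinarith [mul_nonneg p1 p2]
  calc N * (1 + √(L * (C0 * H + 2 * Z))) ≤ N * (D * (√(Λ * H) + √(Λ * Z) + 3)) := by
        apply mul_le_mul_of_nonneg_left _ hN; nlinarith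
    _ = D * (N * √(Λ * H) + N * √(Λ * Z) + 3 * N) := by ring
    _ ≤ D * (23 * (G * X * Z)) := by
        apply mul_le_mul_of_nonneg_left _ (by linarith); linarith [key.1, key.2]
    _ = _ := by ring

lemma box_est {X Z G L H C0 C1 t u s σ : ℝ} (hX : 0 < X) (hX1 : X ≤ 1)
    (hZ : 0 < Z) (hZ1 : Z ≤ 1) (hZX : Z ≤ 4 * X) (hH : 0 ≤ H) (hHX : H ≤ X)
    (hC0 : 1 ≤ C0) (hC1 : 1 ≤ C1) (hL : L ≤ C1 * (max |t| |u| + 1))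
    (hs : s = 1 ∨ s = -1) (hσ : σ = 1 ∨ σ = -1)
    (B Bx Bz : ℝ → ℝ → ℝ) (Q Q' Q'' : ℝ → ℝ)
    (dQ : ∀ x ∈ Icc X (2 * X), HasDerivAt Q (Q' x) x)
    (dQ' : ∀ x ∈ Icc X (2 * X), HasDerivAt Q' (Q'' x) x)
    (bQ' : ∀ x ∈ Icc X (2 * X), |Q' x| ≤ 1 / 2)
    (bQ'' : ∀ x ∈ Icc X (2 * X), H ≤ X ^ 2 * (s * Q'' x))
    (hBx : ∀ x ∈ Icc X (2 * X), ∀ z ∈ Icc Z (2 * Z), HasDerivAt (fun x => B x z) (Bx x z) x)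
    (hBz : ∀ x ∈ Icc X (2 * X), ∀ z ∈ Icc Z (2 * Z), HasDerivAt (fun z => B x z) (Bz x z) z)
    (bB : ∀ x ∈ Icc X (2 * X), ∀ z ∈ Icc Z (2 * Z), |B x z| ≤ G)
    (bBx : ∀ x ∈ Icc X (2 * X), ∀ z ∈ Icc Z (2 * Z), |Bx x z| ≤ G / X)
    (bBz : ∀ x ∈ Icc X (2 * X), ∀ z ∈ Icc Z (2 * Z), |Bz x z| ≤ G / Z)
    (hint : IntegrableOn (fun q : V2 => (B q.1 q.2 : ℂ) *
      Complex.exp (Complex.I * ((t * q.1 + u * (Q q.1 + σ * q.2) : ℝ) : ℂ)))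
      (Ioc X (2 * X) ×ˢ Ioc Z (2 * Z))) :
    ‖∫ q in Ioc X (2 * X) ×ˢ Ioc Z (2 * Z), (B q.1 q.2 : ℂ) *
      Complex.exp (Complex.I * ((t * q.1 + u * (Q q.1 + σ * q.2) : ℝ) : ℂ))‖
      * (1 + √(L * (C0 * H + 2 * Z))) ≤ 23 * (C1 * (C0 + 2)) * (G * X * Z) := by
  have hG : 0 ≤ G := (abs_nonneg _).trans (bB X ⟨le_rfl, by linarith⟩ Z ⟨le_rfl, by linarith⟩)
  have hX2 : X ≤ 2 * X := by linarith
  have hZ2 : Z ≤ 2 * Z := by linarith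
  have hσa : |σ| = 1 := by rcases hσ with h | h <;> simp [h]
  set F : V2 → ℂ := fun q => (B q.1 q.2 : ℂ) *
      Complex.exp (Complex.I * ((t * q.1 + u * (Q q.1 + σ * q.2) : ℝ) : ℂ)) with hF
  set I := ∫ q in Ioc X (2 * X) ×ˢ Ioc Z (2 * Z), F q with hI
  have i1 : I = ∫ x in Ioc X (2 * X), ∫ z in Z..(2 * Z), F (x, z) := by
    rw [hI, Measure.volume_eq_prod, setIntegral_prod _ hint]
    simp_rw [intervalIntegral.integral_of_le hZ2]
  have i2 : I = ∫ z in Ioc Z (2 * Z), ∫ x in X..(2 * X), F (x, z) := by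
    rw [hI, Measure.volume_eq_prod, ← setIntegral_prod_swap, setIntegral_prod]
    · simp_rw [intervalIntegral.integral_of_le hX2]; rfl
    · exact hint.swap
  have b1 : ∀ c, (∀ x ∈ Icc X (2 * X), ‖∫ z in Z..(2 * Z), F (x, z)‖ ≤ c) → ‖I‖ ≤ c * X := by
    intro c hc
    rw [i1]
    refine (norm_setIntegral_le_of_norm_le_const (C := c) (by simp) ?_).trans ?_
    · intro x hx; exact hc x (Ioc_subset_Icc_self hx)
    · simp [measureReal_def, show 2 * X - X = X by ring, hX.le]
  have b2 : ∀ c, (∀ z ∈ Icc Z (2 * Z), ‖∫ x in X..(2 * X), F (x, z)‖ ≤ c) → ‖I‖ ≤ c * Z := by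
    intro c hc
    rw [i2]
    refine (norm_setIntegral_le_of_norm_le_const (C := c) (by simp) ?_).trans ?_
    · intro x hx; exact hc x (Ioc_subset_Icc_self hx)
    · simp [measureReal_def, show 2 * Z - Z = Z by ring, hZ.le]
  have h0 : ‖I‖ ≤ G * X * Z := by
    refine (b1 (G * Z) ?_).trans (by ring_nf; rfl)
    intro x hx
    have := osc_trivial hZ2 (fun z => B x z) (fun z => t * x + u * (Q x + σ * z)) (bB x hx)
    rwa [show 2 * Z - Z = Z by ring] at this
  have dψ : ∀ z, ∀ x ∈ Icc X (2 * X),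
      HasDerivAt (fun x => t * x + u * (Q x + σ * z)) (t + u * Q' x) x := by
    intro z x hx
    have h1 := ((hasDerivAt_id x).const_mul t).add (((dQ x hx).add_const (σ * z)).const_mul u)
    refine h1.congr_deriv (by simp)
  have dψ' : ∀ x ∈ Icc X (2 * X),
      HasDerivAt (fun x => t + u * Q' x) (u * Q'' x) x := by
    intro x hx
    simpa using ((dQ' x hx).const_mul u).const_add t
  have sgn : ∃ s' : ℝ, (s' = 1 ∨ s' = -1) ∧ ∀ w, s' * (u * w) = |u| * (s * w) := by
    rcases hs with rfl | rfl <;> rcases le_total 0 u with h | h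
    · exact ⟨1, Or.inl rfl, fun w => by rw [abs_of_nonneg h]; ring⟩
    · exact ⟨-1, Or.inr rfl, fun w => by rw [abs_of_nonpos h]; ring⟩
    · exact ⟨-1, Or.inr rfl, fun w => by rw [abs_of_nonneg h]; ring⟩
    · exact ⟨1, Or.inl rfl, fun w => by rw [abs_of_nonpos h]; ring⟩
  obtain ⟨s', hs', hsw⟩ := sgn
  have Q''nn : ∀ x ∈ Icc X (2 * X), H / X ^ 2 ≤ s * Q'' x := by
    intro x hx
    rw [div_le_iff₀ (by positivity)]; linarith [bQ'' x hx]
  apply box_final (norm_nonneg _) hG hX hX1 hZ hZ1 hZX hH hHX (Λ := max |t| |u|) (by positivity)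
    hC0 hC1 hL h0
  rcases le_or_gt |u| |t| with htu | htu
  · left
    rw [max_eq_left htu]
    rcases (abs_nonneg t).eq_or_lt with ht | ht
    · rw [← ht]; simp; positivity
    have := b2 (10 * G / |t|) ?_
    · calc ‖I‖ * |t| ≤ 10 * G / |t| * Z * |t| := by gcongr
        _ = _ := by field_simp
    intro z hz
    have := vdc1s hX2 (fun x => B x z) (fun x => Bx x z) (fun x => t * x + u * (Q x + σ * z))
      (fun x => t + u * Q' x) (fun x => u * Q'' x) (μ := |t| / 2) (by positivity) hs'
      (fun x hx => hBx x hx z hz) (dψ z) dψ' (fun x hx => bB x hx z hz)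
      (fun x hx => bBx x hx z hz) ?_ ?_
    · refine this.trans (le_of_eq ?_)
      rw [show 2 * X - X = X by ring]; field_simp; ring
    · intro x hx
      have h1 : |u * Q' x| ≤ |t| / 2 := by
        rw [abs_mul]
        calc |u| * |Q' x| ≤ |t| * (1/2) := mul_le_mul htu (bQ' x hx) (abs_nonneg _) ht.le
          _ = _ := by ring
      have h2 := abs_sub_abs_le_abs_sub t (-(u * Q' x))
      rw [abs_neg, sub_neg_eq_add] at h2
      linarith
    · intro x hx
      rw [hsw]
      exact mul_nonneg (abs_nonneg _) ((by positivity : 0 ≤ H / X ^ 2).trans (Q''nn x hx))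
  · right
    rw [max_eq_right htu.le]
    have hu : 0 < |u| := (abs_nonneg _).trans_lt htu
    constructor
    · have := b1 (5 * G / |u|) ?_
      · calc ‖I‖ * |u| ≤ 5 * G / |u| * X * |u| := by gcongr
          _ = _ := by field_simp
      intro x hx
      have := vdc1s hZ2 (fun z => B x z) (fun z => Bz x z) (fun z => t * x + u * (Q x + σ * z))
        (fun _ => u * σ) (fun _ => 0) (μ := |u|) hu (Or.inl rfl)
        (fun z hz => hBz x hx z hz) ?_ (fun z _ => hasDerivAt_const _ _)
        (fun z hz => bB x hx z hz)
        (fun z hz => bBz x hx z hz) ?_ ?_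
      · refine this.trans (le_of_eq ?_)
        rw [show 2 * Z - Z = Z by ring]; field_simp; ring
      · intro z hz
        simpa using ((((hasDerivAt_id z).const_mul σ).const_add (Q x)).const_mul u).const_add (t * x)
      · intro z hz; rw [abs_mul, hσa, mul_one]
      · intro z hz; simp
    · rcases hH.eq_or_lt with hH0 | hH0
      · rw [← hH0]; simp; positivity
      have hsq : 0 < √(|u| * H) := sqrt_pos.2 (by positivity)
      have := b2 (12 * G * X / √(|u| * H)) ?_
      · calc ‖I‖ * √(|u| * H) ≤ 12 * G * X / √(|u| * H) * Z * √(|u| * H) := by gcongr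
          _ = _ := by field_simp
      intro z hz
      have := vdc2s hX2 (fun x => B x z) (fun x => Bx x z) (fun x => t * x + u * (Q x + σ * z))
        (fun x => t + u * Q' x) (fun x => u * Q'' x) (ρ := |u| * H / X ^ 2) (by positivity) hs'
        (fun x hx => hBx x hx z hz) (dψ z) dψ' (fun x hx => bB x hx z hz)
        (fun x hx => bBx x hx z hz) ?_
      · refine this.trans (le_of_eq ?_)
        rw [show 2 * X - X = X by ring, sqrt_div (by positivity), sqrt_sq hX.le]
        field_simp; ring
      · intro x hx
        rw [hsw, mul_div_assoc]
        exact mul_le_mul_of_nonneg_left (Q''nn x hx) hu.le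

lemma hasDerivAt_rpow_mul_comp {E : ℝ → ℝ} {a μ x : ℝ} (hx : 0 < x)
    (hE : DifferentiableAt ℝ E (x ^ μ)) :
    HasDerivAt (fun x => x ^ a * E (x ^ μ))
      (x ^ (a - 1) * (a * E (x ^ μ) + μ * (x ^ μ * deriv E (x ^ μ)))) x := by
  have h1 := hasDerivAt_rpow_const (x := x) (p := a) (Or.inl hx.ne')
  have h2 := hasDerivAt_rpow_const (x := x) (p := μ) (Or.inl hx.ne')
  have h3 := h1.mul (hE.hasDerivAt.comp x h2)
  refine h3.congr_deriv ?_
  have e1 : x ^ a = x ^ (a - 1) * x := by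
    rw [rpow_sub_one hx.ne']; field_simp
  have e2 : x ^ μ = x ^ (μ - 1) * x := by
    rw [rpow_sub_one hx.ne']; field_simp
  simp only [Function.comp]
  rw [e1]
  linear_combination (-x ^ (a-1) * μ * deriv E (x ^ μ)) * e2

lemma tendsto_rpow_zero_right {μ : ℝ} (hμ : 0 < μ) :
    Tendsto (fun x : ℝ => x ^ μ) (𝓝 0) (𝓝 0) := by
  have := (continuousAt_rpow_const 0 μ (Or.inr hμ.le)).tendsto
  rwa [zero_rpow hμ.ne'] at this

lemma Q2_lemma {μ : ℝ} (hμ : 0 < μ) {e : ℝ → ℝ} (he : AnalyticAt ℝ e 0) :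
    ∃ x0 > 0, ∃ C0 ≥ (1:ℝ), ∃ s : ℝ, (s = 1 ∨ s = -1) ∧ ∃ Q' Q'' Hf : ℝ → ℝ,
      ∀ X, 0 < X → X < x0 → 0 ≤ Hf X ∧ Hf X ≤ X ∧ ∀ x ∈ Icc X (2 * X),
        HasDerivAt (fun x => x * (e (x ^ μ) - e 0)) (Q' x) x ∧ HasDerivAt Q' (Q'' x) x ∧
        |Q' x| ≤ 1 / 2 ∧ Hf X ≤ X ^ 2 * (s * Q'' x) ∧
        |x * (e (x ^ μ) - e 0)| ≤ C0 * Hf X := by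
  have hd : AnalyticAt ℝ (fun ξ => e ξ - e 0) 0 := he.sub analyticAt_const
  have evx : ∀ P : ℝ → Prop, (∀ᶠ ξ in 𝓝 0, P ξ) →
      ∃ x1 > 0, ∀ x, 0 < x → x < x1 → P (x ^ μ) := by
    intro P hP
    obtain ⟨ε, hε, h⟩ := Metric.eventually_nhds_iff.1 ((tendsto_rpow_zero_right hμ).eventually hP)
    exact ⟨ε, hε, fun x h0 h1 => h (by rw [dist_eq, sub_zero, abs_of_pos h0]; exact h1)⟩
  by_cases hz : ∀ᶠ ξ in 𝓝 0, e ξ - e 0 = 0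
  · obtain ⟨x1, hx1, h⟩ := evx _ hz
    refine ⟨x1 / 2, by positivity, 1, le_rfl, 1, Or.inl rfl, fun _ => 0, fun _ => 0, fun _ => 0, ?_⟩
    intro X hX hX1
    refine ⟨le_rfl, hX.le, fun x hx => ?_⟩
    have hx0 : 0 < x := hX.trans_le hx.1
    have hxx : x < x1 := by linarith [hx.2]
    refine ⟨?_, hasDerivAt_const _ _, by norm_num, by simp, by rw [h x hx0 hxx]; simp⟩
    refine (hasDerivAt_const x (0:ℝ)).congr_of_eventuallyEq ?_
    filter_upwards [Ioo_mem_nhds hx0 hxx] with y hy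
    rw [h y hy.1 hy.2, mul_zero]
  · obtain ⟨k, E, hE, hE0, hk⟩ := hd.exists_eventuallyEq_pow_smul_nonzero_iff.2 hz
    have hk1 : 1 ≤ k := by
      by_contra hk0
      have : k = 0 := by omega
      subst this
      have := hk.self_of_nhds
      simp at this; exact hE0 this.symm
    set a : ℝ := 1 + k * μ with ha
    have hkμ : 0 < (k:ℝ) * μ := by positivity
    set E1 : ℝ → ℝ := fun ξ => a * E ξ + μ * (ξ * deriv E ξ) with hE1
    have hE1a : AnalyticAt ℝ E1 0 :=
      (analyticAt_const.mul hE).add (analyticAt_const.mul (analyticAt_id.mul hE.deriv))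
    set E2 : ℝ → ℝ := fun ξ => (a - 1) * E1 ξ + μ * (ξ * deriv E1 ξ) with hE2
    have hE2a : AnalyticAt ℝ E2 0 :=
      (analyticAt_const.mul hE1a).add (analyticAt_const.mul (analyticAt_id.mul hE1a.deriv))
    have hE10 : E1 0 = a * E 0 := by simp [hE1]
    have hE20 : E2 0 = (a - 1) * (a * E 0) := by simp [hE2, hE10]
    obtain ⟨s, hs, hsE⟩ : ∃ s : ℝ, (s = 1 ∨ s = -1) ∧ s * E 0 = |E 0| := by
      rcases le_total 0 (E 0) with h | h
      · exact ⟨1, Or.inl rfl, by rw [abs_of_nonneg h, one_mul]⟩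
      · exact ⟨-1, Or.inr rfl, by rw [abs_of_nonpos h]; ring⟩
    have hE0p : 0 < |E 0| := abs_pos.2 hE0
    set c := (a - 1) * a * |E 0| / 2 with hc
    have hapos : 0 < a := by linarith
    have hcpos : 0 < c := by
      have : 0 < a - 1 := by linarith
      positivity
    have ev1 : ∀ᶠ ξ in 𝓝 0, |E ξ| < 2 * |E 0| :=
      (hE.continuousAt.abs).eventually_lt continuousAt_const (by linarith)
    have ev2 : ∀ᶠ ξ in 𝓝 0, |E1 ξ| < |E1 0| + 1 :=
      (hE1a.continuousAt.abs).eventually_lt continuousAt_const (by linarith)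
    have ev3 : ∀ᶠ ξ in 𝓝 0, c < s * E2 ξ := by
      refine continuousAt_const.eventually_lt (continuousAt_const.mul hE2a.continuousAt) ?_
      rw [hE20, show s * ((a-1) * (a * E 0)) = (a-1)*a*(s * E 0) by ring, hsE]
      linarith
    have ev := ((ev1.and (ev2.and ev3)).and (hk.and
      (hE.eventually_analyticAt.and hE1a.eventually_analyticAt)))
    obtain ⟨x1, hx1, h⟩ := evx _ ev
    have hpw : ∀ η > (0:ℝ), ∃ x2 > (0:ℝ), ∀ x : ℝ, 0 < x → x < x2 → x ^ (a - 1) < η := by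
      intro η hη
      have := (tendsto_rpow_zero_right (μ := a - 1) (by linarith)).eventually (gt_mem_nhds hη)
      obtain ⟨ε, hε, h⟩ := Metric.eventually_nhds_iff.1 this
      exact ⟨ε, hε, fun x h0 h1 => h (by rw [dist_eq, sub_zero, abs_of_pos h0]; exact h1)⟩
    obtain ⟨x2, hx2, h2⟩ := hpw (4 / c) (by positivity)
    obtain ⟨x3, hx3, h3⟩ := hpw (1 / (2 * (|E1 0| + 1))) (by positivity)
    refine ⟨min (x1 / 2) (min x2 (x3 / 2)), by positivity, max 1 (2 ^ a * (2 * |E 0|) / (c / 4)),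
      le_max_left _ _, s, hs,
      fun x => x ^ (a - 1) * E1 (x ^ μ), fun x => x ^ (a - 1 - 1) * E2 (x ^ μ),
      fun X => c / 4 * X ^ a, ?_⟩
    intro X hX hXlt
    have l1 : X < x1 / 2 := hXlt.trans_le (min_le_left _ _)
    have l2 : X < x2 := hXlt.trans_le ((min_le_right _ _).trans (min_le_left _ _))
    have l3 : X < x3 / 2 := hXlt.trans_le ((min_le_right _ _).trans (min_le_right _ _))
    have hXa : X ^ a = X ^ (a - 1) * X := by rw [rpow_sub_one hX.ne']; field_simp
    refine ⟨by positivity, ?_, ?_⟩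
    · beta_reduce; rw [hXa]
      have := (h2 X hX l2).le
      have h5 : c / 4 * X ^ (a - 1) ≤ 1 := by
        calc _ ≤ c / 4 * (4 / c) := by gcongr
          _ = 1 := by field_simp
      nlinarith
    intro x hx
    have hx0 : 0 < x := hX.trans_le hx.1
    have hxx : x < x1 := by linarith [hx.2]
    obtain ⟨⟨q1, q2, q3⟩, q4, q5, q6⟩ := h x hx0 hxx
    have Qeq : ∀ y, 0 < y → y < x1 → y * (e (y ^ μ) - e 0) = y ^ a * E (y ^ μ) := by
      intro y hy0 hy1
      have := (h y hy0 hy1).2.1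
      simp only [sub_zero, smul_eq_mul] at this
      rw [this, ha, Real.rpow_add hy0, Real.rpow_one, mul_comm (k:ℝ) μ, Real.rpow_mul hy0.le,
        Real.rpow_natCast]
      ring
    refine ⟨?_, ?_, ?_, ?_, ?_⟩
    · refine (hasDerivAt_rpow_mul_comp hx0 q5.differentiableAt).congr_of_eventuallyEq ?_
      filter_upwards [Ioo_mem_nhds hx0 hxx] with y hy
      exact Qeq y hy.1 hy.2
    · exact hasDerivAt_rpow_mul_comp hx0 q6.differentiableAt
    · rw [abs_mul, abs_of_pos (Real.rpow_pos_of_pos hx0 _)]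
      have := (h3 x hx0 (by linarith [hx.2])).le
      calc x ^ (a - 1) * |E1 (x ^ μ)| ≤ 1 / (2 * (|E1 0| + 1)) * (|E1 0| + 1) := by
            gcongr
        _ = 1 / 2 := by
          have : |E1 0| + 1 ≠ 0 := by positivity
          field_simp
    · have e5 : x ^ (a - 1 - 1) = x ^ a / x ^ 2 := by
        rw [show a - 1 - 1 = a - 2 by ring, Real.rpow_sub hx0, Real.rpow_two]
      have e6 : X ^ a ≤ x ^ a := Real.rpow_le_rpow hX.le hx.1 hapos.le
      have e7 : 1 / 4 ≤ X ^ 2 / x ^ 2 := by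
        rw [div_le_div_iff₀ (by norm_num) (by positivity)]
        nlinarith [hx.2]
      beta_reduce; rw [e5]
      calc c / 4 * X ^ a = (1 / 4) * (X ^ a * c) := by ring
        _ ≤ (X ^ 2 / x ^ 2) * (x ^ a * (s * E2 (x ^ μ))) := by
          apply mul_le_mul e7 _ (by positivity) (by positivity)
          exact mul_le_mul e6 q3.le hcpos.le (by positivity)
        _ = _ := by ring
    · rw [Qeq x hx0 hxx, abs_mul, abs_of_pos (Real.rpow_pos_of_pos hx0 _)]
      have e6 : x ^ a ≤ 2 ^ a * X ^ a := by
        rw [← Real.mul_rpow (by norm_num) hX.le]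
        exact Real.rpow_le_rpow hx0.le hx.2 hapos.le
      calc x ^ a * |E (x ^ μ)| ≤ (2 ^ a * X ^ a) * (2 * |E 0|) := by gcongr
        _ = (2 ^ a * (2 * |E 0|) / (c / 4)) * (c / 4 * X ^ a) := by field_simp
        _ ≤ _ := by gcongr; exact le_max_right _ _

def HP : Set V2 := {p | 0 < p.1}

def RR (t u : ℝ) : ℝ := (2 + nrm2 (t, u)) ^ (-(1/2 : ℝ)) * (Real.log (2 + nrm2 (t, u))) ^ 2

def Phi (M T : ℕ) (e : ℝ → ℝ) (q : V2) : V2 :=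
  (q.1 ^ M, q.1 ^ M * (e q.1 + q.1 ^ T * q.2))

def Bdd (g β : V2 → ℝ) : Prop :=
  ∃ C, ∀ t u, ‖oscInt (fun p => β p * g p) HP t u‖ ≤ C * RR t u

def Sml (r : ℝ) : Set V2 := {p | 0 < p.1 ∧ p.1 < r ∧ |p.2| < r}

structure Ctx {ι : Type} [Fintype ι] (fh : ι → V2 → ℝ) (γ : ι → ℝ) (E : Set V2)
    (g : V2 → ℝ) : Prop where
  g0 : IntegrableOn g HP
  gn : ∀ p, 0 ≤ g p
  g1 : ∃ r > 0, ∀ p ∈ Sml r, g p = E.indicator (fun p => ∏ i, |fh i p| ^ γ i) p ∧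
    (p ∈ frontier E → ∃ i, fh i p = 0)
  g3 : ∀ c1 : ℝ, ∃ r > 0, ∃ C, ∀ L ≥ (2:ℝ),
    ∫⁻ p in Sml r, ENNReal.ofReal (g p / (1 + √(L * |p.2 - c1 * p.1|))) ≤
      ENNReal.ofReal (C * (L ^ (-(1/2:ℝ)) * Real.log L ^ 2))

def EBat (F : V2 → ℝ) (C : ℝ) (q : V2) : Prop :=
  DifferentiableAt ℝ F q ∧ |F q| ≤ C ∧ |q.1 * fderiv ℝ F q (1, 0)| ≤ C ∧
    |q.2 * fderiv ℝ F q (0, 1)| ≤ C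

def LDat (F : V2 → ℝ) (C : ℝ) (q : V2) : Prop :=
  DifferentiableAt ℝ F q ∧ F q ≠ 0 ∧ |q.1 * fderiv ℝ F q (1, 0)| ≤ C * |F q| ∧
    |q.2 * fderiv ℝ F q (0, 1)| ≤ C * |F q|

lemma LDat.nonneg {F : V2 → ℝ} {C : ℝ} {q : V2} (h : LDat F C q) : 0 ≤ C := by
  have h1 := (abs_nonneg _).trans h.2.2.1
  exact nonneg_of_mul_nonneg_left h1 (abs_pos.2 h.2.1)

lemma LDat.mul {F G : V2 → ℝ} {C D : ℝ} {q : V2} (hF : LDat F C q) (hG : LDat G D q) :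
    LDat (fun q => F q * G q) (C + D) q := by
  obtain ⟨a1, a2, a3, a4⟩ := hF
  obtain ⟨b1, b2, b3, b4⟩ := hG
  refine ⟨a1.mul b1, mul_ne_zero a2 b2, ?_, ?_⟩
  · rw [fderiv_fun_mul a1 b1]
    simp only [add_apply, _root_.smul_apply, smul_eq_mul]
    rw [show q.1 * (F q * fderiv ℝ G q (1, 0) + G q * fderiv ℝ F q (1, 0)) =
      F q * (q.1 * fderiv ℝ G q (1, 0)) + G q * (q.1 * fderiv ℝ F q (1, 0)) by ring]
    refine (abs_add_le _ _).trans ?_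
    rw [abs_mul (F q), abs_mul (G q), abs_mul (F q) (G q)]
    nlinarith [mul_le_mul_of_nonneg_left b3 (abs_nonneg (F q)),
      mul_le_mul_of_nonneg_left a3 (abs_nonneg (G q))]
  · rw [fderiv_fun_mul a1 b1]
    simp only [add_apply, _root_.smul_apply, smul_eq_mul]
    rw [show q.2 * (F q * fderiv ℝ G q (0, 1) + G q * fderiv ℝ F q (0, 1)) =
      F q * (q.2 * fderiv ℝ G q (0, 1)) + G q * (q.2 * fderiv ℝ F q (0, 1)) by ring]
    refine (abs_add_le _ _).trans ?_
    rw [abs_mul (F q), abs_mul (G q), abs_mul (F q) (G q)]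
    nlinarith [mul_le_mul_of_nonneg_left b4 (abs_nonneg (F q)),
      mul_le_mul_of_nonneg_left a4 (abs_nonneg (G q))]

lemma EBat.mul_LDat {F G : V2 → ℝ} {C D : ℝ} {q : V2} (hF : EBat F C q) (hG : LDat G D q) :
    EBat (fun q => F q * G q) (C * (1 + D) * |G q|) q := by
  have hD := hG.nonneg
  obtain ⟨a1, a2, a3, a4⟩ := hF
  obtain ⟨b1, b2, b3, b4⟩ := hG
  have hC : 0 ≤ C := (abs_nonneg _).trans a2
  refine ⟨a1.mul b1, ?_, ?_, ?_⟩
  · rw [abs_mul]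
    have := mul_le_mul_of_nonneg_right a2 (abs_nonneg (G q))
    have h2 : 0 ≤ C * D * |G q| := by positivity
    nlinarith
  · rw [fderiv_fun_mul a1 b1]
    simp only [add_apply, _root_.smul_apply, smul_eq_mul]
    rw [show q.1 * (F q * fderiv ℝ G q (1, 0) + G q * fderiv ℝ F q (1, 0)) =
      F q * (q.1 * fderiv ℝ G q (1, 0)) + G q * (q.1 * fderiv ℝ F q (1, 0)) by ring]
    refine (abs_add_le _ _).trans ?_
    rw [abs_mul, abs_mul (G q)]
    have := mul_le_mul a2 b3 (abs_nonneg _) hC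
    nlinarith [mul_le_mul_of_nonneg_left a3 (abs_nonneg (G q))]
  · rw [fderiv_fun_mul a1 b1]
    simp only [add_apply, _root_.smul_apply, smul_eq_mul]
    rw [show q.2 * (F q * fderiv ℝ G q (0, 1) + G q * fderiv ℝ F q (0, 1)) =
      F q * (q.2 * fderiv ℝ G q (0, 1)) + G q * (q.2 * fderiv ℝ F q (0, 1)) by ring]
    refine (abs_add_le _ _).trans ?_
    rw [abs_mul, abs_mul (G q)]
    have := mul_le_mul a2 b4 (abs_nonneg _) hC
    nlinarith [mul_le_mul_of_nonneg_left a4 (abs_nonneg (G q))]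

lemma LDat.abs_rpow {F : V2 → ℝ} {C : ℝ} {q : V2} (hF : LDat F C q) (γ : ℝ) :
    LDat (fun q => |F q| ^ γ) (|γ| * C) q := by
  obtain ⟨a1, a2, a3, a4⟩ := hF
  have hp : 0 < |F q| := abs_pos.2 a2
  have e : (fun q => |F q| ^ γ) = fun q => (F q ^ 2) ^ (γ / 2) := by
    funext q
    rw [← sq_abs, ← Real.rpow_natCast, ← Real.rpow_mul (abs_nonneg _)]
    congr 1; push_cast; ring
  have hd : HasFDerivAt (fun q => |F q| ^ γ) ((γ * |F q| ^ γ / F q) • fderiv ℝ F q) q := by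
    rw [e]
    have h1 := (a1.hasFDerivAt.pow 2).rpow_const (p := γ / 2) (Or.inl (by positivity))
    refine h1.congr_fderiv ?_
    have e3 : |F q| ^ γ = (F q ^ 2) ^ (γ / 2) := congrFun e q
    rw [smul_smul, e3, rpow_sub_one (by positivity)]
    congr 1
    simp
    field_simp
  refine ⟨hd.differentiableAt, (Real.rpow_pos_of_pos hp _).ne', ?_, ?_⟩
  · rw [hd.fderiv]
    simp only [_root_.smul_apply, smul_eq_mul, abs_mul, abs_div]
    rw [abs_of_pos (Real.rpow_pos_of_pos hp γ)]
    rw [abs_mul] at a3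
    have h5 : 0 < |F q| ^ γ := Real.rpow_pos_of_pos hp γ
    calc |q.1| * (|γ| * |F q| ^ γ / |F q| * |fderiv ℝ F q (1, 0)|)
        = |γ| * |F q| ^ γ / |F q| * (|q.1| * |fderiv ℝ F q (1, 0)|) := by ring
      _ ≤ |γ| * |F q| ^ γ / |F q| * (C * |F q|) := by gcongr
      _ = _ := by field_simp
  · rw [hd.fderiv]
    simp only [_root_.smul_apply, smul_eq_mul, abs_mul, abs_div]
    rw [abs_of_pos (Real.rpow_pos_of_pos hp γ)]
    rw [abs_mul] at a4
    have h5 : 0 < |F q| ^ γ := Real.rpow_pos_of_pos hp γ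
    calc |q.2| * (|γ| * |F q| ^ γ / |F q| * |fderiv ℝ F q (0, 1)|)
        = |γ| * |F q| ^ γ / |F q| * (|q.2| * |fderiv ℝ F q (0, 1)|) := by ring
      _ ≤ |γ| * |F q| ^ γ / |F q| * (C * |F q|) := by gcongr
      _ = _ := by field_simp

lemma LDat.prod {ι : Type} (s : Finset ι) {F : ι → V2 → ℝ} {C : ι → ℝ} {q : V2}
    (h : ∀ i, LDat (F i) (C i) q) : LDat (fun q => ∏ i ∈ s, F i q) (∑ i ∈ s, C i) q := by
  classical
  induction s using Finset.induction_on with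
  | empty =>
    refine ⟨by simp, by simp, by simp, by simp⟩
  | insert a s ha ih =>
    simp_rw [Finset.prod_insert ha]
    rw [Finset.sum_insert ha]
    exact (h a).mul ih

def Wm (μ τ σ : ℝ) (x z : ℝ) : V2 := (x ^ μ, σ * z * x ^ (-τ))

lemma chain_x {F : V2 → ℝ} {D μ τ σ x z : ℝ} (hμ : 0 ≤ μ) (hτ : 0 ≤ τ) (hx : 0 < x)
    (h : EBat F D (Wm μ τ σ x z)) :
    ∃ d, HasDerivAt (fun x => F (Wm μ τ σ x z)) d x ∧ |d| ≤ (μ + τ) * D / x := by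
  obtain ⟨a1, a2, a3, a4⟩ := h
  have h1 := hasDerivAt_rpow_const (x := x) (p := μ) (Or.inl hx.ne')
  have h2 := (hasDerivAt_rpow_const (x := x) (p := -τ) (Or.inl hx.ne')).const_mul (σ * z)
  have h3 := a1.hasFDerivAt.comp_hasDerivAt x (h1.prodMk h2)
  refine ⟨_, h3, ?_⟩
  set A := fderiv ℝ F (Wm μ τ σ x z)
  have e : (μ * x ^ (μ - 1), σ * z * (-τ * x ^ (-τ - 1))) =
      (μ * x ^ (μ - 1)) • ((1:ℝ), (0:ℝ)) + (σ * z * (-τ * x ^ (-τ - 1))) • ((0:ℝ), (1:ℝ)) := by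
    simp
  rw [e, map_add, map_smul, map_smul, smul_eq_mul, smul_eq_mul, rpow_sub_one hx.ne',
    rpow_sub_one hx.ne']
  have e2 : μ * (x ^ μ / x) * A (1, 0) + σ * z * (-τ * (x ^ (-τ) / x)) * A (0, 1)
      = (μ * (x ^ μ * A (1, 0)) - τ * ((σ * z * x ^ (-τ)) * A (0, 1))) / x := by
    field_simp; ring
  rw [e2, abs_div, abs_of_pos hx]
  gcongr
  refine (abs_sub _ _).trans ?_
  rw [abs_mul, abs_mul τ, abs_of_nonneg hμ, abs_of_nonneg hτ]
  have := mul_le_mul_of_nonneg_left a3 hμ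
  have := mul_le_mul_of_nonneg_left a4 hτ
  simp only [Wm] at *
  linarith

lemma chain_z {F : V2 → ℝ} {D μ τ σ x z : ℝ} (hz : 0 < z)
    (h : EBat F D (Wm μ τ σ x z)) :
    ∃ d, HasDerivAt (fun z => F (Wm μ τ σ x z)) d z ∧ |d| ≤ D / z := by
  obtain ⟨a1, a2, a3, a4⟩ := h
  have h2 := ((hasDerivAt_id z).const_mul σ).mul_const (x ^ (-τ))
  have h3 := a1.hasFDerivAt.comp_hasDerivAt z ((hasDerivAt_const z (x ^ μ)).prodMk h2)
  refine ⟨_, h3, ?_⟩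
  set A := fderiv ℝ F (Wm μ τ σ x z)
  have e : ((0:ℝ), σ * 1 * x ^ (-τ)) = (σ * x ^ (-τ)) • ((0:ℝ), (1:ℝ)) := by simp
  rw [e, map_smul, smul_eq_mul]
  have e2 : σ * x ^ (-τ) * A (0, 1) = ((σ * z * x ^ (-τ)) * A (0, 1)) / z := by field_simp
  rw [e2, abs_div, abs_of_pos hz]
  gcongr
  exact a4

lemma LDat.eb {F : V2 → ℝ} {C : ℝ} {q : V2} (h : LDat F C q) :
    EBat F ((1 + C) * |F q|) q := by
  have hC := h.nonneg
  obtain ⟨a1, a2, a3, a4⟩ := h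
  have := abs_nonneg (F q)
  exact ⟨a1, by nlinarith, by nlinarith, by nlinarith⟩

lemma log_lip {f : ℝ → ℝ} {X D x : ℝ} (hX : 0 < X) (hD : 0 ≤ D)
    (hf : ∀ x ∈ Icc X (2 * X), 0 < f x)
    (hd : ∀ x ∈ Icc X (2 * X), ∃ d, HasDerivAt f d x ∧ |d| ≤ D * f x / x) (hx : x ∈ Icc X (2 * X)) :
    |Real.log (f x) - Real.log (f X)| ≤ D := by
  have h1 : ∀ y ∈ Icc X (2 * X), ∃ d, HasDerivAt (fun y => Real.log (f y)) d y ∧ |d| ≤ D / X := by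
    intro y hy
    obtain ⟨d, h2, h3⟩ := hd y hy
    refine ⟨_, h2.log (hf y hy).ne', ?_⟩
    rw [abs_div, abs_of_pos (hf y hy), div_le_iff₀ (hf y hy)]
    refine h3.trans ?_
    have hy0 : 0 < y := hX.trans_le hy.1
    rw [div_mul_eq_mul_div]
    exact div_le_div_of_nonneg_left (mul_nonneg hD (hf y hy).le) hX hy.1
  choose! d hd1 hd2 using h1
  have := (convex_Icc X (2 * X)).norm_image_sub_le_of_norm_hasDerivWithin_le
    (f := fun y => Real.log (f y)) (f' := d) (C := D / X) (x := X) (y := x)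
    (fun y hy => (hd1 y hy).hasDerivWithinAt) (fun y hy => hd2 y hy) ⟨le_rfl, by linarith⟩ hx
  rw [norm_eq_abs, norm_eq_abs] at this
  refine this.trans ?_
  rw [abs_of_nonneg (by linarith [hx.1])]
  calc D / X * (x - X) ≤ D / X * X := by
        apply mul_le_mul_of_nonneg_left _ (by positivity); linarith [hx.2]
    _ = D := by field_simp

lemma compar {F : V2 → ℝ} {C μ τ σ X Z : ℝ} (hμ : 0 ≤ μ) (hτ : 0 ≤ τ) (hX : 0 < X) (hZ : 0 < Z)
    (hC : 0 ≤ C) (hpos : ∀ q, 0 ≤ F q)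
    (h : ∀ x ∈ Icc X (2 * X), ∀ z ∈ Icc Z (2 * Z), LDat F C (Wm μ τ σ x z)) {x z : ℝ}
    (hx : x ∈ Icc X (2 * X)) (hz : z ∈ Icc Z (2 * Z)) :
    F (Wm μ τ σ x z) ≤ Real.exp ((μ + τ + 1) * (1 + C)) * F (Wm μ τ σ X Z) ∧
    F (Wm μ τ σ X Z) ≤ Real.exp ((μ + τ + 1) * (1 + C)) * F (Wm μ τ σ x z) := by
  have hp : ∀ x ∈ Icc X (2 * X), ∀ z ∈ Icc Z (2 * Z), 0 < F (Wm μ τ σ x z) := fun x hx z hz =>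
    lt_of_le_of_ne (hpos _) (h x hx z hz).2.1.symm
  have hX' : X ∈ Icc X (2 * X) := ⟨le_rfl, by linarith⟩
  have hZ' : Z ∈ Icc Z (2 * Z) := ⟨le_rfl, by linarith⟩
  have l1 := log_lip (f := fun x => F (Wm μ τ σ x Z)) (D := (μ + τ) * (1 + C)) hX (by positivity)
    (fun x hx => hp x hx Z hZ') (fun x hx => by
      obtain ⟨d, h1, h2⟩ := chain_x hμ hτ (hX.trans_le hx.1) (h x hx Z hZ').eb
      refine ⟨d, h1, h2.trans (le_of_eq ?_)⟩
      rw [abs_of_pos (hp x hx Z hZ')]; ring) hx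
  have l2 := log_lip (f := fun z => F (Wm μ τ σ x z)) (D := (1 + C)) hZ (by positivity)
    (fun z hz => hp x hx z hz) (fun z hz => by
      obtain ⟨d, h1, h2⟩ := chain_z (hZ.trans_le hz.1) (h x hx z hz).eb
      refine ⟨d, h1, h2.trans (le_of_eq ?_)⟩
      rw [abs_of_pos (hp x hx z hz)]) hz
  have p1 := hp x hx z hz
  have p2 := hp X hX' Z hZ'
  rw [abs_le] at l1 l2
  constructor
  · rw [← Real.log_le_log_iff p1 (by positivity), Real.log_mul (Real.exp_pos _).ne' p2.ne',
      Real.log_exp]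
    linarith [l1.2, l2.2]
  · rw [← Real.log_le_log_iff p2 (by positivity), Real.log_mul (Real.exp_pos _).ne' p1.ne',
      Real.log_exp]
    linarith [l1.1, l2.1]

def shr (Q : ℝ → ℝ) (hQ : Measurable Q) (σ : ℝ) (hσ : σ * σ = 1) : V2 ≃ᵐ V2 where
  toFun q := (q.1, Q q.1 + σ * q.2)
  invFun p := (p.1, σ * (p.2 - Q p.1))
  left_inv q := by
    ext
    · rfl
    · show σ * (Q q.1 + σ * q.2 - Q q.1) = q.2
      linear_combination q.2 * hσ
  right_inv q := by
    ext
    · rfl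
    · show Q q.1 + σ * (σ * (q.2 - Q q.1)) = q.2
      linear_combination (q.2 - Q q.1) * hσ
  measurable_toFun := by
    show Measurable fun q : V2 => (q.1, Q q.1 + σ * q.2)
    fun_prop
  measurable_invFun := by
    show Measurable fun p : V2 => (p.1, σ * (p.2 - Q p.1))
    fun_prop

lemma shr_mp (Q : ℝ → ℝ) (hQ : Measurable Q) (σ : ℝ) (hσ : σ * σ = 1) :
    MeasurePreserving (shr Q hQ σ hσ) volume volume := by
  have h1 : ∀ x : ℝ, MeasurePreserving (fun z : ℝ => Q x + σ * z) volume volume := by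
    intro x
    have hs : σ = 1 ∨ σ = -1 := mul_self_eq_one_iff.1 hσ
    have h2 : MeasurePreserving (fun z : ℝ => σ * z) volume volume := by
      rcases hs with rfl | rfl
      · simp only [one_mul]; exact MeasurePreserving.id (volume : Measure ℝ)
      · simpa using Measure.measurePreserving_neg (volume : Measure ℝ)
    exact (measurePreserving_add_left volume (Q x)).comp h2
  have := MeasurePreserving.skew_product (μa := (volume : Measure ℝ)) (μb := (volume : Measure ℝ))
    (μc := (volume : Measure ℝ)) (μd := (volume : Measure ℝ)) (f := id)
    (MeasurePreserving.id _) (g := fun x z => Q x + σ * z) (by unfold Function.uncurry; fun_prop)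
    (Filter.Eventually.of_forall fun x => (h1 x).map_eq)
  exact this

def BX (Q : ℝ → ℝ) (σ X Z : ℝ) : Set V2 :=
  {p | p.1 ∈ Ioc X (2 * X) ∧ σ * (p.2 - Q p.1) ∈ Ioc Z (2 * Z)}

lemma shr_pre (Q : ℝ → ℝ) (hQ : Measurable Q) (σ : ℝ) (hσ : σ * σ = 1) (X Z : ℝ) :
    shr Q hQ σ hσ ⁻¹' BX Q σ X Z = Ioc X (2 * X) ×ˢ Ioc Z (2 * Z) := by
  ext q
  have : σ * (Q q.1 + σ * q.2 - Q q.1) = q.2 := by linear_combination q.2 * hσ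
  show (q.1 ∈ Ioc X (2 * X) ∧ σ * (Q q.1 + σ * q.2 - Q q.1) ∈ Ioc Z (2 * Z)) ↔ _
  rw [this]; rfl

lemma measurableSet_BX (Q : ℝ → ℝ) (hQ : Measurable Q) (σ X Z : ℝ) :
    MeasurableSet (BX Q σ X Z) := by
  have h1 : Measurable fun p : V2 => σ * (p.2 - Q p.1) := by fun_prop
  exact (measurable_fst measurableSet_Ioc).inter (h1 measurableSet_Ioc)

lemma box_leaf {X Z K C H C0 t u s σ μ τ c1 : ℝ} (hX : 0 < X) (hX1 : X ≤ 1)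
    (hZ : 0 < Z) (hZ1 : Z ≤ 1) (hZX : Z ≤ 4 * X) (hH : 0 ≤ H) (hHX : H ≤ X)
    (hC0 : 1 ≤ C0) (hK : 0 ≤ K) (hC : 0 ≤ C) (hμ : 0 ≤ μ) (hτ : 0 ≤ τ)
    (hs : s = 1 ∨ s = -1) (hσ : σ * σ = 1)
    (Q Q2' Q2'' : ℝ → ℝ) (hQ : Measurable Q)
    (dQ : ∀ x ∈ Icc X (2 * X), HasDerivAt (fun x => Q x - c1 * x) (Q2' x) x)
    (dQ' : ∀ x ∈ Icc X (2 * X), HasDerivAt Q2' (Q2'' x) x)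
    (bQ : ∀ x ∈ Icc X (2 * X), |Q x - c1 * x| ≤ C0 * H)
    (bQ' : ∀ x ∈ Icc X (2 * X), |Q2' x| ≤ 1 / 2)
    (bQ'' : ∀ x ∈ Icc X (2 * X), H ≤ X ^ 2 * (s * Q2'' x))
    (b 𝒢 β g : V2 → ℝ) (h𝒢 : ∀ q, 0 ≤ 𝒢 q)
    (hLD : ∀ x ∈ Icc X (2 * X), ∀ z ∈ Icc Z (2 * Z), LDat 𝒢 C (Wm μ τ σ x z))
    (hb : ∀ x ∈ Icc X (2 * X), ∀ z ∈ Icc Z (2 * Z), EBat b K (Wm μ τ σ x z))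
    (hβ : ∀ x ∈ Icc X (2 * X), ∀ z ∈ Icc Z (2 * Z), β (x, Q x + σ * z) = b (Wm μ τ σ x z))
    (hg : ∀ x ∈ Icc X (2 * X), ∀ z ∈ Icc Z (2 * Z), g (x, Q x + σ * z) = 𝒢 (Wm μ τ σ x z))
    (hint : IntegrableOn (fun p => β p * g p) (BX Q σ X Z)) :
    ‖oscInt (fun p => β p * g p) (BX Q σ X Z) t u‖ₑ ≤
      ENNReal.ofReal (23 * ((2 + |c1|) * (C0 + 2)) * (K * (1 + C) * (μ + τ + 1)) *
        Real.exp ((μ + τ + 1) * (1 + C)) ^ 2) *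
      ∫⁻ p in BX Q σ X Z,
        ENNReal.ofReal (g p / (1 + √((2 + nrm2 (t, u)) * |p.2 - c1 * p.1|))) := by
  set W := Wm μ τ σ with hW
  set S := shr Q hQ σ hσ with hS
  have hSa : ∀ q, S q = (q.1, Q q.1 + σ * q.2) := fun q => rfl
  have hmp := shr_mp Q hQ σ hσ
  have hpre := shr_pre Q hQ σ hσ X Z
  set L := 2 + nrm2 (t, u) with hL
  have hL0 : 0 ≤ L := by have := sqrt_nonneg ((t,u).1^2 + (t,u).2^2); rw [hL, nrm2]; linarith
  set D := Real.exp ((μ + τ + 1) * (1 + C)) with hD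
  have hDpos : 0 < D := Real.exp_pos _
  set G0 := 𝒢 (W X Z) with hG0
  have hG0n : 0 ≤ G0 := h𝒢 _
  have hX' : X ∈ Icc X (2 * X) := ⟨le_rfl, by linarith⟩
  have hZ' : Z ∈ Icc Z (2 * Z) := ⟨le_rfl, by linarith⟩
  have cmp : ∀ x ∈ Icc X (2 * X), ∀ z ∈ Icc Z (2 * Z), 𝒢 (W x z) ≤ D * G0 ∧ G0 ≤ D * 𝒢 (W x z) :=
    fun x hx z hz => compar hμ hτ hX hZ hC h𝒢 hLD hx hz
  set N := ‖oscInt (fun p => β p * g p) (BX Q σ X Z) t u‖ with hN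
  have hP : ∀ x ∈ Icc X (2 * X), ∀ z ∈ Icc Z (2 * Z),
      EBat (fun q => b q * 𝒢 q) (K * (1 + C) * (D * G0)) (W x z) := by
    intro x hx z hz
    obtain ⟨a1, a2, a3, a4⟩ := (hb x hx z hz).mul_LDat (hLD x hx z hz)
    have : K * (1 + C) * |𝒢 (W x z)| ≤ K * (1 + C) * (D * G0) := by
      rw [abs_of_nonneg (h𝒢 _)]; have := (cmp x hx z hz).1; gcongr
    exact ⟨a1, a2.trans this, a3.trans this, a4.trans this⟩
  have hx1 : ∀ x ∈ Icc X (2 * X), ∀ z ∈ Icc Z (2 * Z), ∃ d,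
      HasDerivAt (fun x => b (W x z) * 𝒢 (W x z)) d x ∧ |d| ≤
        (K * (1 + C) * (μ + τ + 1)) * (D * G0) / X := by
    intro x hx z hz
    obtain ⟨d, h1, h2⟩ := chain_x hμ hτ (hX.trans_le hx.1) (hP x hx z hz)
    refine ⟨d, h1, h2.trans ?_⟩
    have h0 : 0 ≤ K * (1 + C) * (D * G0) := by positivity
    have hx0 : 0 < x := hX.trans_le hx.1
    refine div_le_div₀ (by positivity) ?_ hX hx.1
    nlinarith
  have hz1 : ∀ x ∈ Icc X (2 * X), ∀ z ∈ Icc Z (2 * Z), ∃ d,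
      HasDerivAt (fun z => b (W x z) * 𝒢 (W x z)) d z ∧ |d| ≤
        (K * (1 + C) * (μ + τ + 1)) * (D * G0) / Z := by
    intro x hx z hz
    obtain ⟨d, h1, h2⟩ := chain_z (hZ.trans_le hz.1) (hP x hx z hz)
    refine ⟨d, h1, h2.trans ?_⟩
    have h0 : 0 ≤ K * (1 + C) * (D * G0) := by positivity
    refine div_le_div₀ (by positivity) ?_ hZ hz.1
    nlinarith
  choose! Bx hBx bBx using hx1
  choose! Bz hBz bBz using hz1
  have hI : oscInt (fun p => β p * g p) (BX Q σ X Z) t u =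
      ∫ q in Ioc X (2 * X) ×ˢ Ioc Z (2 * Z), ((b (W q.1 q.2) * 𝒢 (W q.1 q.2) : ℝ) : ℂ) *
      Complex.exp (Complex.I * (((t + u * c1) * q.1 + u * ((Q q.1 - c1 * q.1) + σ * q.2) : ℝ) : ℂ)) := by
    rw [oscInt, ← hmp.setIntegral_preimage_emb S.measurableEmbedding, hpre]
    apply setIntegral_congr_fun (measurableSet_Ioc.prod measurableSet_Ioc)
    intro q hq
    have q1 := Ioc_subset_Icc_self hq.1
    have q2 := Ioc_subset_Icc_self hq.2
    simp only [← hS, hSa]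
    rw [hβ _ q1 _ q2, hg _ q1 _ q2]
    congr 2
    push_cast; ring
  have hint' : IntegrableOn (fun q : V2 => ((b (W q.1 q.2) * 𝒢 (W q.1 q.2) : ℝ) : ℂ) *
      Complex.exp (Complex.I * (((t + u * c1) * q.1 + u * ((Q q.1 - c1 * q.1) + σ * q.2) : ℝ) : ℂ)))
      (Ioc X (2 * X) ×ˢ Ioc Z (2 * Z)) := by
    have h1 : IntegrableOn (fun q : V2 => β (S q) * g (S q)) (Ioc X (2 * X) ×ˢ Ioc Z (2 * Z)) := by
      have := (hmp.integrableOn_comp_preimage S.measurableEmbedding (s := BX Q σ X Z)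
        (f := fun p => β p * g p)).2 hint
      rw [hpre] at this; exact this
    have h2 : IntegrableOn (fun q : V2 => b (W q.1 q.2) * 𝒢 (W q.1 q.2))
        (Ioc X (2 * X) ×ˢ Ioc Z (2 * Z)) := by
      refine h1.congr_fun ?_ (measurableSet_Ioc.prod measurableSet_Ioc)
      intro q hq
      simp only [hSa]
      rw [hβ _ (Ioc_subset_Icc_self hq.1) _ (Ioc_subset_Icc_self hq.2),
        hg _ (Ioc_subset_Icc_self hq.1) _ (Ioc_subset_Icc_self hq.2)]
    have h2' := Integrable.ofReal (𝕜 := ℂ) h2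
    refine Integrable.mono h2' ?_ ?_
    · refine h2'.aestronglyMeasurable.mul ?_
      apply Measurable.aestronglyMeasurable
      fun_prop
    · filter_upwards with q
      rw [norm_mul, mul_comm Complex.I, Complex.norm_exp_ofReal_mul_I, mul_one]
      exact le_rfl
  have hLΛ : L ≤ (2 + |c1|) * (max |t + u * c1| |u| + 1) := by
    have h1 : nrm2 (t, u) ≤ |t| + |u| := by
      rw [nrm2]; apply sqrt_le_iff.2
      refine ⟨by positivity, ?_⟩
      have := mul_nonneg (abs_nonneg t) (abs_nonneg u)
      simp only
      nlinarith [sq_abs t, sq_abs u]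
    have h2 : |t| ≤ |t + u * c1| + |u| * |c1| := by
      rw [← abs_mul]
      have := abs_sub (t + u * c1) (u * c1)
      simpa using this
    have h3 : |t + u * c1| ≤ max |t + u * c1| |u| := le_max_left _ _
    have h4 : |u| ≤ max |t + u * c1| |u| := le_max_right _ _
    set m := max |t + u * c1| |u|
    have := mul_le_mul_of_nonneg_right h4 (abs_nonneg c1)
    nlinarith [abs_nonneg c1]
  have est := box_est (C1 := 2 + |c1|) hX hX1 hZ hZ1 hZX hH hHX hC0
    (by linarith [abs_nonneg c1]) hLΛ hs (mul_self_eq_one_iff.1 hσ)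
    (fun x z => b (W x z) * 𝒢 (W x z)) Bx Bz (fun x => Q x - c1 * x) Q2' Q2'' dQ dQ' bQ' bQ''
    hBx hBz (fun x hx z hz => (hP x hx z hz).2.1.trans (by
      have h0 : 0 ≤ K * (1 + C) * (D * G0) := by positivity
      have : K * (1 + C) * (μ + τ + 1) * (D * G0) = K * (1 + C) * (D * G0) * (μ + τ + 1) := by ring
      rw [this]; nlinarith)) bBx bBz hint'
  rw [← hI, ← hN] at est
  set Y := 1 + √(L * (C0 * H + 2 * Z)) with hY
  have hYpos : 0 < Y := by positivity
  have low : ENNReal.ofReal (G0 / D / Y * (X * Z)) ≤ ∫⁻ p in BX Q σ X Z,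
        ENNReal.ofReal (g p / (1 + √(L * |p.2 - c1 * p.1|))) := by
    rw [← hmp.setLIntegral_comp_preimage_emb S.measurableEmbedding, hpre]
    have hv : volume (Ioc X (2 * X) ×ˢ Ioc Z (2 * Z)) = ENNReal.ofReal (X * Z) := by
      rw [Measure.volume_eq_prod, Measure.prod_prod, Real.volume_Ioc, Real.volume_Ioc,
        ← ENNReal.ofReal_mul (by linarith)]
      congr 1; ring
    rw [ENNReal.ofReal_mul (by positivity), ← hv, ← setLIntegral_const]
    apply setLIntegral_mono' (measurableSet_Ioc.prod measurableSet_Ioc)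
    intro q hq
    have q1 := Ioc_subset_Icc_self hq.1
    have q2 := Ioc_subset_Icc_self hq.2
    apply ENNReal.ofReal_le_ofReal
    rw [← hS, hSa]
    simp only
    rw [hg _ q1 _ q2]
    refine div_le_div₀ (h𝒢 _) ?_ (by positivity) ?_
    · rw [div_le_iff₀ hDpos]; linarith [(cmp _ q1 _ q2).2]
    · rw [hY]
      have : |Q q.1 + σ * q.2 - c1 * q.1| ≤ C0 * H + 2 * Z := by
        have h1 := bQ _ q1
        have h2 : |σ * q.2| ≤ 2 * Z := by
          rw [abs_mul, abs_of_pos (hZ.trans_le q2.1)]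
          rcases mul_self_eq_one_iff.1 hσ with h | h <;> rw [h] <;> simp <;> exact q2.2
        rw [show Q q.1 + σ * q.2 - c1 * q.1 = (Q q.1 - c1 * q.1) + σ * q.2 by ring]
        exact (abs_add_le _ _).trans (add_le_add h1 h2)
      gcongr
  have fin : N ≤ 23 * ((2 + |c1|) * (C0 + 2)) * (K * (1 + C) * (μ + τ + 1)) * D ^ 2 *
      (G0 / D / Y * (X * Z)) := by
    have : N ≤ 23 * ((2 + |c1|) * (C0 + 2)) *
        (K * (1 + C) * (μ + τ + 1) * (D * G0) * X * Z) / Y := by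
      rw [le_div_iff₀ hYpos]; exact est
    refine this.trans (le_of_eq ?_)
    field_simp
  rw [← ofReal_norm, ← hN]
  refine (ENNReal.ofReal_le_ofReal fin).trans ?_
  rw [ENNReal.ofReal_mul (by positivity)]
  gcongr

lemma Phi_Wm {M T : ℕ} (hM : 0 < M) (e : ℝ → ℝ) {x : ℝ} (hx : 0 < x) (σ z : ℝ) :
    Phi M T e (Wm (M:ℝ)⁻¹ (1 + T * (M:ℝ)⁻¹) σ x z) = (x, x * e (x ^ (M:ℝ)⁻¹) + σ * z) := by
  have h1 : (x ^ (M:ℝ)⁻¹) ^ M = x := Real.rpow_inv_natCast_pow hx.le hM.ne'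
  have h2 : (x ^ (M:ℝ)⁻¹) ^ T = x ^ (T * (M:ℝ)⁻¹) := by
    rw [← Real.rpow_natCast, ← Real.rpow_mul hx.le]; congr 1; ring
  simp only [Phi, Wm, h1, h2]
  congr 1
  have h3 : x * x ^ (T * (M:ℝ)⁻¹) * x ^ (-(1 + T * (M:ℝ)⁻¹)) = 1 := by
    rw [← Real.rpow_one_add' hx.le (by positivity), ← Real.rpow_add hx]; simp
  linear_combination (σ * z) * h3

lemma Wm_cmp {M T : ℕ} (hM : 0 < M) {σ X Z x z x' z' : ℝ} (hX : 0 < X) (hZ : 0 < Z)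
    (hσ : σ * σ = 1)
    (hx : x ∈ Icc X (2 * X)) (hz : z ∈ Icc Z (2 * Z))
    (hx' : x' ∈ Icc X (2 * X)) (hz' : z' ∈ Icc Z (2 * Z)) :
    (Wm (M:ℝ)⁻¹ (1 + T * (M:ℝ)⁻¹) σ x z).1 ≤ 2 * (Wm (M:ℝ)⁻¹ (1 + T * (M:ℝ)⁻¹) σ x' z').1 ∧
    |(Wm (M:ℝ)⁻¹ (1 + T * (M:ℝ)⁻¹) σ x z).2| ≤
      2 ^ (T + 2) * |(Wm (M:ℝ)⁻¹ (1 + T * (M:ℝ)⁻¹) σ x' z').2| := by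
  have hx0 : 0 < x := hX.trans_le hx.1
  have hx0' : 0 < x' := hX.trans_le hx'.1
  have hz0 : 0 < z := hZ.trans_le hz.1
  have hz0' : 0 < z' := hZ.trans_le hz'.1
  have hM1 : (M:ℝ)⁻¹ ≤ 1 := inv_le_one_of_one_le₀ (by exact_mod_cast hM)
  have hMp : 0 < (M:ℝ)⁻¹ := by positivity
  simp only [Wm]
  constructor
  · calc x ^ (M:ℝ)⁻¹ ≤ (2 * x') ^ (M:ℝ)⁻¹ := by
          apply Real.rpow_le_rpow hx0.le _ hMp.le; linarith [hx.2, hx'.1]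
      _ = 2 ^ (M:ℝ)⁻¹ * x' ^ (M:ℝ)⁻¹ := Real.mul_rpow (by norm_num) hx0'.le
      _ ≤ 2 ^ (1:ℝ) * x' ^ (M:ℝ)⁻¹ := by
          gcongr; norm_num
      _ = _ := by rw [Real.rpow_one]
  · set τ := 1 + T * (M:ℝ)⁻¹ with hτ
    have hs : |σ| = 1 := by
      rcases mul_self_eq_one_iff.1 hσ with h | h <;> simp [h]
    have hτ1 : τ ≤ (T + 1 : ℕ) := by
      push_cast; rw [hτ]
      have : (T:ℝ) * (M:ℝ)⁻¹ ≤ T * 1 := by gcongr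
      linarith
    have hτ0 : 0 ≤ τ := by positivity
    rw [abs_mul, abs_mul, abs_mul, abs_mul, hs, abs_of_pos hz0, abs_of_pos hz0',
      abs_of_pos (Real.rpow_pos_of_pos hx0 _), abs_of_pos (Real.rpow_pos_of_pos hx0' _)]
    have h1 : x ^ (-τ) ≤ 2 ^ (T + 1) * x' ^ (-τ) := by
      calc x ^ (-τ) ≤ (2⁻¹ * x') ^ (-τ) := by
            apply Real.rpow_le_rpow_of_nonpos (by positivity) _ (by linarith)
            linarith [hx.1, hx'.2]
        _ = 2 ^ τ * x' ^ (-τ) := by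
            rw [Real.mul_rpow (by norm_num) hx0'.le, Real.inv_rpow (by norm_num),
              Real.rpow_neg (by norm_num), inv_inv]
        _ ≤ 2 ^ ((T + 1 : ℕ):ℝ) * x' ^ (-τ) := by gcongr; norm_num
        _ = _ := by rw [Real.rpow_natCast]
    calc 1 * z * x ^ (-τ) ≤ (2 * z') * (2 ^ (T + 1) * x' ^ (-τ)) := by
          rw [one_mul]
          apply mul_le_mul _ h1 (by positivity) (by positivity)
          linarith [hz.2, hz'.1]
      _ = _ := by ring

lemma preconn_frontier {s E : Set V2} (hs : IsPreconnected s)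
    (h : ∀ p ∈ s, p ∉ frontier E) : s ⊆ E ∨ Disjoint s E := by
  have hcov : s ⊆ interior E ∪ (closure E)ᶜ := by
    intro p hp
    by_cases hc : p ∈ closure E
    · left
      by_contra hi
      exact h p hp ⟨hc, hi⟩
    · right; exact hc
  rcases hs.subset_or_subset isOpen_interior isClosed_closure.isOpen_compl
    (disjoint_compl_right_iff_subset.2 (interior_subset.trans subset_closure)) hcov with h1 | h1
  · exact Or.inl (h1.trans interior_subset)
  · exact Or.inr (disjoint_left.2 fun p hp hE => h1 hp (subset_closure hE))

lemma null_curve (Q : ℝ → ℝ) (hQ : Measurable Q) : volume {p : V2 | p.2 = Q p.1} = 0 := by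
  have hm : MeasurableSet {p : V2 | p.2 = Q p.1} :=
    measurableSet_eq_fun measurable_snd (hQ.comp measurable_fst)
  rw [← (shr_mp Q hQ 1 (by norm_num)).measure_preimage hm.nullMeasurableSet]
  have : (shr Q hQ 1 (by norm_num)) ⁻¹' {p : V2 | p.2 = Q p.1} = univ ×ˢ {0} := by
    ext q
    show Q q.1 + 1 * q.2 = Q q.1 ↔ _
    simp
  rw [this, Measure.volume_eq_prod, Measure.prod_prod]; simp

lemma ioc_zpow_disj {i j : ℤ} {x : ℝ} (hi : x ∈ Ioc ((2:ℝ) ^ i) (2 * 2 ^ i))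
    (hj : x ∈ Ioc ((2:ℝ) ^ j) (2 * 2 ^ j)) : i = j := by
  have key : ∀ i j : ℤ, i < j → x ≤ 2 * 2 ^ i → (2:ℝ) ^ j < x → False := by
    intro i j hij h1 h2
    have : (2:ℝ) ^ (i + 1) ≤ 2 ^ j := zpow_le_zpow_right₀ (by norm_num) hij
    rw [zpow_add_one₀ (by norm_num)] at this
    linarith
  rcases lt_trichotomy i j with h | h | h
  · exact (key i j h hi.2 hj.1).elim
  · exact h
  · exact (key j i h hj.2 hi.1).elim

def sg (b : Bool) : ℝ := if b then 1 else -1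

lemma sg_sq (b : Bool) : sg b * sg b = 1 := by cases b <;> simp [sg]

def BXi (Q : ℝ → ℝ) (n : Bool × ℤ × ℤ) : Set V2 := BX Q (sg n.1) (2 ^ n.2.1) (2 ^ n.2.2)

lemma BXi_disj (Q : ℝ → ℝ) : Pairwise (Function.onFun Disjoint (BXi Q)) := by
  intro n m hnm
  rw [Function.onFun, Set.disjoint_left]
  intro p h1 h2
  apply hnm
  obtain ⟨b, i, j⟩ := n
  obtain ⟨b', i', j'⟩ := m
  obtain ⟨a1, a2⟩ := h1
  obtain ⟨c1, c2⟩ := h2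
  simp only at a1 a2 c1 c2
  have hb : b = b' := by
    by_contra hbb
    have h3 : 0 < sg b * (p.2 - Q p.1) := lt_trans (by positivity) a2.1
    have h4 : 0 < sg b' * (p.2 - Q p.1) := lt_trans (by positivity) c2.1
    cases b <;> cases b' <;> simp [sg] at hbb h3 h4 <;> linarith
  subst hb
  rw [ioc_zpow_disj a1 c1, ioc_zpow_disj a2 c2]

lemma BXi_ae (Q : ℝ → ℝ) (hQ : Measurable Q) : HP =ᵐ[volume] ⋃ n, BXi Q n := by
  have h0 : ∀ᵐ p : V2, p ∉ {p : V2 | p.2 = Q p.1} :=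
    measure_eq_zero_iff_ae_notMem.1 (null_curve Q hQ)
  filter_upwards [h0] with p hp
  apply propext
  show p ∈ HP ↔ p ∈ ⋃ n, BXi Q n
  rw [mem_iUnion]
  constructor
  · intro h
    obtain ⟨i, hi⟩ := exists_mem_Ioc_zpow (x := p.1) (y := (2:ℝ)) h (by norm_num)
    have hne : p.2 - Q p.1 ≠ 0 := sub_ne_zero.2 hp
    have : ∃ b, 0 < sg b * (p.2 - Q p.1) := by
      rcases lt_or_gt_of_ne hne with h | h
      · exact ⟨false, by simp only [sg]; simp; linarith⟩
      · exact ⟨true, by simp only [sg]; simp; linarith⟩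
    obtain ⟨b, hb⟩ := this
    obtain ⟨j, hj⟩ := exists_mem_Ioc_zpow (x := sg b * (p.2 - Q p.1)) (y := (2:ℝ)) hb (by norm_num)
    rw [zpow_add_one₀ (by norm_num), mul_comm] at hi hj
    exact ⟨(b, i, j), hi, hj⟩
  · rintro ⟨n, h1, h2⟩
    exact lt_trans (by positivity) h1.1

lemma measurableSet_HP : MeasurableSet HP := measurableSet_lt measurable_const measurable_fst

lemma measurableSet_Sml (r : ℝ) : MeasurableSet (Sml r) := by
  have h1 : MeasurableSet {p : V2 | |p.2| < r} :=
    measurableSet_lt (measurable_snd.abs) measurable_const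
  have h2 : MeasurableSet {p : V2 | p.1 < r} := measurableSet_lt measurable_fst measurable_const
  exact measurableSet_HP.inter (h2.inter h1)

lemma int_bg {g β : V2 → ℝ} {K : ℝ} (hg : IntegrableOn g HP)
    (hβm : AEStronglyMeasurable β (volume.restrict HP)) (hβ : ∀ p ∈ HP, |β p| ≤ K) :
    IntegrableOn (fun p => β p * g p) HP := by
  refine Integrable.bdd_mul (c := K) hg hβm ?_
  exact (ae_restrict_iff' measurableSet_HP).2 (Eventually.of_forall fun p hp => hβ p hp)

lemma int_osc {h : V2 → ℝ} {S : Set V2} (hh : IntegrableOn h S) (t u : ℝ) :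
    IntegrableOn (fun p : V2 => (h p : ℂ) *
      Complex.exp (Complex.I * ((t : ℂ) * (p.1 : ℂ) + (u : ℂ) * (p.2 : ℂ)))) S := by
  have h2' := Integrable.ofReal (𝕜 := ℂ) hh
  refine Integrable.mono h2' ?_ ?_
  · refine h2'.aestronglyMeasurable.mul ?_
    apply Measurable.aestronglyMeasurable
    fun_prop
  · filter_upwards with q
    rw [norm_mul, show Complex.I * ((t : ℂ) * (q.1 : ℂ) + (u : ℂ) * (q.2 : ℂ)) =
      ((t * q.1 + u * q.2 : ℝ) : ℂ) * Complex.I by push_cast; ring,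
      Complex.norm_exp_ofReal_mul_I, mul_one]
    exact le_rfl

lemma sum_boxes {β g : V2 → ℝ} (Q : ℝ → ℝ) (hQ : Measurable Q) {t u r : ℝ} {C : ℝ≥0∞}
    (w : V2 → ℝ≥0∞)
    (hint : IntegrableOn (fun p => β p * g p) HP)
    (h : ∀ n, ‖oscInt (fun p => β p * g p) (BXi Q n) t u‖ₑ ≤ C * ∫⁻ p in BXi Q n ∩ Sml r, w p) :
    ‖oscInt (fun p => β p * g p) HP t u‖ₑ ≤ C * ∫⁻ p in Sml r, w p := by
  have hm : ∀ n, MeasurableSet (BXi Q n) := fun n => measurableSet_BX Q hQ _ _ _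
  have ae := BXi_ae Q hQ
  have e1 : oscInt (fun p => β p * g p) HP t u =
      ∑' n, oscInt (fun p => β p * g p) (BXi Q n) t u := by
    unfold oscInt
    rw [setIntegral_congr_set ae]
    refine integral_iUnion hm (BXi_disj Q) ?_
    exact (int_osc hint t u).congr_set_ae ae.symm
  rw [e1]
  refine enorm_tsum_le_tsum_enorm.trans ((ENNReal.tsum_le_tsum h).trans ?_)
  rw [ENNReal.tsum_mul_left]
  gcongr
  rw [← lintegral_iUnion (fun n => (hm n).inter (measurableSet_Sml r))
    (fun i j hij => ((BXi_disj Q) hij).mono inter_subset_left inter_subset_left)]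
  exact lintegral_mono_set (iUnion_subset fun n => inter_subset_right)

lemma RR_nonneg (t u : ℝ) : 0 ≤ RR t u := by
  have : 0 ≤ nrm2 (t, u) := sqrt_nonneg _
  unfold RR; positivity

lemma Bdd_of_enorm {g β : V2 → ℝ} {C : ℝ}
    (h : ∀ t u, ‖oscInt (fun p => β p * g p) HP t u‖ₑ ≤ ENNReal.ofReal (C * RR t u)) : Bdd g β := by
  refine ⟨|C|, fun t u => ?_⟩
  have h1 := (h t u).trans (ENNReal.ofReal_le_ofReal
    (mul_le_mul_of_nonneg_right (le_abs_self C) (RR_nonneg t u)))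
  rw [← ofReal_norm] at h1
  exact (ENNReal.ofReal_le_ofReal_iff (mul_nonneg (abs_nonneg _) (RR_nonneg t u))).1 h1

structure LSymb (M T p : ℕ) (e : ℝ → ℝ) (θ ρ : ℝ) (β : V2 → ℝ) (K : ℝ) : Prop where
  ms : AEStronglyMeasurable β (volume.restrict HP)
  bd : ∀ q ∈ HP, |β q| ≤ K
  eb : ∀ q : V2, 0 < q.1 → q.1 < 2 * ρ → q.2 ≠ 0 → EBat (fun q => β (Phi M T e q)) K q
  sp : ∀ q : V2, 0 < q.1 → q.2 ≠ 0 → β (Phi M T e q) ≠ 0 →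
    q.1 < ρ ∧ θ * q.1 ^ p ≤ |q.2| ∧ |q.2| < ρ

set_option maxHeartbeats 1000000 in
theorem leaf {ι : Type} [Fintype ι] {fh : ι → V2 → ℝ} {γ : ι → ℝ} {E : Set V2}
    {g : V2 → ℝ} (ctx : Ctx fh γ E g) {M T p : ℕ} (hM : 0 < M) {e : ℝ → ℝ} (he : Measurable e)
    (hea : AnalyticAt ℝ e 0) {θ ε C : ℝ} (hθ : 0 ≤ θ) (hε : 0 < ε)
    (hLD : ∀ q : V2, 0 < q.1 → q.1 < ε → θ * q.1 ^ p ≤ |q.2| → |q.2| < ε → q.2 ≠ 0 →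
      ∀ i, LDat (fun q => fh i (Phi M T e q)) C q) :
    ∃ ρ0 > 0, ∀ ρ, 0 < ρ → ρ ≤ ρ0 → ∀ β K, LSymb M T p e (θ * 2 ^ (p + T + 3)) ρ β K →
      Bdd g β := by
  set μ : ℝ := (M:ℝ)⁻¹ with hμ
  have hμ0 : 0 < μ := by positivity
  set τ : ℝ := 1 + T * μ with hτ
  have hτ0 : 0 ≤ τ := by positivity
  set c1 := e 0 with hc1
  obtain ⟨x0, hx0, C0, hC0, s, hs, Q', Q'', Hf, hQ2⟩ := Q2_lemma hμ0 hea
  obtain ⟨r1, hr1, hg1⟩ := ctx.g1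
  obtain ⟨r3, hr3, C3, hg3⟩ := ctx.g3 c1
  obtain ⟨ε2, hε2, hB⟩ := Metric.eventually_nhds_iff.1
    (hea.continuousAt.abs.eventually (gt_mem_nhds (lt_add_one |e 0|)))
  set B := |e 0| + 1 with hBdef
  have hB0 : 0 < B := by positivity
  set r := min r1 r3 with hr
  have hr0 : 0 < r := lt_min hr1 hr3
  set ρ0 := min (min (1/2) (x0 / 2)) (min (min (ε2 / 2) (ε / 2 ^ (T + 3))) (min (r / (4 * (B + 1))) (1 / 2 ^ (T + 3)))) with hρ0
  refine ⟨ρ0, by positivity, fun ρ hρ hρρ0 β K hβ => ?_⟩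
  have b1 : ρ ≤ 1/2 := hρρ0.trans ((min_le_left _ _).trans (min_le_left _ _))
  have b2 : ρ ≤ x0 / 2 := hρρ0.trans ((min_le_left _ _).trans (min_le_right _ _))
  have b3 : ρ ≤ ε2 / 2 := hρρ0.trans ((min_le_right _ _).trans ((min_le_left _ _).trans (min_le_left _ _)))
  have b4 : ρ ≤ ε / 2 ^ (T + 3) := hρρ0.trans ((min_le_right _ _).trans ((min_le_left _ _).trans (min_le_right _ _)))
  have b5 : ρ ≤ r / (4 * (B + 1)) := hρρ0.trans ((min_le_right _ _).trans ((min_le_right _ _).trans (min_le_left _ _)))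
  have b6 : ρ ≤ 1 / 2 ^ (T + 3) := hρρ0.trans ((min_le_right _ _).trans ((min_le_right _ _).trans (min_le_right _ _)))
  rw [le_div_iff₀ (by positivity)] at b4 b5 b6
  have hT8 : (8:ℝ) ≤ 2 ^ (T + 3) := by
    rw [pow_add]; have : (1:ℝ) ≤ 2 ^ T := one_le_pow₀ (by norm_num)
    linarith
  have b4' : 2 * ρ < ε := by
    have := mul_le_mul_of_nonneg_left hT8 hρ.le
    linarith
  set Q : ℝ → ℝ := fun x => x * e (x ^ μ) with hQ
  have hQm : Measurable Q := by
    have : Measurable fun x : ℝ => x ^ μ := by fun_prop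
    exact measurable_id.mul (he.comp this)
  have hint := int_bg ctx.g0 hβ.ms hβ.bd
  have hK : 0 ≤ K := (abs_nonneg _).trans (hβ.bd (1, 0) (by simp [HP]))
  set 𝒢 : V2 → ℝ := fun q => ∏ i, |fh i (Phi M T e q)| ^ γ i with h𝒢
  set CL := ∑ i, |γ i| * |C| with hCL
  have hCL0 : 0 ≤ CL := Finset.sum_nonneg fun i _ => by positivity
  set CC := 23 * ((2 + |c1|) * (C0 + 2)) * (K * (1 + CL) * (μ + τ + 1)) *
        Real.exp ((μ + τ + 1) * (1 + CL)) ^ 2 with hCC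
  have hCC0 : 0 ≤ CC := by positivity
  apply Bdd_of_enorm (C := CC * C3)
  intro t u
  set L := 2 + nrm2 (t, u) with hL
  have hL2 : 2 ≤ L := by have := sqrt_nonneg ((t,u).1^2 + (t,u).2^2); rw [hL, nrm2]; linarith
  set w : V2 → ℝ≥0∞ := fun p => ENNReal.ofReal (g p / (1 + √(L * |p.2 - c1 * p.1|))) with hw
  have main : ∀ n, ‖oscInt (fun p => β p * g p) (BXi Q n) t u‖ₑ ≤
      ENNReal.ofReal CC * ∫⁻ p in BXi Q n ∩ Sml r, w p := by
    rintro ⟨bo, i, j⟩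
    set σ := sg bo with hσd
    have hσ : σ * σ = 1 := sg_sq bo
    have hσa : |σ| = 1 := by
      rcases mul_self_eq_one_iff.1 hσ with h | h <;> simp [h]
    set X : ℝ := 2 ^ i with hXd
    set Z : ℝ := 2 ^ j with hZd
    have hX : 0 < X := by positivity
    have hZ : 0 < Z := by positivity
    have hBX : BXi Q (bo, i, j) = BX Q σ X Z := rfl
    rw [hBX]
    have hmBX := measurableSet_BX Q hQm σ X Z
    have hsub : BX Q σ X Z ⊆ HP := fun p hp => hX.trans hp.1.1
    have hPW : ∀ x, 0 < x → ∀ z, Phi M T e (Wm μ τ σ x z) = (x, Q x + σ * z) :=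
      fun x hx z => Phi_Wm hM e hx σ z
    have hrep : ∀ p ∈ BX Q σ X Z, ∃ z ∈ Ioc Z (2 * Z), p = (p.1, Q p.1 + σ * z) := by
      intro p hp
      refine ⟨_, hp.2, ?_⟩
      ext
      · rfl
      · show p.2 = Q p.1 + σ * (σ * (p.2 - Q p.1))
        linear_combination -(p.2 - Q p.1) * hσ
    have zero : (∀ p ∈ BX Q σ X Z, β p * g p = 0) →
        ‖oscInt (fun p => β p * g p) (BX Q σ X Z) t u‖ₑ ≤
      ENNReal.ofReal CC * ∫⁻ p in BX Q σ X Z ∩ Sml r, w p := by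
      intro h
      have : oscInt (fun p => β p * g p) (BX Q σ X Z) t u = 0 := by
        unfold oscInt
        apply setIntegral_eq_zero_of_forall_eq_zero
        intro p hp; simp only [h p hp]; simp
      rw [this]; simp
    by_cases hz : ∀ p ∈ BX Q σ X Z, β p = 0
    · exact zero fun p hp => by rw [hz p hp, zero_mul]
    push Not at hz
    obtain ⟨p1, hp1, hβ1⟩ := hz
    obtain ⟨z1, hz1, hpz⟩ := hrep p1 hp1
    set x1 := p1.1 with hx1d
    have hx1 := hp1.1
    have hx1p : 0 < x1 := hX.trans hx1.1
    have hz1p : 0 < z1 := hZ.trans hz1.1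
    have hWne : ∀ x, 0 < x → ∀ z, 0 < z → 0 < (Wm μ τ σ x z).1 ∧ (Wm μ τ σ x z).2 ≠ 0 := by
      intro x hx z hz
      refine ⟨Real.rpow_pos_of_pos hx _, mul_ne_zero (mul_ne_zero ?_ hz.ne')
        (Real.rpow_pos_of_pos hx _).ne'⟩
      intro h; rw [h] at hσ; norm_num at hσ
    obtain ⟨s1, s2, s3⟩ := hβ.sp (Wm μ τ σ x1 z1) (hWne _ hx1p _ hz1p).1 (hWne _ hx1p _ hz1p).2
      (by rw [hPW _ hx1p, ← hpz]; exact hβ1)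
    have hreg : ∀ x ∈ Icc X (2 * X), ∀ z ∈ Icc Z (2 * Z), 0 < x ∧ 0 < z ∧
        (Wm μ τ σ x z).1 < 2 * ρ ∧ θ * (Wm μ τ σ x z).1 ^ p ≤ |(Wm μ τ σ x z).2| ∧
        |(Wm μ τ σ x z).2| < ε ∧ |(Wm μ τ σ x z).2| ≤ 1 := by
      intro x hx z hz
      have hxp := hX.trans_le hx.1
      have hzp := hZ.trans_le hz.1
      obtain ⟨a1, a2⟩ := Wm_cmp (T := T) hM hX hZ hσ hx hz (Ioc_subset_Icc_self hx1)
        (Ioc_subset_Icc_self hz1)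
      obtain ⟨c1, c2⟩ := Wm_cmp (T := T) hM hX hZ hσ (Ioc_subset_Icc_self hx1)
        (Ioc_subset_Icc_self hz1) hx hz
      rw [← hμ, ← hτ] at a1 a2 c1 c2
      have hW0 := (hWne _ hxp _ hzp).1
      have hW1 := (hWne _ hx1p _ hz1p).1
      have hy : |(Wm μ τ σ x z).2| ≤ 2 ^ (T + 2) * ρ := a2.trans (by gcongr)
      have e2 : (2:ℝ) ^ (T + 3) = 2 * 2 ^ (T + 2) := by ring
      have hpp : 0 < 2 ^ (T + 2) * ρ := by positivity
      refine ⟨hxp, hzp, by linarith, ?_, ?_, ?_⟩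
      · have h1 : θ * (Wm μ τ σ x z).1 ^ p ≤ θ * (2 * (Wm μ τ σ x1 z1).1) ^ p := by gcongr
        rw [mul_pow] at h1
        have h2 : θ * 2 ^ (p + T + 3) * (Wm μ τ σ x1 z1).1 ^ p =
          2 ^ (T + 3) * (θ * (2 ^ p * (Wm μ τ σ x1 z1).1 ^ p)) := by ring
        have h4 : 0 ≤ θ * (2 ^ p * (Wm μ τ σ x1 z1).1 ^ p) := by positivity
        have h5 : 2 ^ (T + 2) * (θ * (2 ^ p * (Wm μ τ σ x1 z1).1 ^ p)) ≤
            2 ^ (T + 2) * |(Wm μ τ σ x z).2| := by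
          refine le_trans ?_ (s2.trans c2)
          rw [h2, e2]
          have : 0 ≤ 2 ^ (T + 2) * (θ * (2 ^ p * (Wm μ τ σ x1 z1).1 ^ p)) := by positivity
          linarith
        exact h1.trans (le_of_mul_le_mul_left h5 (by positivity))
      · rw [e2] at b4; linarith
      · rw [e2] at b6; linarith
    have hx1ρ : x1 < ρ := by
      have h1 : x1 = (Wm μ τ σ x1 z1).1 ^ M := (Real.rpow_inv_natCast_pow hx1p.le hM.ne').symm
      rw [h1]
      calc (Wm μ τ σ x1 z1).1 ^ M ≤ (Wm μ τ σ x1 z1).1 ^ 1 :=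
            pow_le_pow_of_le_one (hWne _ hx1p _ hz1p).1.le (by linarith) hM
        _ < ρ := by rw [pow_one]; exact s1
    have hXρ : X < ρ := hx1.1.trans hx1ρ
    have hzx : ∀ x ∈ Icc X (2 * X), ∀ z ∈ Icc Z (2 * Z), z ≤ x := by
      intro x hx z hz
      obtain ⟨hxp, hzp, a1, a2, a3, a4⟩ := hreg x hx z hz
      simp only [Wm] at a4
      rw [abs_mul, abs_mul, hσa, one_mul, abs_of_pos hzp, abs_of_pos (Real.rpow_pos_of_pos hxp _),
        Real.rpow_neg hxp.le, ← div_eq_mul_inv, div_le_one (Real.rpow_pos_of_pos hxp _)] at a4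
      refine a4.trans ?_
      calc x ^ τ ≤ x ^ (1:ℝ) := by
            apply Real.rpow_le_rpow_of_exponent_ge hxp (by linarith [hx.2])
            rw [hτ]; have : 0 ≤ T * μ := by positivity
            linarith
        _ = x := Real.rpow_one x
    have hX' : X ∈ Icc X (2 * X) := ⟨le_rfl, by linarith⟩
    have hZ' : Z ∈ Icc Z (2 * Z) := ⟨le_rfl, by linarith⟩
    have hSml : ∀ x ∈ Icc X (2 * X), ∀ z ∈ Icc Z (2 * Z), (x, Q x + σ * z) ∈ Sml r := by
      intro x hx z hz
      obtain ⟨hxp, hzp, a1, a2, a3, a4⟩ := hreg x hx z hz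
      have hx2 : x < 2 * ρ := by linarith [hx.2]
      have hle : |Q x + σ * z| ≤ x * (B + 1) := by
        have h1 : |e (x ^ μ)| < B := by
          apply hB
          rw [dist_eq, sub_zero, abs_of_pos (Real.rpow_pos_of_pos hxp _)]
          have : (Wm μ τ σ x z).1 = x ^ μ := rfl
          rw [← this]; linarith
        calc |Q x + σ * z| ≤ |Q x| + |σ * z| := abs_add_le _ _
          _ = x * |e (x ^ μ)| + z := by
              rw [hQ, abs_mul, abs_mul, hσa, abs_of_pos hxp, abs_of_pos hzp, one_mul]
          _ ≤ x * B + x := add_le_add (by gcongr) (hzx x hx z hz)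
          _ = _ := by ring
      have : x * (B + 1) < 2 * ρ * (B + 1) := by gcongr
      have hρB : 0 < ρ * B := mul_pos hρ hB0
      have hh : 2 * ρ * (B + 1) ≤ r := by linarith
      refine ⟨hxp, ?_, ?_⟩
      · show x < r
        linarith
      · show |Q x + σ * z| < r
        linarith
    have hBXS : BX Q σ X Z ⊆ Sml r := by
      intro p hp
      obtain ⟨z, hz, h⟩ := hrep p hp
      rw [h]; exact hSml _ (Ioc_subset_Icc_self hp.1) _ (Ioc_subset_Icc_self hz)
    rw [inter_eq_self_of_subset_left hBXS]
    rw [inter_eq_self_of_subset_left hBXS] at zero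
    have hLDi : ∀ x ∈ Icc X (2 * X), ∀ z ∈ Icc Z (2 * Z), ∀ i,
        LDat (fun q => fh i (Phi M T e q)) C (Wm μ τ σ x z) := by
      intro x hx z hz i
      obtain ⟨hxp, hzp, a1, a2, a3, a4⟩ := hreg x hx z hz
      exact hLD _ (hWne _ hxp _ hzp).1 (by linarith) a2 a3 (hWne _ hxp _ hzp).2 i
    obtain ⟨q1, q2, q3⟩ := hQ2 X hX (by linarith)
    have hQeq : (fun x => x * (e (x ^ μ) - e 0)) = fun x => Q x - c1 * x := by
      funext x; rw [hQ, hc1]; ring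
    have hQc : ContinuousOn Q (Icc X (2 * X)) := by
      have h1 : ContinuousOn (fun x => Q x - c1 * x) (Icc X (2 * X)) := by
        rw [← hQeq]; exact fun x hx => (q3 x hx).1.continuousAt.continuousWithinAt
      have h2 : ContinuousOn (fun x => (Q x - c1 * x) + c1 * x) (Icc X (2 * X)) :=
        h1.add (by fun_prop)
      exact h2.congr fun x hx => by ring
    have hpre : IsPreconnected ((fun q : V2 => (q.1, Q q.1 + σ * q.2)) ''
        (Icc X (2 * X) ×ˢ Icc Z (2 * Z))) := by
      apply (isPreconnected_Icc.prod isPreconnected_Icc).image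
      apply continuousOn_fst.prodMk
      apply ContinuousOn.add
      · exact hQc.comp continuousOn_fst fun q hq => hq.1
      · fun_prop
    have hSr1 : ∀ p ∈ Sml r, p ∈ Sml r1 := fun p hp =>
      ⟨hp.1, hp.2.1.trans_le (min_le_left _ _), hp.2.2.trans_le (min_le_left _ _)⟩
    have hSr3 : Sml r ⊆ Sml r3 := fun p hp =>
      ⟨hp.1, hp.2.1.trans_le (min_le_right _ _), hp.2.2.trans_le (min_le_right _ _)⟩
    rcases preconn_frontier (E := E) hpre (by
      rintro _ ⟨⟨x, z⟩, ⟨hx, hz⟩, rfl⟩ hf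
      simp only at hx hz hf
      obtain ⟨i, hi⟩ := (hg1 _ (hSr1 _ (hSml x hx z hz))).2 hf
      apply (hLDi x hx z hz i).2.1
      simp only
      rw [hPW x (hreg x hx z hz).1, hi]) with hE | hE
    · refine box_leaf (H := Hf X) hX (by linarith) hZ (by linarith [hzx X hX' Z hZ'])
        (by linarith [hzx X hX' Z hZ']) q1 q2 hC0 hK hCL0 hμ0.le hτ0 hs hσ Q Q' Q'' hQm
        (fun x hx => by rw [← hQeq]; exact (q3 x hx).1) (fun x hx => (q3 x hx).2.1)
        (fun x hx => ?_) (fun x hx => (q3 x hx).2.2.1)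
        (fun x hx => (q3 x hx).2.2.2.1) (fun q => β (Phi M T e q)) 𝒢 β g ?_ ?_ ?_ ?_ ?_
        (hint.mono_set hsub)
      · have := (q3 x hx).2.2.2.2
        rw [show Q x - c1 * x = x * (e (x ^ μ) - e 0) from (congrFun hQeq x).symm]; exact this
      · intro q; exact Finset.prod_nonneg fun i _ => Real.rpow_nonneg (abs_nonneg _) _
      · intro x hx z hz
        refine LDat.prod Finset.univ (F := fun i q => |fh i (Phi M T e q)| ^ γ i)
          (C := fun i => |γ i| * |C|) fun i => ?_
        obtain ⟨l1, l2, l3, l4⟩ := (hLDi x hx z hz i)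
        refine LDat.abs_rpow ⟨l1, l2, l3.trans ?_, l4.trans ?_⟩ (γ i)
        · gcongr; exact le_abs_self C
        · gcongr; exact le_abs_self C
      · intro x hx z hz
        obtain ⟨hxp, hzp, a1, a2, a3, a4⟩ := hreg x hx z hz
        exact hβ.eb _ (hWne _ hxp _ hzp).1 a1 (hWne _ hxp _ hzp).2
      · intro x hx z hz
        rw [hPW x (hreg x hx z hz).1]
      · intro x hx z hz
        rw [(hg1 _ (hSr1 _ (hSml x hx z hz))).1, indicator_of_mem (hE ⟨(x, z), ⟨hx, hz⟩, rfl⟩)]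
        simp only [h𝒢]
        rw [hPW x (hreg x hx z hz).1]
    · apply zero
      intro p hp
      obtain ⟨z, hz, h⟩ := hrep p hp
      have h1 := Ioc_subset_Icc_self hp.1
      have h2 := Ioc_subset_Icc_self hz
      have h3 : p ∉ E := by
        rw [h]; exact disjoint_left.1 hE ⟨(p.1, z), ⟨h1, h2⟩, rfl⟩
      rw [(hg1 p (hSr1 _ (hBXS hp))).1, indicator_of_notMem h3, mul_zero]
  have hfin := sum_boxes Q hQm w hint main
  refine hfin.trans ?_
  have hSr3 : Sml r ⊆ Sml r3 := fun p hp =>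
      ⟨hp.1, hp.2.1.trans_le (min_le_right _ _), hp.2.2.trans_le (min_le_right _ _)⟩
  rw [mul_assoc, ENNReal.ofReal_mul hCC0]
  gcongr
  exact (lintegral_mono_set hSr3).trans (hg3 L hL2)

section DivSec

variable {E : Type} [NormedAddCommGroup E] [NormedSpace ℝ E]

def divT (A : E →L[ℝ] E) (e : E) {n : ℕ} (p : ContinuousMultilinearMap ℝ (fun _ : Fin (n+1) => E) ℝ)
    (k : Fin (n+1)) : ContinuousMultilinearMap ℝ (fun _ : Fin n => E) ℝ :=
  (ContinuousMultilinearMap.curryMid k p e).compContinuousLinearMap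
    (fun i => if k.succAbove i < k then A else ContinuousLinearMap.id ℝ E)

lemma divT_apply (A : E →L[ℝ] E) (e : E) {n : ℕ}
    (p : ContinuousMultilinearMap ℝ (fun _ : Fin (n+1) => E) ℝ) (k : Fin (n+1)) (v : E) :
    divT A e p k (fun _ => v) =
      p (Function.update (fun i => if i < k then A v else v) k e) := by
  unfold divT
  rw [ContinuousMultilinearMap.compContinuousLinearMap_apply]
  show p _ = _
  congr 1
  funext j
  refine Fin.succAboveCases k ?_ (fun i => ?_) j
  · simp
  · rw [Function.update_of_ne (Fin.succAbove_ne k i)]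
    simp only [Fin.insertNth_apply_succAbove]
    split_ifs <;> rfl

lemma divT_norm (A : E →L[ℝ] E) (e : E) (hA : ‖A‖ ≤ 1) (he : ‖e‖ ≤ 1) {n : ℕ}
    (p : ContinuousMultilinearMap ℝ (fun _ : Fin (n+1) => E) ℝ) (k : Fin (n+1)) :
    ‖divT A e p k‖ ≤ ‖p‖ := by
  unfold divT
  refine (ContinuousMultilinearMap.norm_compContinuousLinearMap_le _ _).trans ?_
  have h1 : ‖ContinuousMultilinearMap.curryMid k p e‖ ≤ ‖p‖ := by
    refine ContinuousMultilinearMap.opNorm_le_bound (norm_nonneg _) fun m => ?_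
    refine (p.norm_map_insertNth_le (i := k) e m).trans ?_
    gcongr
    exact mul_le_of_le_one_right (norm_nonneg _) he
  have h2 : ∏ i : Fin n, ‖(if k.succAbove i < k then A else ContinuousLinearMap.id ℝ E)‖ ≤ 1 := by
    apply Finset.prod_le_one
    · intros; positivity
    · intro i _
      split_ifs
      · exact hA
      · exact ContinuousLinearMap.norm_id_le
  calc _ ≤ ‖p‖ * 1 := mul_le_mul h1 h2 (Finset.prod_nonneg fun _ _ => norm_nonneg _) (norm_nonneg _)
    _ = _ := mul_one _

lemma div_tele (A : E →L[ℝ] E) (e : E) (ℓ : E →L[ℝ] ℝ) (hl : ∀ v, v = A v + ℓ v • e) {n : ℕ}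
    (p : ContinuousMultilinearMap ℝ (fun _ : Fin (n+1) => E) ℝ) (v : E) :
    p (fun _ => v) = p (fun _ => A v) + ℓ v * ∑ k, divT A e p k (fun _ => v) := by
  have key : ∀ m : ℕ, (hm : m ≤ n + 1) → p (fun _ => v) =
      p (fun i => if i.1 < m then A v else v) +
        ℓ v * ∑ k : Fin m, divT A e p (Fin.castLE hm k) (fun _ => v) := by
    intro m
    induction m with
    | zero => intro hm; simp
    | succ m ih =>
      intro hm
      rw [ih (by omega), Fin.sum_univ_castSucc]
      have hk : (Fin.castLE hm (Fin.last m)) = (⟨m, by omega⟩ : Fin (n+1)) := rfl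
      rw [hk, divT_apply]
      set k : Fin (n+1) := ⟨m, by omega⟩ with hkd
      have e1 : (fun i : Fin (n+1) => if i.1 < m then A v else v) =
          Function.update (fun i => if i < k then A v else v) k (A v + ℓ v • e) := by
        funext i
        by_cases hik : i = k
        · subst hik; simp only [Function.update_self, ← hl v]; simp [hkd]
        · rw [Function.update_of_ne hik]; rfl
      have e2 : (fun i : Fin (n+1) => if i.1 < m + 1 then A v else v) =
          Function.update (fun i => if i < k then A v else v) k (A v) := by
        funext i
        by_cases hik : i = k
        · subst hik; simp [hkd]
        · rw [Function.update_of_ne hik]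
          have : i.1 ≠ m := fun h => hik (Fin.ext h)
          have h2 : i < k ↔ i.1 < m := Iff.rfl
          simp only [h2]
          congr 1
          apply propext; omega
      rw [e1, e2, p.map_update_add, p.map_update_smul, smul_eq_mul]
      have e3 : ∀ x : Fin m, Fin.castLE hm x.castSucc = Fin.castLE (by omega) x := fun x => rfl
      simp only [e3]
      ring
  have := key (n+1) le_rfl
  have h2 : (fun i : Fin (n+1) => if i.1 < n + 1 then A v else v) = fun _ => A v := by
    funext i; simp only [i.2, if_true]
  rw [h2] at this
  exact this

lemma analytic_div {F : E → ℝ} (hF : AnalyticAt ℝ F 0) (A : E →L[ℝ] E) (e : E) (ℓ : E →L[ℝ] ℝ)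
    (hA : ‖A‖ ≤ 1) (he : ‖e‖ ≤ 1) (hl : ∀ v, v = A v + ℓ v • e) :
    ∃ u : E → ℝ, AnalyticAt ℝ u 0 ∧ ∀ᶠ v in 𝓝 0, F v = F (A v) + ℓ v * u v := by
  obtain ⟨p, r, hp⟩ := hF
  set q : FormalMultilinearSeries ℝ E ℝ := fun n => ∑ k, divT A e (p (n+1)) k with hq
  have hqn : ∀ n, ‖q n‖ ≤ (n + 1) * ‖p (n+1)‖ := by
    intro n
    refine (norm_sum_le _ _).trans ?_
    refine (Finset.sum_le_sum fun k _ => divT_norm A e hA he (p (n+1)) k).trans ?_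
    simp
  obtain ⟨ρ, hρ0, hρ⟩ := ENNReal.lt_iff_exists_nnreal_btwn.1 hp.radius_pos
  have hρp : 0 < ρ := by exact_mod_cast hρ0
  obtain ⟨C, hC, hb⟩ := p.norm_mul_pow_le_of_lt_radius hρ
  have hrad : ((ρ / 2 : NNReal) : ℝ≥0∞) ≤ q.radius := by
    apply q.le_radius_of_bound (C * (1 / ρ))
    intro n
    have h1 := hb (n+1)
    have h2 : ((n:ℝ) + 1) ≤ 2 ^ n := by
      have : n + 1 ≤ 2 ^ n := Nat.lt_two_pow_self
      exact_mod_cast this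
    push_cast
    rw [div_pow]
    have hρ' : (0:ℝ) < ρ := hρp
    calc ‖q n‖ * ((ρ:ℝ) ^ n / 2 ^ n) ≤ ((2:ℝ) ^ n * ‖p (n+1)‖) * ((ρ:ℝ) ^ n / 2 ^ n) := by
          gcongr; exact (hqn n).trans (by gcongr)
      _ = (‖p (n+1)‖ * (ρ:ℝ) ^ (n+1)) * (1 / ρ) := by field_simp; ring
      _ ≤ _ := by gcongr
  have hqr : 0 < q.radius := lt_of_lt_of_le (by exact_mod_cast (half_pos hρp)) hrad
  have hqs := q.hasFPowerSeriesOnBall hqr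
  refine ⟨q.sum, hqs.analyticAt, ?_⟩
  have hmin : 0 < min r q.radius := lt_min hp.r_pos hqr
  filter_upwards [Metric.eball_mem_nhds (0:E) hmin] with v hv
  have hv1 : v ∈ Metric.eball (0:E) r := Metric.eball_subset_eball (min_le_left _ _) hv
  have hv2 : v ∈ Metric.eball (0:E) q.radius := Metric.eball_subset_eball (min_le_right _ _) hv
  have hAv : A v ∈ Metric.eball (0:E) r := by
    rw [Metric.mem_eball, edist_zero_right] at hv1 ⊢
    refine lt_of_le_of_lt ?_ hv1
    rw [enorm_le_iff_norm_le]
    exact (A.le_opNorm v).trans (mul_le_of_le_one_left (norm_nonneg _) hA)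
  have s1 := hp.hasSum hv1
  have s2 := hp.hasSum hAv
  have s3 := hqs.hasSum hv2
  rw [zero_add] at s1 s2 s3
  have s4 := (s1.sub s2)
  rw [← hasSum_nat_add_iff' 1] at s4
  have s5 := s3.mul_left (ℓ v)
  have : (fun n => p (n+1) (fun _ => v) - p (n+1) (fun _ => A v)) = fun n => ℓ v * q n (fun _ => v) := by
    funext n
    rw [div_tele A e ℓ hl (p (n+1)) v]
    simp [hq]
  rw [this] at s4
  have s6 := s4.unique s5
  have h0 : p 0 (fun _ => v) = p 0 (fun _ => A v) := by
    congr 1; funext i; exact i.elim0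
  simp only [Finset.range_one, Finset.sum_singleton, h0, sub_self, sub_zero] at s6
  linarith

end DivSec

lemma div_y {F : V2 → ℝ} (hF : AnalyticAt ℝ F 0) :
    ∃ u : V2 → ℝ, AnalyticAt ℝ u 0 ∧ ∀ᶠ v in 𝓝 0, F v = F (v.1, 0) + v.2 * u v := by
  have := analytic_div hF ((ContinuousLinearMap.inl ℝ ℝ ℝ).comp (ContinuousLinearMap.fst ℝ ℝ ℝ))
    (0, 1) (ContinuousLinearMap.snd ℝ ℝ ℝ) ?_ ?_ ?_
  · simpa using this
  · refine ContinuousLinearMap.opNorm_le_bound _ zero_le_one fun v => ?_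
    simp [Prod.norm_def]
  · simp [Prod.norm_def]
  · intro v; ext <;> simp

lemma div_x {F : V2 → ℝ} (hF : AnalyticAt ℝ F 0) :
    ∃ u : V2 → ℝ, AnalyticAt ℝ u 0 ∧ ∀ᶠ v in 𝓝 0, F v = F (0, v.2) + v.1 * u v := by
  have := analytic_div hF ((ContinuousLinearMap.inr ℝ ℝ ℝ).comp (ContinuousLinearMap.snd ℝ ℝ ℝ))
    (1, 0) (ContinuousLinearMap.fst ℝ ℝ ℝ) ?_ ?_ ?_
  · simpa using this
  · refine ContinuousLinearMap.opNorm_le_bound _ zero_le_one fun v => ?_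
    simp [Prod.norm_def]
  · simp [Prod.norm_def]
  · intro v; ext <;> simp

def Dy (F : V2 → ℝ) : V2 → ℝ := fun q => fderiv ℝ F q (0, 1)

lemma Dy_an {F : V2 → ℝ} {q : V2} (hF : AnalyticAt ℝ F q) : AnalyticAt ℝ (Dy F) q :=
  ((ContinuousLinearMap.apply ℝ ℝ ((0:ℝ),(1:ℝ))).analyticAt _).comp hF.fderiv

lemma DyI_an {F : V2 → ℝ} {q : V2} (hF : AnalyticAt ℝ F q) (j : ℕ) :
    AnalyticAt ℝ (Dy^[j] F) q := by
  induction j with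
  | zero => exact hF
  | succ j ih => rw [Function.iterate_succ_apply']; exact Dy_an ih

lemma Dy_congr {F G : V2 → ℝ} {q : V2} (h : F =ᶠ[𝓝 q] G) : Dy F =ᶠ[𝓝 q] Dy G := by
  filter_upwards [h.fderiv (𝕜 := ℝ)] with p hp
  simp only [Dy, hp]

lemma Dy_hasDerivAt {F : V2 → ℝ} {q : V2} (hF : DifferentiableAt ℝ F q) :
    HasDerivAt (fun y => F (q.1, y)) (Dy F q) q.2 := by
  have h1 : HasDerivAt (fun y : ℝ => (q.1, y)) ((0:ℝ), (1:ℝ)) q.2 :=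
    (hasDerivAt_const _ _).prodMk (hasDerivAt_id _)
  exact hF.hasFDerivAt.comp_hasDerivAt q.2 h1

lemma Dy_div {F v : V2 → ℝ} {c : ℝ → ℝ} (hv : AnalyticAt ℝ v 0) (hc : AnalyticAt ℝ c 0)
    (h : F =ᶠ[𝓝 0] fun q => c q.1 + q.2 * v q) (j : ℕ) :
    Dy^[j+1] F =ᶠ[𝓝 0] fun q => (j + 1) * Dy^[j] v q + q.2 * Dy^[j+1] v q := by
  induction j with
  | zero =>
    simp only [zero_add, Function.iterate_one, Function.iterate_zero, id]
    refine (Dy_congr h).trans ?_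
    have hc' : ∀ᶠ q : V2 in 𝓝 0, AnalyticAt ℝ c q.1 :=
      (continuous_fst.tendsto (0:V2)).eventually hc.eventually_analyticAt
    filter_upwards [hv.eventually_analyticAt, hc'] with q h1 h2
    have h4 : DifferentiableAt ℝ (fun q : V2 => c q.1 + q.2 * v q) q :=
      (h2.differentiableAt.comp q differentiableAt_fst).add (differentiableAt_snd.mul h1.differentiableAt)
    have h3 := ((hasDerivAt_id q.2).mul (Dy_hasDerivAt h1.differentiableAt)).const_add (c q.1)
    have := (Dy_hasDerivAt h4).unique h3
    rw [this]; simp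
  | succ j ih =>
    rw [Function.iterate_succ_apply']
    refine (Dy_congr ih).trans ?_
    filter_upwards [(DyI_an hv j).eventually_analyticAt, (DyI_an hv (j+1)).eventually_analyticAt]
      with q h1 h2
    have h4 : DifferentiableAt ℝ (fun q : V2 => ((j:ℝ) + 1) * Dy^[j] v q + q.2 * Dy^[j+1] v q) q :=
      (h1.differentiableAt.const_mul _).add (differentiableAt_snd.mul h2.differentiableAt)
    have h3 := ((Dy_hasDerivAt h1.differentiableAt).const_mul ((j:ℝ)+1)).add
      ((hasDerivAt_id q.2).mul (Dy_hasDerivAt h2.differentiableAt))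
    have := (Dy_hasDerivAt h4).unique h3
    rw [this, Function.iterate_succ_apply' (f := Dy) (n := j+1), Function.iterate_succ_apply' (f := Dy) (n := j)]
    simp; ring

lemma tendsto_fst0 : Tendsto (fun q : V2 => ((q.1, 0) : V2)) (𝓝 0) (𝓝 0) := by
  have : Continuous fun q : V2 => ((q.1, 0) : V2) := by fun_prop
  exact this.tendsto (0 : V2)

lemma taylor2 (m : ℕ) : ∀ {F : V2 → ℝ}, AnalyticAt ℝ F 0 →
    ∃ u : V2 → ℝ, AnalyticAt ℝ u 0 ∧ u 0 = Dy^[m] F 0 / m.factorial ∧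
      ∀ᶠ q in 𝓝 0, F q = ∑ j ∈ Finset.range m, Dy^[j] F (q.1, 0) / j.factorial * q.2 ^ j
        + q.2 ^ m * u q := by
  induction m with
  | zero => intro F hF; exact ⟨F, hF, by simp, by simp⟩
  | succ m ih =>
    intro F hF
    obtain ⟨v, hv, hFv⟩ := div_y hF
    obtain ⟨u, hu, hu0, huv⟩ := ih hv
    have hc : AnalyticAt ℝ (fun x : ℝ => F (x, 0)) 0 :=
      AnalyticAt.fun_comp (g := F) (f := fun x : ℝ => (x, (0:ℝ))) hF (analyticAt_id.prod analyticAt_const)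
    have hD := Dy_div hv hc hFv
    refine ⟨u, hu, ?_, ?_⟩
    · have := (hD m).self_of_nhds
      rw [this, hu0, Nat.factorial_succ]
      have : (m.factorial : ℝ) ≠ 0 := by positivity
      push_cast; simp; field_simp
    · have hD' : ∀ᶠ q : V2 in 𝓝 0, ∀ j ∈ Finset.range m,
          Dy^[j+1] F (q.1, 0) = (j + 1) * Dy^[j] v (q.1, 0) := by
        rw [Filter.eventually_all_finset]
        intro j _
        filter_upwards [tendsto_fst0.eventually (hD j)] with q hq
        rw [hq]; simp
      filter_upwards [hFv, huv, hD'] with q h1 h2 h3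
      rw [h1, h2, Finset.sum_range_succ', mul_add, Finset.mul_sum]
      have : ∑ i ∈ Finset.range m, q.2 * (Dy^[i] v (q.1, 0) / i.factorial * q.2 ^ i) =
        ∑ k ∈ Finset.range m, Dy^[k + 1] F (q.1, 0) / (k + 1).factorial * q.2 ^ (k + 1) := by
        apply Finset.sum_congr rfl
        intro j hj
        rw [h3 j hj, Nat.factorial_succ]
        have : (j.factorial : ℝ) ≠ 0 := by positivity
        push_cast; field_simp; ring
      rw [this]; simp; ring

lemma Dy_comp_shift {F : V2 → ℝ} {Ψ1 : ℝ → ℝ} {c : ℝ → ℝ} (hF : AnalyticAt ℝ F 0)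
    (hΨ1 : AnalyticAt ℝ Ψ1 0) (hc : AnalyticAt ℝ c 0) (h1 : Ψ1 0 = 0) (hc0 : c 0 = 0) (j : ℕ) :
    Dy^[j] (fun q => F (Ψ1 q.1, c q.1 + q.2)) =ᶠ[𝓝 0] fun q => Dy^[j] F (Ψ1 q.1, c q.1 + q.2) := by
  have hΨa : ∀ᶠ q : V2 in 𝓝 0, AnalyticAt ℝ Ψ1 q.1 ∧ AnalyticAt ℝ c q.1 :=
    (continuous_fst.tendsto (0:V2)).eventually
      (hΨ1.eventually_analyticAt.and hc.eventually_analyticAt)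
  have ht : Tendsto (fun q : V2 => (Ψ1 q.1, c q.1 + q.2)) (𝓝 0) (𝓝 0) := by
    have e1 : AnalyticAt ℝ (fun q : V2 => Ψ1 q.1) 0 :=
      AnalyticAt.fun_comp (g := Ψ1) (f := fun q : V2 => q.1) hΨ1 analyticAt_fst
    have e2 : AnalyticAt ℝ (fun q : V2 => c q.1 + q.2) 0 :=
      (AnalyticAt.fun_comp (g := c) (f := fun q : V2 => q.1) hc analyticAt_fst).add analyticAt_snd
    have := (e1.prod e2).continuousAt.tendsto
    have h00 : (Ψ1 (0:V2).1, c (0:V2).1 + (0:V2).2) = (0 : V2) := by ext <;> simp [h1, hc0]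
    rw [h00] at this
    exact this
  induction j with
  | zero => exact Filter.EventuallyEq.rfl
  | succ j ih =>
    rw [Function.iterate_succ_apply']
    refine (Dy_congr ih).trans ?_
    filter_upwards [hΨa, ht.eventually (DyI_an hF j).eventually_analyticAt] with q h2 h3
    have h4 : DifferentiableAt ℝ (fun q : V2 => Dy^[j] F (Ψ1 q.1, c q.1 + q.2)) q := by
      have a1 : DifferentiableAt ℝ (fun q : V2 => Ψ1 q.1) q :=
        h2.1.differentiableAt.comp q differentiableAt_fst
      have a2 : DifferentiableAt ℝ (fun q : V2 => c q.1) q :=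
        h2.2.differentiableAt.comp q differentiableAt_fst
      exact DifferentiableAt.comp (g := Dy^[j] F) q h3.differentiableAt (a1.prodMk (a2.add differentiableAt_snd))
    have h5 := (Dy_hasDerivAt h3.differentiableAt)
    have h6 := HasDerivAt.comp q.2 h5 ((hasDerivAt_id q.2).const_add (c q.1))
    have := (Dy_hasDerivAt h4).unique h6
    rw [this, Function.iterate_succ_apply' (f := Dy)]; simp

lemma implicit_an {A : V2 → ℝ} (hA : AnalyticAt ℝ A 0) (h0 : A 0 = 0) (h1 : Dy A 0 ≠ 0) :
    ∃ q : ℝ → ℝ, AnalyticAt ℝ q 0 ∧ q 0 = 0 ∧ (∀ᶠ x in 𝓝 0, A (x, q x) = 0) ∧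
      ∀ᶠ v : V2 in 𝓝 0, A v = 0 ↔ q v.1 = v.2 := by
  have cdf : ContDiffAt ℝ (⊤ : WithTop ℕ∞) A 0 := hA.contDiffAt
  have inv : (fderiv ℝ A 0 ∘L ContinuousLinearMap.inr ℝ ℝ ℝ).IsInvertible := by
    refine ⟨ContinuousLinearEquiv.unitsEquivAut ℝ (Units.mk0 _ h1), ?_⟩
    ext
    simp [Dy]
  refine ⟨cdf.implicitFunction (by simp) inv, ?_, ?_, ?_, ?_⟩
  · exact (cdf.contDiffAt_implicitFunction (by simp) inv).analyticAt
  · exact cdf.implicitFunction_apply_self (by simp) inv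
  · have := cdf.eventually_apply_implicitFunction (by simp) inv
    rw [h0] at this; exact this
  · have := cdf.eventually_apply_eq_iff_implicitFunction (by simp) inv
    rw [h0] at this; exact this

lemma pow_cancel {a b : ℝ → ℝ} (ha : ContinuousAt a 0) (hb : ContinuousAt b 0) {m k : ℕ} (hmk : m < k)
    (h : ∀ᶠ y in 𝓝 (0:ℝ), y ^ m * a y = y ^ k * b y) : a 0 = 0 := by
  have h1 : Tendsto a (𝓝[≠] 0) (𝓝 (a 0)) := ha.tendsto.mono_left nhdsWithin_le_nhds
  have h2 : Tendsto (fun y => y ^ (k - m) * b y) (𝓝[≠] 0) (𝓝 (0 ^ (k - m) * b 0)) := by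
    have : ContinuousAt (fun y : ℝ => y ^ (k - m) * b y) 0 := (continuousAt_id.pow _).mul hb
    exact this.tendsto.mono_left nhdsWithin_le_nhds
  rw [zero_pow (by omega), zero_mul] at h2
  have h3 : a =ᶠ[𝓝[≠] 0] fun y => y ^ (k - m) * b y := by
    filter_upwards [h.filter_mono nhdsWithin_le_nhds, self_mem_nhdsWithin] with y hy hy0
    have hy0' : y ≠ 0 := hy0
    have : y ^ m * a y = y ^ m * (y ^ (k - m) * b y) := by
      rw [hy, ← mul_assoc, ← pow_add]; congr 2; omega
    exact mul_left_cancel₀ (pow_ne_zero m hy0') this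
  exact tendsto_nhds_unique (h1.congr' h3) h2

def OrdY (F : V2 → ℝ) (m : ℕ) : Prop := (∀ j < m, Dy^[j] F 0 = 0) ∧ Dy^[m] F 0 ≠ 0

lemma tendsto_0y : Tendsto (fun y : ℝ => ((0, y) : V2)) (𝓝 0) (𝓝 0) := by
  have : Continuous fun y : ℝ => ((0, y) : V2) := by fun_prop
  exact this.tendsto 0

lemma taylor_0y {F : V2 → ℝ} (hF : AnalyticAt ℝ F 0) {m : ℕ} (h : ∀ j < m, Dy^[j] F 0 = 0) :
    ∃ u : ℝ → ℝ, ContinuousAt u 0 ∧ u 0 = Dy^[m] F 0 / m.factorial ∧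
      ∀ᶠ y in 𝓝 (0:ℝ), F (0, y) = y ^ m * u y := by
  obtain ⟨u, hu, hu0, hFu⟩ := taylor2 m hF
  refine ⟨fun y => u (0, y), ContinuousAt.comp' (g := u) (f := fun y : ℝ => ((0:ℝ), y)) hu.continuousAt tendsto_0y, hu0, ?_⟩
  filter_upwards [tendsto_0y.eventually hFu] with y hy
  rw [hy, Finset.sum_eq_zero, zero_add]
  intro j hj
  have : Dy^[j] F ((0:ℝ), (0:ℝ)) = 0 := h j (Finset.mem_range.1 hj)
  simp [this]

lemma OrdY_of {F : V2 → ℝ} (hF : AnalyticAt ℝ F 0) {k : ℕ} {v : ℝ → ℝ} (hv : ContinuousAt v 0)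
    (hv0 : v 0 ≠ 0) (h : ∀ᶠ y in 𝓝 (0:ℝ), F (0, y) = y ^ k * v y) : OrdY F k := by
  have h1 : ∀ j < k, Dy^[j] F 0 = 0 := by
    intro j
    induction j using Nat.strong_induction_on with
    | _ j ih =>
      intro hj
      obtain ⟨u, hu, hu0, hFu⟩ := taylor_0y hF (m := j) fun i hi => ih i hi (hi.trans hj)
      have := pow_cancel hu hv hj (by filter_upwards [h, hFu] with y h1 h2; rw [← h1, ← h2])
      rw [this] at hu0
      have hf : (j.factorial : ℝ) ≠ 0 := by positivity
      rcases div_eq_zero_iff.1 hu0.symm with h | h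
      · exact h
      · exact absurd h hf
  refine ⟨h1, fun h2 => hv0 ?_⟩
  obtain ⟨u, hu, hu0, hFu⟩ := taylor_0y hF (m := k + 1) fun i hi => by
    rcases Nat.lt_succ_iff_lt_or_eq.1 hi with h | h
    · exact h1 i h
    · rw [h, h2]
  exact pow_cancel hv hu (Nat.lt_succ_self k) (by filter_upwards [h, hFu] with y h1 h2; rw [← h1, ← h2])

lemma fac1 {f : ℝ → ℝ} (hf : AnalyticAt ℝ f 0) (h : ¬ ∀ᶠ x in 𝓝 0, f x = 0) :
    ∃ (n : ℕ) (B : ℝ → ℝ), AnalyticAt ℝ B 0 ∧ B 0 ≠ 0 ∧ ∀ᶠ x in 𝓝 0, f x = x ^ n * B x := by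
  obtain ⟨n, B, h1, h2, h3⟩ := hf.exists_eventuallyEq_pow_smul_nonzero_iff.2 h
  exact ⟨n, B, h1, h2, by simpa using h3⟩

lemma an_comp2 {F : V2 → ℝ} (hF : AnalyticAt ℝ F 0) {a b : ℝ → ℝ} (ha : AnalyticAt ℝ a 0)
    (hb : AnalyticAt ℝ b 0) (ha0 : a 0 = 0) (hb0 : b 0 = 0) : AnalyticAt ℝ (fun x => F (a x, b x)) 0 := by
  have h00 : (a 0, b 0) = (0 : V2) := by rw [ha0, hb0]; rfl
  exact AnalyticAt.fun_comp (g := F) (f := fun x : ℝ => (a x, b x)) (by rw [h00]; exact hF) (ha.prod hb)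

lemma root_aux (c : V2) (n : ℕ) : ∀ {G : V2 → ℝ}, AnalyticAt ℝ G 0 →
    (∃ v : ℝ → ℝ, ContinuousAt v 0 ∧ v 0 ≠ 0 ∧ ∀ᶠ τ in 𝓝 (0:ℝ), G (τ * c.1, τ * c.2) = τ ^ n * v τ) →
    ∃ (a : ℕ) (F : V2 → ℝ) (m : ℕ), AnalyticAt ℝ F 0 ∧ OrdY F m ∧ ∀ᶠ q in 𝓝 0, G q = q.1 ^ a * F q := by
  induction n with
  | zero =>
    rintro G hG ⟨v, hv, hv0, h⟩
    refine ⟨0, G, 0, hG, ⟨by simp, ?_⟩, by simp⟩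
    have := h.self_of_nhds
    simp at this
    show G (0, 0) ≠ 0
    rw [this]; exact hv0
  | succ n ih =>
    rintro G hG ⟨v, hv, hv0, h⟩
    by_cases hz : ∀ᶠ y in 𝓝 (0:ℝ), G (0, y) = 0
    · obtain ⟨u, hu, hGu⟩ := div_x hG
      have hGu' : ∀ᶠ q : V2 in 𝓝 0, G q = q.1 * u q := by
        have := (continuous_snd.tendsto (0:V2)).eventually hz
        filter_upwards [this, hGu] with q h1 h2
        rw [h2, h1, zero_add]
      have hcu : AnalyticAt ℝ (fun τ : ℝ => u (τ * c.1, τ * c.2)) 0 :=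
        an_comp2 hu (analyticAt_id.mul analyticAt_const) (analyticAt_id.mul analyticAt_const) (by simp) (by simp)
      have htc : Tendsto (fun τ : ℝ => ((τ * c.1, τ * c.2) : V2)) (𝓝 0) (𝓝 0) := by
        have : Continuous fun τ : ℝ => ((τ * c.1, τ * c.2) : V2) := by fun_prop
        have h2 := this.tendsto 0
        simp only [zero_mul] at h2
        exact h2
      have hc1 : c.1 ≠ 0 := by
        intro h0
        apply hv0
        refine pow_cancel (m := n + 1) (k := n + 2) (b := fun _ => 0) hv continuousAt_const (by omega) ?_
        filter_upwards [h, htc.eventually hGu'] with τ h1 h2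
        rw [← h1, h2, h0]; simp
      obtain ⟨a, F, m, hF, ho, hF'⟩ := ih hu ⟨fun τ => v τ / c.1, hv.div_const _, div_ne_zero hv0 hc1, by
        have e : (fun τ : ℝ => u (τ * c.1, τ * c.2)) =ᶠ[𝓝[≠] 0] fun τ => τ ^ n * (v τ / c.1) := by
          filter_upwards [h.filter_mono nhdsWithin_le_nhds,
            (htc.eventually hGu').filter_mono nhdsWithin_le_nhds, self_mem_nhdsWithin] with τ h1 h2 h3
          have h3' : τ ≠ 0 := h3
          rw [h2] at h1
          rw [pow_succ] at h1
          field_simp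
          have : τ * (c.1 * u (τ * c.1, τ * c.2)) = τ * (τ ^ n * v τ) := by linarith
          have := mul_left_cancel₀ h3' this
          linarith
        exact (ContinuousAt.eventuallyEq_nhds_iff_eventuallyEq_nhdsNE hcu.continuousAt
          ((continuousAt_id.pow n).mul (hv.div_const _))).1 e⟩
      refine ⟨a + 1, F, m, hF, ho, ?_⟩
      filter_upwards [hGu', hF'] with q h1 h2
      rw [h1, h2]; ring
    · have hG0 : AnalyticAt ℝ (fun y : ℝ => G (0, y)) 0 :=
        an_comp2 hG analyticAt_const analyticAt_id rfl rfl
      obtain ⟨k, B, hB, hB0, hGB⟩ := fac1 hG0 hz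
      exact ⟨0, G, k, hG, OrdY_of hG hB.continuousAt hB0 hGB, by simp⟩

lemma root {G : V2 → ℝ} (hG : AnalyticAt ℝ G 0) (hne : ¬ ∀ᶠ q in 𝓝 0, G q = 0) :
    ∃ (a : ℕ) (F : V2 → ℝ) (m : ℕ), AnalyticAt ℝ F 0 ∧ OrdY F m ∧ ∀ᶠ q in 𝓝 0, G q = q.1 ^ a * F q := by
  by_cases hc : ∃ c : V2, ¬ ∀ᶠ τ in 𝓝 (0:ℝ), G (τ * c.1, τ * c.2) = 0
  · obtain ⟨c, hc⟩ := hc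
    have hcG : AnalyticAt ℝ (fun τ : ℝ => G (τ * c.1, τ * c.2)) 0 :=
      an_comp2 hG (analyticAt_id.mul analyticAt_const) (analyticAt_id.mul analyticAt_const) (by simp) (by simp)
    obtain ⟨n, B, hB, hB0, hGB⟩ := fac1 hcG hc
    exact root_aux c n hG ⟨B, hB.continuousAt, hB0, hGB⟩
  · push Not at hc
    exfalso; apply hne
    obtain ⟨r, hr, hr'⟩ := Metric.eventually_nhds_iff.1 hG.eventually_analyticAt
    filter_upwards [Metric.ball_mem_nhds (0:V2) hr] with q hq
    have han : AnalyticOnNhd ℝ (fun τ : ℝ => G (τ * q.1, τ * q.2)) (Icc 0 1) := by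
      intro τ hτ
      have hd : dist ((τ * q.1, τ * q.2) : V2) 0 < r := by
        rw [mem_ball_zero_iff] at hq
        rw [dist_zero_right]
        have e : ((τ * q.1, τ * q.2) : V2) = τ • q := rfl
        rw [e, norm_smul, Real.norm_of_nonneg hτ.1]
        calc τ * ‖q‖ ≤ 1 * ‖q‖ := by gcongr; exact hτ.2
          _ < r := by rwa [one_mul]
      exact AnalyticAt.fun_comp (g := G) (f := fun τ : ℝ => (τ * q.1, τ * q.2)) (hr' hd)
        ((analyticAt_id.mul analyticAt_const).prod (analyticAt_id.mul analyticAt_const))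
    have := han.eqOn_zero_of_preconnected_of_eventuallyEq_zero isPreconnected_Icc
      (left_mem_Icc.2 zero_le_one) (hc q) (right_mem_Icc.2 zero_le_one)
    simpa using this

lemma NP {κ : Type} [Fintype κ] {A : κ → ℝ → ℝ} (hA : ∀ k, AnalyticAt ℝ (A k) 0) (hA0 : ∀ k, A k 0 = 0)
    {d : κ → ℕ} (hd : ∀ k, 0 < d k) {N : ℕ} (hN : 0 < N) (hdN : ∀ k, d k ∣ N)
    (hne : ∃ k, ¬ ∀ᶠ x in 𝓝 0, A k x = 0) :
    ∃ (p : ℕ) (B : κ → ℝ → ℝ), 0 < p ∧ (∀ k, AnalyticAt ℝ (B k) 0) ∧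
      (∀ k, ∀ᶠ x in 𝓝 0, A k (x ^ N) = x ^ (p * d k) * B k x) ∧ (∃ k, B k 0 ≠ 0) ∧
      ∀ k, (∀ᶠ x in 𝓝 0, A k x = 0) → ∀ x, B k x = 0 := by
  classical
  have hfac : ∀ k, ∃ (n : ℕ) (B : ℝ → ℝ), AnalyticAt ℝ B 0 ∧ ((¬ ∀ᶠ x in 𝓝 0, A k x = 0) → B 0 ≠ 0 ∧ 0 < n) ∧
      (∀ᶠ x in 𝓝 0, A k x = x ^ n * B x) ∧ ((∀ᶠ x in 𝓝 0, A k x = 0) → ∀ x, B x = 0) := by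
    intro k
    by_cases h : ∀ᶠ x in 𝓝 0, A k x = 0
    · exact ⟨0, fun _ => 0, analyticAt_const, fun h' => absurd h h', by simpa using h, fun _ _ => rfl⟩
    · obtain ⟨n, B, h1, h2, h3⟩ := fac1 (hA k) h
      refine ⟨n, B, h1, fun _ => ⟨h2, Nat.pos_of_ne_zero ?_⟩, h3, fun h' => absurd h' h⟩
      rintro rfl
      have := h3.self_of_nhds
      rw [hA0] at this
      simp at this; exact h2 this.symm
  choose n B hB hB0 hAB hz using hfac
  set S := Finset.univ.filter fun k => ¬ ∀ᶠ x in 𝓝 0, A k x = 0 with hS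
  have hSn : S.Nonempty := by
    obtain ⟨k, hk⟩ := hne; exact ⟨k, by simpa [hS] using hk⟩
  obtain ⟨k0, hk0, hmin⟩ := Finset.exists_min_image S (fun k => N / d k * n k) hSn
  have hk0' : ¬ ∀ᶠ x in 𝓝 0, A k0 x = 0 := by simpa [hS] using hk0
  set p := N / d k0 * n k0 with hp
  have hdiv : ∀ k, N / d k * d k = N := fun k => Nat.div_mul_cancel (hdN k)
  have hx0 : Tendsto (fun x : ℝ => x ^ N) (𝓝 0) (𝓝 0) := by
    have : Continuous fun x : ℝ => x ^ N := by fun_prop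
    have h2 := this.tendsto 0
    simpa [zero_pow hN.ne'] using h2
  refine ⟨p, fun k x => x ^ (N * n k - p * d k) * B k (x ^ N), ?_, ?_, ?_, ⟨k0, ?_⟩, ?_⟩
  · exact Nat.mul_pos (Nat.div_pos (Nat.le_of_dvd hN (hdN k0)) (hd k0)) (hB0 k0 hk0').2
  · intro k
    refine (analyticAt_id.pow _).mul (AnalyticAt.fun_comp (g := B k) (f := fun x : ℝ => x ^ N) ?_ (analyticAt_id.pow _))
    simp only [zero_pow hN.ne']; exact hB k
  · intro k
    by_cases h : ∀ᶠ x in 𝓝 0, A k x = 0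
    · filter_upwards [hx0.eventually h] with x hx
      rw [hx, hz k h]; simp
    · have hle : p * d k ≤ N * n k := by
        calc p * d k ≤ N / d k * n k * d k := Nat.mul_le_mul_right _ (hmin k (by simpa [hS] using h))
          _ = (N / d k * d k) * n k := by ring
          _ = _ := by rw [hdiv]
      filter_upwards [hx0.eventually (hAB k)] with x hx
      rw [hx, ← mul_assoc, ← pow_add, ← pow_mul]; congr 2; omega
  · have : N * n k0 - p * d k0 = 0 := by
      have : p * d k0 = N * n k0 := by
        calc p * d k0 = (N / d k0 * d k0) * n k0 := by rw [hp]; ring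
          _ = _ := by rw [hdiv]
      omega
    simp only [this, pow_zero, one_mul, zero_pow hN.ne']
    exact (hB0 k0 hk0').1
  · intro k h x; simp [hz k h]

open Polynomial in
lemma poly_mult {P : ℝ[X]} {m : ℕ} (hdeg : P.natDegree = m) (hP : P ≠ 0) (w0 : ℝ) :
    ∃ (k : ℕ) (R : ℝ[X]), k ≤ m ∧ R.eval w0 ≠ 0 ∧ P = (X - C w0) ^ k * R ∧
      (k = m → ∃ c : ℝ, P = C c * (X - C w0) ^ m) := by
  obtain ⟨R, hR, hnd⟩ := P.exists_eq_pow_rootMultiplicity_mul_and_not_dvd hP w0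
  have hR0 : R ≠ 0 := by rintro rfl; simp at hnd
  have hd : P.natDegree = P.rootMultiplicity w0 + R.natDegree := by
    conv_lhs => rw [hR]
    rw [natDegree_mul (pow_ne_zero _ (X_sub_C_ne_zero _)) hR0, natDegree_pow, natDegree_X_sub_C, mul_one]
  refine ⟨P.rootMultiplicity w0, R, by omega, ?_, hR, ?_⟩
  · intro h; exact hnd (dvd_iff_isRoot.2 h)
  · intro h
    refine ⟨R.coeff 0, ?_⟩
    have : R = C (R.coeff 0) := eq_C_of_natDegree_eq_zero (by omega)
    rw [← this, ← h, mul_comm]; exact hR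

lemma EBat.add {F G : V2 → ℝ} {C D : ℝ} {q : V2} (hF : EBat F C q) (hG : EBat G D q) :
    EBat (fun q => F q + G q) (C + D) q := by
  obtain ⟨a1, a2, a3, a4⟩ := hF
  obtain ⟨b1, b2, b3, b4⟩ := hG
  refine ⟨a1.add b1, (abs_add_le _ _).trans (add_le_add a2 b2), ?_, ?_⟩ <;>
  · rw [fderiv_fun_add a1 b1]
    simp only [add_apply, mul_add]
    exact (abs_add_le _ _).trans (add_le_add (by assumption) (by assumption))

lemma EBat.mul {F G : V2 → ℝ} {C D : ℝ} {q : V2} (hF : EBat F C q) (hG : EBat G D q) :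
    EBat (fun q => F q * G q) (2 * (C * D)) q := by
  obtain ⟨a1, a2, a3, a4⟩ := hF
  obtain ⟨b1, b2, b3, b4⟩ := hG
  have hC : 0 ≤ C := (abs_nonneg _).trans a2
  have hD : 0 ≤ D := (abs_nonneg _).trans b2
  refine ⟨a1.mul b1, ?_, ?_, ?_⟩
  · rw [abs_mul]
    have := mul_le_mul a2 b2 (abs_nonneg _) hC
    have : 0 ≤ C * D := by positivity
    linarith
  · rw [fderiv_fun_mul a1 b1]
    simp only [add_apply, _root_.smul_apply, smul_eq_mul]
    rw [show q.1 * (F q * fderiv ℝ G q (1, 0) + G q * fderiv ℝ F q (1, 0)) =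
      F q * (q.1 * fderiv ℝ G q (1, 0)) + (q.1 * fderiv ℝ F q (1, 0)) * G q by ring]
    refine (abs_add_le _ _).trans ?_
    rw [abs_mul (F q), abs_mul _ (G q)]
    have := mul_le_mul a2 b3 (abs_nonneg _) hC
    have := mul_le_mul a3 b2 (abs_nonneg _) hC
    linarith
  · rw [fderiv_fun_mul a1 b1]
    simp only [add_apply, _root_.smul_apply, smul_eq_mul]
    rw [show q.2 * (F q * fderiv ℝ G q (0, 1) + G q * fderiv ℝ F q (0, 1)) =
      F q * (q.2 * fderiv ℝ G q (0, 1)) + (q.2 * fderiv ℝ F q (0, 1)) * G q by ring]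
    refine (abs_add_le _ _).trans ?_
    rw [abs_mul (F q), abs_mul _ (G q)]
    have := mul_le_mul a2 b4 (abs_nonneg _) hC
    have := mul_le_mul a4 b2 (abs_nonneg _) hC
    linarith

lemma EBat.sum {κ : Type} (s : Finset κ) {F : κ → V2 → ℝ} {C : κ → ℝ} {q : V2}
    (h : ∀ i ∈ s, EBat (F i) (C i) q) : EBat (fun q => ∑ i ∈ s, F i q) (∑ i ∈ s, C i) q := by
  classical
  induction s using Finset.induction_on with
  | empty => simp only [Finset.sum_empty]; exact ⟨by simp, by simp, by simp, by simp⟩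
  | insert a s ha ih =>
    simp_rw [Finset.sum_insert ha]
    exact (h a (Finset.mem_insert_self _ _)).add (ih fun i hi => h i (Finset.mem_insert_of_mem hi))

lemma LDat.congr {F G : V2 → ℝ} {C : ℝ} {q : V2} (h : LDat F C q) (e : G =ᶠ[𝓝 q] F) :
    LDat G C q := by
  obtain ⟨a1, a2, a3, a4⟩ := h
  have := e.self_of_nhds
  refine ⟨a1.congr_of_eventuallyEq e, by rwa [this], ?_, ?_⟩ <;> rwa [e.fderiv_eq, this]

lemma LDat.mono {F : V2 → ℝ} {C D : ℝ} {q : V2} (h : LDat F C q) (hCD : C ≤ D) : LDat F D q := by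
  obtain ⟨a1, a2, a3, a4⟩ := h
  have : C * |F q| ≤ D * |F q| := by gcongr
  exact ⟨a1, a2, a3.trans this, a4.trans this⟩

lemma LDat_of {F : V2 → ℝ} {C c : ℝ} {q : V2} (h : EBat F C q) (hc : 0 < c) (hF : c ≤ |F q|) :
    LDat F (C / c) q := by
  obtain ⟨a1, a2, a3, a4⟩ := h
  have hC : 0 ≤ C := (abs_nonneg _).trans a2
  have : C ≤ C / c * |F q| := by
    rw [div_mul_eq_mul_div, le_div_iff₀ hc]; gcongr
  exact ⟨a1, abs_pos.1 (hc.trans_le hF), a3.trans this, a4.trans this⟩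

lemma LDat_fst {q : V2} (h : q.1 ≠ 0) : LDat (fun q => q.1) 1 q := by
  refine ⟨differentiableAt_fst, h, ?_, ?_⟩ <;> simp [fderiv_fst]

lemma LDat_snd {q : V2} (h : q.2 ≠ 0) : LDat (fun q => q.2) 1 q := by
  refine ⟨differentiableAt_snd, h, ?_, ?_⟩ <;> simp [fderiv_snd]

lemma LDat.pow {F : V2 → ℝ} {C : ℝ} {q : V2} (h : LDat F C q) (k : ℕ) :
    LDat (fun q => F q ^ k) (k * C) q := by
  have := LDat.prod (Finset.range k) (F := fun _ => F) (C := fun _ => C) fun _ => h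
  simpa using this

lemma LDat.inv {F : V2 → ℝ} {C : ℝ} {q : V2} (h : LDat F C q) :
    LDat (fun q => (F q)⁻¹) C q := by
  obtain ⟨a1, a2, a3, a4⟩ := h
  have hd := (hasDerivAt_inv a2).comp_hasFDerivAt q a1.hasFDerivAt
  have hp : 0 < |F q| := abs_pos.2 a2
  refine ⟨hd.differentiableAt, inv_ne_zero a2, ?_, ?_⟩ <;>
  · rw [show fderiv ℝ (fun q => (F q)⁻¹) q = _ from hd.fderiv]
    simp only [_root_.smul_apply, smul_eq_mul, abs_mul, abs_neg, abs_inv, abs_pow] at *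
    rw [← mul_assoc, mul_comm |_| (_)⁻¹, mul_assoc]
    calc (|F q| ^ 2)⁻¹ * _ ≤ (|F q| ^ 2)⁻¹ * (C * |F q|) := by gcongr
      _ = _ := by field_simp

lemma EB_an {F : V2 → ℝ} (hF : AnalyticAt ℝ F 0) : ∃ C > 0, ∀ᶠ q in 𝓝 0, EBat F C q := by
  have h1 := hF.continuousAt.norm
  have h2 := hF.fderiv.continuousAt.norm
  set C := max (‖F 0‖ + 1) (‖fderiv ℝ F 0‖ + 1) with hC
  refine ⟨C, by positivity, ?_⟩
  filter_upwards [hF.eventually_analyticAt, h1.eventually (gt_mem_nhds (lt_add_one ‖F 0‖)),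
    h2.eventually (gt_mem_nhds (lt_add_one ‖fderiv ℝ F 0‖)),
    Metric.ball_mem_nhds (0:V2) one_pos] with q a1 a2 a3 a4
  rw [mem_ball_zero_iff, Prod.norm_def, max_lt_iff] at a4
  have n1 : ‖fderiv ℝ F q (1, 0)‖ ≤ C := by
    refine ((fderiv ℝ F q).le_opNorm _).trans ?_
    simp only [Prod.norm_def]
    simp; exact a3.le.trans (le_max_right _ _)
  have n2 : ‖fderiv ℝ F q (0, 1)‖ ≤ C := by
    refine ((fderiv ℝ F q).le_opNorm _).trans ?_
    simp only [Prod.norm_def]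
    simp; exact a3.le.trans (le_max_right _ _)
  refine ⟨a1.differentiableAt, a2.le.trans (le_max_left _ _), ?_, ?_⟩
  · rw [abs_mul]
    calc _ ≤ 1 * C := mul_le_mul a4.1.le n1 (abs_nonneg _) zero_le_one
      _ = C := one_mul C
  · rw [abs_mul]
    calc _ ≤ 1 * C := mul_le_mul a4.2.le n2 (abs_nonneg _) zero_le_one
      _ = C := one_mul C

lemma EB_term {a : ℝ → ℝ} (ha : AnalyticAt ℝ a 0) (p k : ℕ) (hk : 0 < k) :
    ∃ C > 0, ∀ η : ℝ, 0 < η → η ≤ 1 → ∀ᶠ q : V2 in 𝓝 0, 0 < q.1 → η⁻¹ * q.1 ^ p ≤ |q.2| → q.2 ≠ 0 →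
      EBat (fun q => a q.1 * (q.1 ^ p * q.2⁻¹) ^ k) (C * η) q := by
  obtain ⟨C, hC, h⟩ := EB_an (F := fun q => a q.1)
    (AnalyticAt.fun_comp (g := a) (f := fun q : V2 => q.1) ha analyticAt_fst)
  refine ⟨2 * (C * (1 + k * (p + 1))), by positivity, fun η h0 h1 => ?_⟩
  filter_upwards [h] with q hq hq1 hq2 hq3
  have l1 := (((LDat_fst hq1.ne').pow p).mul (LDat_snd hq3).inv).pow k
  have l2 := hq.mul l1.eb
  refine ⟨l2.1, ?_⟩
  have hs : |(q.1 ^ p * q.2⁻¹) ^ k| ≤ η := by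
    rw [abs_pow]
    have : |q.1 ^ p * q.2⁻¹| ≤ η := by
      rw [abs_mul, abs_inv, abs_of_pos (pow_pos hq1 p), ← div_eq_mul_inv, div_le_iff₀ (abs_pos.2 hq3)]
      have := mul_le_mul_of_nonneg_left hq2 h0.le
      rwa [← mul_assoc, mul_inv_cancel₀ h0.ne', one_mul] at this
    calc |q.1 ^ p * q.2⁻¹| ^ k ≤ |q.1 ^ p * q.2⁻¹| ^ 1 :=
          pow_le_pow_of_le_one (abs_nonneg _) (this.trans h1) hk
      _ ≤ η := by rwa [pow_one]
  have hle : 2 * (C * ((1 + k * (p * 1 + 1)) * |(q.1 ^ p * q.2⁻¹) ^ k|)) ≤ 2 * (C * (1 + k * (p + 1))) * η := by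
    rw [mul_one]
    calc _ ≤ 2 * (C * ((1 + k * (p + 1)) * η)) := by gcongr
      _ = _ := by ring
  exact ⟨l2.2.1.trans hle, l2.2.2.1.trans hle, l2.2.2.2.trans hle⟩

lemma LD_V {u : V2 → ℝ} (hu : AnalyticAt ℝ u 0) (hu0 : u 0 ≠ 0) {m : ℕ} {a : ℕ → ℝ → ℝ}
    (ha : ∀ j < m, AnalyticAt ℝ (a j) 0) (p : ℕ) :
    ∃ θ > 0, ∃ C, ∀ᶠ q : V2 in 𝓝 0, 0 < q.1 → θ * q.1 ^ p ≤ |q.2| → q.2 ≠ 0 →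
      LDat (fun q => u q + ∑ j ∈ Finset.range m, a j q.1 * (q.1 ^ p * q.2⁻¹) ^ (m - j)) C q := by
  have hT : ∀ j : ℕ, ∃ C > 0, j < m → ∀ η : ℝ, 0 < η → η ≤ 1 → ∀ᶠ q : V2 in 𝓝 0, 0 < q.1 →
      η⁻¹ * q.1 ^ p ≤ |q.2| → q.2 ≠ 0 →
      EBat (fun q => a j q.1 * (q.1 ^ p * q.2⁻¹) ^ (m - j)) (C * η) q := by
    intro j
    by_cases hj : j < m
    · obtain ⟨C, hC, h⟩ := EB_term (ha j hj) p (m - j) (by omega)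
      exact ⟨C, hC, fun _ => h⟩
    · exact ⟨1, one_pos, fun h => absurd h hj⟩
  choose C hC hE using hT
  obtain ⟨C0, hC0, hu'⟩ := EB_an hu
  set S := ∑ j ∈ Finset.range m, C j with hS
  have hS0 : 0 ≤ S := Finset.sum_nonneg fun j _ => (hC j).le
  have hup : 0 < |u 0| := abs_pos.2 hu0
  set η := min 1 (|u 0| / (4 * (S + 1))) with hη
  have hη0 : 0 < η := by positivity
  have hη1 : η ≤ 1 := min_le_left _ _
  have hSη : S * η ≤ |u 0| / 4 := by
    calc S * η ≤ (S + 1) * (|u 0| / (4 * (S + 1))) := by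
          gcongr; · linarith
          · exact min_le_right _ _
      _ = _ := by field_simp
  refine ⟨η⁻¹, by positivity, (C0 + S * η) / (|u 0| / 4), ?_⟩
  have hall : ∀ᶠ q : V2 in 𝓝 0, ∀ j ∈ Finset.range m, 0 < q.1 →
      η⁻¹ * q.1 ^ p ≤ |q.2| → q.2 ≠ 0 →
      EBat (fun q => a j q.1 * (q.1 ^ p * q.2⁻¹) ^ (m - j)) (C j * η) q := by
    rw [Filter.eventually_all_finset]
    intro j hj
    exact hE j (Finset.mem_range.1 hj) η hη0 hη1
  have hlow : ∀ᶠ q in 𝓝 (0:V2), |u 0| / 2 < |u q| :=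
    hu.continuousAt.abs.eventually (lt_mem_nhds (by linarith))
  filter_upwards [hall, hu', hlow] with q h1 h2 h3 hq1 hq2 hq3
  have hsum := EBat.sum (Finset.range m) fun j hj => h1 j hj hq1 hq2 hq3
  rw [← Finset.sum_mul] at hsum
  refine LDat_of (h2.add hsum) (by positivity) ?_
  have := hsum.2.1
  have h5 := abs_sub_abs_le_abs_add (u q) (∑ j ∈ Finset.range m, a j q.1 * (q.1 ^ p * q.2⁻¹) ^ (m - j))
  linarith

lemma LD_u {u : V2 → ℝ} (hu : AnalyticAt ℝ u 0) (hu0 : u 0 ≠ 0) :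
    ∃ C, ∀ᶠ q : V2 in 𝓝 0, LDat u C q := by
  obtain ⟨C0, hC0, hu'⟩ := EB_an hu
  have hup : 0 < |u 0| := abs_pos.2 hu0
  refine ⟨C0 / (|u 0| / 2), ?_⟩
  have hlow : ∀ᶠ q in 𝓝 (0:V2), |u 0| / 2 < |u q| :=
    hu.continuousAt.abs.eventually (lt_mem_nhds (by linarith))
  filter_upwards [hu', hlow] with q h2 h3
  exact LDat_of h2 (by positivity) h3.le

lemma LD_H {H V : V2 → ℝ} {a m p : ℕ} {θ C : ℝ}
    (hH : ∀ᶠ q : V2 in 𝓝 0, 0 < q.1 → q.2 ≠ 0 → H q = q.1 ^ a * (q.2 ^ m * V q))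
    (hV : ∀ᶠ q : V2 in 𝓝 0, 0 < q.1 → θ * q.1 ^ p ≤ |q.2| → q.2 ≠ 0 → LDat V C q) :
    ∃ C', ∀ᶠ q : V2 in 𝓝 0, 0 < q.1 → θ * q.1 ^ p ≤ |q.2| → q.2 ≠ 0 → LDat H C' q := by
  refine ⟨a * 1 + (m * 1 + C), ?_⟩
  filter_upwards [hV, hH.eventually_nhds] with q h1 h2 hq1 hq2 hq3
  refine (((LDat_fst hq1.ne').pow a).mul (((LDat_snd hq3).pow m).mul (h1 hq1 hq2 hq3))).congr ?_
  have e1 : ∀ᶠ q' : V2 in 𝓝 q, 0 < q'.1 := continuousAt_fst.eventually (lt_mem_nhds hq1)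
  have e2 : ∀ᶠ q' : V2 in 𝓝 q, q'.2 ≠ 0 := continuousAt_snd.eventually_ne hq3
  filter_upwards [h2, e1, e2] with q' a1 a2 a3
  exact a1 a2 a3

def SB (b : V2 → ℝ) (K : ℝ) : Prop := ∀ q : V2, 0 < q.1 →
  DifferentiableAt ℝ b q ∧ |b q| ≤ K ∧ |q.1 * fderiv ℝ b q (1, 0)| ≤ K ∧
    (1 + |q.2|) * |fderiv ℝ b q (0, 1)| ≤ K

lemma SB.nonneg {b : V2 → ℝ} {K : ℝ} (h : SB b K) : 0 ≤ K :=
  (abs_nonneg _).trans (h (1, 0) one_pos).2.1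

lemma SB.eb {b : V2 → ℝ} {K : ℝ} (h : SB b K) {q : V2} (hq : 0 < q.1) : EBat b K q := by
  obtain ⟨a1, a2, a3, a4⟩ := h q hq
  refine ⟨a1, a2, a3, le_trans ?_ a4⟩
  rw [abs_mul]; gcongr; linarith [abs_nonneg q.2]

lemma SB.mul {b c : V2 → ℝ} {K L : ℝ} (hb : SB b K) (hc : SB c L) :
    SB (fun q => b q * c q) (2 * (K * L)) := by
  intro q hq
  have hK := hb.nonneg
  have e := (hb.eb hq).mul (hc.eb hq)
  refine ⟨e.1, e.2.1, e.2.2.1, ?_⟩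
  obtain ⟨a1, a2, a3, a4⟩ := hb q hq
  obtain ⟨b1, b2, b3, b4⟩ := hc q hq
  rw [fderiv_fun_mul a1 b1]
  simp only [add_apply, _root_.smul_apply, smul_eq_mul]
  have h1 : |b q * fderiv ℝ c q (0, 1) + c q * fderiv ℝ b q (0, 1)| ≤
      |b q| * |fderiv ℝ c q (0, 1)| + |fderiv ℝ b q (0, 1)| * |c q| := by
    refine (abs_add_le _ _).trans ?_
    rw [abs_mul, abs_mul, mul_comm |c q|]
  have h2 := mul_le_mul a2 b4 (by positivity) hK
  have h3 := mul_le_mul a4 b2 (abs_nonneg _) hK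
  have h4 : (0:ℝ) ≤ 1 + |q.2| := by positivity
  have := mul_le_mul_of_nonneg_left h1 h4
  linarith

lemma bdd_cs {f : ℝ → ℝ} (hf : Continuous f) {R : ℝ} (hR : ∀ x, R ≤ |x| → f x = 0) :
    ∃ C > 0, ∀ x, |f x| ≤ C := by
  obtain ⟨C, hC⟩ := (isCompact_Icc (a := -R) (b := R)).exists_bound_of_continuousOn hf.continuousOn
  refine ⟨max C 1, by positivity, fun x => ?_⟩
  by_cases hx : |x| ≤ R
  · exact (hC x (abs_le.1 hx)).trans (le_max_left _ _)
  · rw [hR x (not_le.1 hx).le]; simp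

lemma cs_deriv {χ : ℝ → ℝ} (hχ : ContDiff ℝ 1 χ) {R : ℝ} (hR : ∀ x, R ≤ |x| → χ x = 0) (w0 : ℝ) :
    ∃ C > 0, ∀ x, |χ x| ≤ C ∧ (1 + |x - w0|) * |deriv χ x| ≤ C := by
  obtain ⟨C1, h1, h1'⟩ := bdd_cs hχ.continuous hR
  have hd : Continuous (deriv χ) := hχ.continuous_deriv le_rfl
  have hdz : ∀ x, R + 1 ≤ |x| → deriv χ x = 0 := by
    intro x hx
    have : χ =ᶠ[𝓝 x] fun _ => 0 := by
      have : ∀ᶠ y in 𝓝 x, R < |y| := continuous_abs.continuousAt.eventually (lt_mem_nhds (by linarith))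
      filter_upwards [this] with y hy
      exact hR y hy.le
    rw [this.deriv_eq]; simp
  obtain ⟨C2, h2, h2'⟩ := bdd_cs (f := fun x => (1 + |x - w0|) * deriv χ x)
    ((continuous_const.add (continuous_id.sub continuous_const).abs).mul hd) (R := R + 1) fun x hx => by
      rw [hdz x hx, mul_zero]
  refine ⟨max C1 C2, by positivity, fun x => ⟨(h1' x).trans (le_max_left _ _), ?_⟩⟩
  have := h2' x
  rw [abs_mul, abs_of_nonneg (by positivity : (0:ℝ) ≤ 1 + |x - w0|)] at this
  exact this.trans (le_max_right _ _)

lemma SB_snd {χ : ℝ → ℝ} (hχ : ContDiff ℝ 1 χ) {R : ℝ} (hR : ∀ x, R ≤ |x| → χ x = 0) (w0 : ℝ) :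
    ∃ C > 0, SB (fun q => χ (w0 + q.2)) C := by
  obtain ⟨C, hC, h⟩ := cs_deriv hχ hR w0
  refine ⟨C, hC, fun q hq => ?_⟩
  have hd : HasFDerivAt (fun q : V2 => χ (w0 + q.2))
      (deriv χ (w0 + q.2) • ContinuousLinearMap.snd ℝ ℝ ℝ) q :=
    ((hχ.differentiable one_ne_zero).differentiableAt.hasDerivAt).comp_hasFDerivAt q
      (hasFDerivAt_snd.const_add w0)
  refine ⟨hd.differentiableAt, (h _).1, ?_, ?_⟩
  · rw [hd.fderiv]; simp; exact hC.le
  · rw [hd.fderiv]; simpa using (h (w0 + q.2)).2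

def Wy (M T : ℕ) (e : ℝ → ℝ) (p : V2) : ℝ :=
  (p.2 / p.1 - e (p.1 ^ ((M:ℝ)⁻¹))) / (p.1 ^ ((M:ℝ)⁻¹)) ^ T

lemma Phi_Wy {M : ℕ} (hM : 0 < M) (T : ℕ) (e : ℝ → ℝ) {p : V2} (hp : 0 < p.1) :
    Phi M T e (p.1 ^ ((M:ℝ)⁻¹), Wy M T e p) = p := by
  have h1 : (p.1 ^ ((M:ℝ)⁻¹)) ^ M = p.1 := Real.rpow_inv_natCast_pow hp.le hM.ne'
  have h2 : 0 < p.1 ^ ((M:ℝ)⁻¹) := Real.rpow_pos_of_pos hp _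
  unfold Phi Wy
  ext
  · exact h1
  · simp only [h1]
    rw [mul_div_cancel₀ _ (pow_pos h2 T).ne']
    field_simp; ring

lemma Wy_Phi {M : ℕ} (hM : 0 < M) (T : ℕ) (e : ℝ → ℝ) {q : V2} (hq : 0 < q.1) :
    Wy M T e (Phi M T e q) = q.2 := by
  have h1 : (q.1 ^ M) ^ ((M:ℝ)⁻¹) = q.1 := Real.pow_rpow_inv_natCast hq.le hM.ne'
  unfold Phi Wy
  simp only [h1]
  rw [mul_div_cancel_left₀ _ (pow_pos hq M).ne', add_sub_cancel_left,
    mul_div_cancel_left₀ _ (pow_pos hq T).ne']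

lemma measurable_Wy (M T : ℕ) {e : ℝ → ℝ} (he : Measurable e) : Measurable (Wy M T e) := by
  unfold Wy
  have : Measurable fun x : ℝ => x ^ ((M:ℝ)⁻¹) := by fun_prop
  exact ((measurable_snd.div measurable_fst).sub (he.comp (this.comp measurable_fst))).div
    ((this.comp measurable_fst).pow_const T)

structure Symb (M T : ℕ) (e : ℝ → ℝ) (ρ : ℝ) (β : V2 → ℝ) (K : ℝ) : Prop where
  ms : AEStronglyMeasurable β (volume.restrict HP)
  sb : SB (fun q => β (Phi M T e q)) K
  sp : ∀ q : V2, 0 < q.1 → ρ ≤ q.1 → β (Phi M T e q) = 0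

lemma Symb.bd {M T : ℕ} {e : ℝ → ℝ} {ρ : ℝ} {β : V2 → ℝ} {K : ℝ} (h : Symb M T e ρ β K) (hM : 0 < M) :
    ∀ q ∈ HP, |β q| ≤ K := by
  intro q hq
  have := (h.sb (q.1 ^ ((M:ℝ)⁻¹), Wy M T e q) (Real.rpow_pos_of_pos hq _)).2.1
  beta_reduce at this
  rwa [Phi_Wy hM T e hq] at this

lemma Symb.mono {M T : ℕ} {e : ℝ → ℝ} {ρ ρ' : ℝ} {β : V2 → ℝ} {K : ℝ} (h : Symb M T e ρ β K)
    (hρ : ρ ≤ ρ') : Symb M T e ρ' β K :=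
  ⟨h.ms, h.sb, fun q h1 h2 => h.sp q h1 (hρ.trans h2)⟩

set_option maxHeartbeats 1000000 in
lemma Symb.chg {N p : ℕ} (hN : 0 < N) {a : ℝ → ℝ} (ha : AnalyticAt ℝ a 0) :
    ∃ D > 0, ∀ ρ' > 0, ∃ ρ1 > 0, ∀ {M T : ℕ} {e : ℝ → ℝ} {M' T' : ℕ} {e' : ℝ → ℝ},
      (∀ q : V2, 0 < q.1 → Phi M' T' e' q = Phi M T e (q.1 ^ N, a q.1 + q.1 ^ p * q.2)) →
      ∀ {β : V2 → ℝ} {K : ℝ}, Symb M T e ρ1 β K → Symb M' T' e' ρ' β (D * K) := by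
  have hdc : ContinuousAt (deriv a) 0 := ha.deriv.continuousAt
  set A := |a 0| + |deriv a 0| + 1 with hA
  have hA1 : 1 ≤ A := by linarith [abs_nonneg (a 0), abs_nonneg (deriv a 0)]
  have hev : ∀ᶠ x in 𝓝 (0:ℝ), DifferentiableAt ℝ a x ∧ |a x| < A ∧ |deriv a x| < A := by
    filter_upwards [ha.eventually_analyticAt,
      ha.continuousAt.abs.eventually (gt_mem_nhds (show |a 0| < A by linarith [abs_nonneg (deriv a 0)])),
      hdc.abs.eventually (gt_mem_nhds (show |deriv a 0| < A by linarith [abs_nonneg (a 0)]))] with x h1 h2 h3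
    exact ⟨h1.differentiableAt, h2, h3⟩
  obtain ⟨δ0, hδ0, hδ⟩ := Metric.eventually_nhds_iff.1 hev
  set δ := min δ0 1 with hδd
  have hδp : 0 < δ := lt_min hδ0 one_pos
  have hδ1 : δ ≤ 1 := min_le_right _ _
  refine ⟨N + (A + p * (1 + A)) + (1 + A) + 1, by positivity, fun ρ' hρ' => ?_⟩
  set ρ1 := min ((δ / 2) ^ N / 2) (ρ' ^ N) with hρ1
  have hρ1p : 0 < ρ1 := by positivity
  refine ⟨ρ1, hρ1p, ?_⟩
  intro M T e M' T' e' hrel β K hβ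
  have hK := hβ.sb.nonneg
  refine ⟨hβ.ms, ?_, ?_⟩
  · intro q hq
    by_cases hqd : q.1 < δ
    · -- chain rule
      have hq0 : dist q.1 0 < δ0 := by
        rw [dist_eq, sub_zero, abs_of_pos hq]; exact hqd.trans_le (min_le_left _ _)
      obtain ⟨d1, d2, d3⟩ := hδ hq0
      set b := fun q => β (Phi M T e q) with hb
      set ψ : V2 → V2 := fun q => (q.1 ^ N, a q.1 + q.1 ^ p * q.2) with hψ
      have hψ1 : 0 < (ψ q).1 := pow_pos hq N
      obtain ⟨b1, b2, b3, b4⟩ := hβ.sb (ψ q) hψ1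
      have heq : (fun q => β (Phi M' T' e' q)) =ᶠ[𝓝 q] fun q => b (ψ q) := by
        filter_upwards [continuousAt_fst.eventually (lt_mem_nhds hq)] with q' hq'
        rw [hrel q' hq']
      have f1 : HasFDerivAt (fun q : V2 => q.1 ^ N) ((N * q.1 ^ (N - 1)) • ContinuousLinearMap.fst ℝ ℝ ℝ) q := by
        have := (hasDerivAt_pow N q.1).comp_hasFDerivAt q (hasFDerivAt_fst (𝕜 := ℝ) (E := ℝ) (F := ℝ) (p := q))
        exact this
      have f2 : HasFDerivAt (fun q : V2 => q.1 ^ p) ((p * q.1 ^ (p - 1)) • ContinuousLinearMap.fst ℝ ℝ ℝ) q := by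
        have := (hasDerivAt_pow p q.1).comp_hasFDerivAt q (hasFDerivAt_fst (𝕜 := ℝ) (E := ℝ) (F := ℝ) (p := q))
        exact this
      have f3 : HasFDerivAt (fun q : V2 => a q.1) (deriv a q.1 • ContinuousLinearMap.fst ℝ ℝ ℝ) q := by
        have := d1.hasDerivAt.comp_hasFDerivAt q (hasFDerivAt_fst (𝕜 := ℝ) (E := ℝ) (F := ℝ) (p := q))
        exact this
      have f4 := f1.prodMk (f3.add (f2.mul (hasFDerivAt_snd (𝕜 := ℝ) (E := ℝ) (F := ℝ) (p := q))))
      have f5 := b1.hasFDerivAt.comp q f4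
      have f6 : HasFDerivAt (fun q => b (ψ q)) _ q := f5
      set Bx := fderiv ℝ b (ψ q) (1, 0) with hBx
      set By := fderiv ℝ b (ψ q) (0, 1) with hBy
      have hlin : ∀ s t : ℝ, fderiv ℝ b (ψ q) (s, t) = s * Bx + t * By := by
        intro s t
        have : ((s, t) : V2) = s • ((1:ℝ), (0:ℝ)) + t • ((0:ℝ), (1:ℝ)) := by simp
        rw [this, map_add, map_smul, map_smul, smul_eq_mul, smul_eq_mul]
      have hpN : q.1 * (N * q.1 ^ (N - 1)) = N * q.1 ^ N := by
        rw [← mul_pow_sub_one hN.ne' q.1]; ring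
      have hpp : q.1 * (p * q.1 ^ (p - 1)) = p * q.1 ^ p := by
        rcases Nat.eq_zero_or_pos p with h | h
        · simp [h]
        · rw [← mul_pow_sub_one h.ne' q.1]; ring
      have hy : |q.1 ^ p * q.2| ≤ (1 + A) * (1 + |(ψ q).2|) := by
        have : q.1 ^ p * q.2 = (ψ q).2 - a q.1 := by simp [hψ]
        rw [this]
        refine (abs_sub _ _).trans ?_
        have := abs_nonneg (ψ q).2
        nlinarith
      have hKA : |By| * (1 + |(ψ q).2|) ≤ K := by rw [mul_comm]; exact b4
      have hBy1 : |By| ≤ K := by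
        refine le_trans ?_ hKA
        have := abs_nonneg (ψ q).2
        have := abs_nonneg By
        nlinarith
      have hyB : |q.1 ^ p * q.2 * By| ≤ (1 + A) * K := by
        rw [abs_mul]
        calc _ ≤ (1 + A) * (1 + |(ψ q).2|) * |By| := by gcongr
          _ = (1 + A) * (|By| * (1 + |(ψ q).2|)) := by ring
          _ ≤ _ := by gcongr
      refine ⟨f6.differentiableAt.congr_of_eventuallyEq heq, ?_, ?_, ?_⟩
      · rw [heq.self_of_nhds]
        refine b2.trans ?_
        apply le_mul_of_one_le_left hK
        have : (0:ℝ) ≤ N + (A + p * (1 + A)) + (1 + A) := by positivity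
        linarith
      · rw [heq.fderiv_eq, f6.fderiv]
        have e1 : q.1 * (fderiv ℝ b (ψ q) (N * q.1 ^ (N - 1), deriv a q.1 + q.2 * (p * q.1 ^ (p - 1)))) =
            N * (q.1 ^ N * Bx) + (q.1 * deriv a q.1 * By + p * (q.1 ^ p * q.2 * By)) := by
          rw [hlin]
          linear_combination Bx * hpN + q.2 * By * hpp
        have e2 : |q.1 * (fderiv ℝ b (ψ q) (N * q.1 ^ (N - 1), deriv a q.1 + q.2 * (p * q.1 ^ (p - 1))))| ≤
            N * K + (A * K + p * ((1 + A) * K)) := by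
          rw [e1]
          refine (abs_add_le _ _).trans (add_le_add ?_ ((abs_add_le _ _).trans (add_le_add ?_ ?_)))
          · rw [abs_mul, Nat.abs_cast]; gcongr
          · rw [abs_mul, abs_mul, abs_of_pos hq]
            have : q.1 * |deriv a q.1| ≤ 1 * A := by gcongr; exact hqd.le.trans hδ1
            rw [one_mul] at this
            gcongr
          · rw [abs_mul, Nat.abs_cast]; gcongr
        have e3 : N * K + (A * K + p * ((1 + A) * K)) ≤ (N + (A + p * (1 + A)) + (1 + A) + 1) * K := by
          have : 0 ≤ (1 + A + 1) * K := by positivity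
          nlinarith
        refine le_trans (le_of_eq ?_) (e2.trans e3)
        simp only [ContinuousLinearMap.comp_apply, ContinuousLinearMap.prod_apply, add_apply, _root_.smul_apply, ContinuousLinearMap.coe_fst', ContinuousLinearMap.coe_snd', smul_eq_mul, mul_one, mul_zero, zero_add]
        rfl
      · rw [heq.fderiv_eq, f6.fderiv]
        have e1 : (1 + |q.2|) * |fderiv ℝ b (ψ q) (0, q.1 ^ p)| ≤ K + (1 + A) * K := by
          rw [hlin, zero_mul, zero_add]
          have hp1 : q.1 ^ p ≤ 1 := pow_le_one₀ hq.le (hqd.le.trans hδ1)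
          have hp0 : 0 < q.1 ^ p := pow_pos hq p
          rw [abs_mul, abs_of_pos hp0]
          rw [abs_mul, abs_mul, abs_of_pos hp0] at hyB
          have : q.1 ^ p * |By| ≤ 1 * K := by gcongr
          nlinarith
        have e3 : K + (1 + A) * K ≤ (N + (A + p * (1 + A)) + (1 + A) + 1) * K := by
          have : 0 ≤ (N + (A + p * (1 + A))) * K := by positivity
          nlinarith
        refine le_trans (le_of_eq ?_) (e1.trans e3)
        simp only [ContinuousLinearMap.comp_apply, ContinuousLinearMap.prod_apply, add_apply, _root_.smul_apply, ContinuousLinearMap.coe_fst', ContinuousLinearMap.coe_snd', smul_eq_mul, mul_one, mul_zero, zero_add, add_zero]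
        rfl
    · push Not at hqd
      have hz : (fun q => β (Phi M' T' e' q)) =ᶠ[𝓝 q] fun _ => 0 := by
        have : ∀ᶠ q' : V2 in 𝓝 q, δ / 2 < q'.1 :=
          continuousAt_fst.eventually (lt_mem_nhds (by linarith))
        filter_upwards [this] with q' hq'
        have hq'0 : 0 < q'.1 := by linarith
        rw [hrel q' hq'0]
        apply hβ.sp _ (pow_pos hq'0 N)
        calc ρ1 ≤ (δ / 2) ^ N / 2 := min_le_left _ _
          _ ≤ (δ / 2) ^ N := half_le_self (by positivity)
          _ ≤ q'.1 ^ N := by gcongr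
      have hDK : 0 ≤ (N + (A + p * (1 + A)) + (1 + A) + 1) * K := by positivity
      refine ⟨(differentiableAt_const _).congr_of_eventuallyEq hz, ?_, ?_, ?_⟩
      · rw [hz.self_of_nhds]; simpa using hDK
      · rw [hz.fderiv_eq]; simpa using hDK
      · rw [hz.fderiv_eq]; simpa using hDK
  · intro q hq hq2
    rw [hrel q hq]
    apply hβ.sp _ (pow_pos hq N)
    calc ρ1 ≤ ρ' ^ N := min_le_right _ _
      _ ≤ q.1 ^ N := by gcongr

open scoped Manifold ContDiff in
lemma pou {s : Set ℝ} (hs : IsCompact s) {r : ℝ → ℝ} (hr : ∀ w, 0 < r w) :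
    ∃ (t : Finset ℝ) (χ : ℝ → ℝ → ℝ), (∀ w ∈ t, w ∈ s) ∧ (∀ w ∈ t, ContDiff ℝ 1 (χ w)) ∧
      (∀ w ∈ t, ∀ x, r w ≤ |x - w| → χ w x = 0) ∧ (∀ x ∈ s, ∑ w ∈ t, χ w x = 1) ∧
      (∀ x, 0 ≤ ∑ w ∈ t, χ w x) ∧ (∀ x, ∑ w ∈ t, χ w x ≤ 1) := by
  classical
  obtain ⟨t, hts, hcov⟩ := hs.elim_nhds_subcover (fun w => Metric.ball w (r w))
    fun w _ => Metric.ball_mem_nhds w (hr w)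
  obtain ⟨f, hf⟩ := SmoothPartitionOfUnity.exists_isSubordinate 𝓘(ℝ, ℝ) hs.isClosed
    (fun w : t => Metric.ball w.1 (r w.1)) (fun _ => Metric.isOpen_ball) (by
      intro x hx
      obtain ⟨w, hw, hxw⟩ := Set.mem_iUnion₂.1 (hcov hx)
      exact Set.mem_iUnion.2 ⟨⟨w, hw⟩, hxw⟩)
  have hsum : ∀ x, ∑ w ∈ t, (if h : w ∈ t then f ⟨w, h⟩ x else 0) = ∑ᶠ i, f i x := by
    intro x
    rw [finsum_eq_sum_of_fintype, ← Finset.sum_coe_sort t]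
    apply Finset.sum_congr rfl
    intro i _
    rw [dif_pos i.2]
  refine ⟨t, fun w x => if h : w ∈ t then f ⟨w, h⟩ x else 0, hts, ?_, ?_, ?_, ?_, ?_⟩
  · intro w hw
    simp only [hw, dif_pos]
    exact ((f ⟨w, hw⟩).contMDiff.contDiff).of_le (by norm_cast)
  · intro w hw x hx
    simp only [hw, dif_pos]
    by_contra hne
    have h1 : x ∈ tsupport (f ⟨w, hw⟩) := subset_tsupport _ hne
    have h2 := hf ⟨w, hw⟩ h1
    rw [Metric.mem_ball, dist_eq] at h2
    linarith
  · intro x hx; rw [hsum]; exact f.sum_eq_one hx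
  · intro x; rw [hsum]; exact finsum_nonneg fun i => f.nonneg i x
  · intro x; rw [hsum]; exact f.sum_le_one x

lemma Bdd.add {g β β' : V2 → ℝ} (h : Bdd g β) (h' : Bdd g β')
    (hi : IntegrableOn (fun p => β p * g p) HP) (hi' : IntegrableOn (fun p => β' p * g p) HP) :
    Bdd g (fun p => β p + β' p) := by
  obtain ⟨C, hC⟩ := h
  obtain ⟨C', hC'⟩ := h'
  refine ⟨C + C', fun t u => ?_⟩
  have e : oscInt (fun p => (β p + β' p) * g p) HP t u =
      oscInt (fun p => β p * g p) HP t u + oscInt (fun p => β' p * g p) HP t u := by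
    unfold oscInt
    rw [← integral_add (int_osc hi t u) (int_osc hi' t u)]
    congr 1; funext p; push_cast; ring
  rw [e, add_mul]
  exact (norm_add_le _ _).trans (add_le_add (hC t u) (hC' t u))

lemma Bdd.congr {g β β' : V2 → ℝ} (h : Bdd g β) (e : ∀ p ∈ HP, β' p = β p) : Bdd g β' := by
  obtain ⟨C, hC⟩ := h
  refine ⟨C, fun t u => ?_⟩
  have : oscInt (fun p => β' p * g p) HP t u = oscInt (fun p => β p * g p) HP t u := by
    unfold oscInt
    apply setIntegral_congr_fun measurableSet_HP
    intro p hp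
    simp only [e p hp]
  rw [this]; exact hC t u

lemma Bdd.sum {κ : Type} (s : Finset κ) {g : V2 → ℝ} {β : κ → V2 → ℝ} (h : ∀ i ∈ s, Bdd g (β i))
    (hi : ∀ i ∈ s, IntegrableOn (fun p => β i p * g p) HP) :
    Bdd g (fun p => ∑ i ∈ s, β i p) := by
  classical
  induction s using Finset.induction_on with
  | empty => exact ⟨0, fun t u => by simp [oscInt]⟩
  | insert a s ha ih =>
    simp_rw [Finset.sum_insert ha]
    refine (h a (Finset.mem_insert_self _ _)).add (ih (fun i hi' => h i (Finset.mem_insert_of_mem hi'))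
      (fun i hi' => hi i (Finset.mem_insert_of_mem hi'))) (hi a (Finset.mem_insert_self _ _)) ?_
    simp_rw [Finset.sum_mul]
    exact integrable_finsetSum s fun i hi' => hi i (Finset.mem_insert_of_mem hi')

def Good (g : V2 → ℝ) (M T : ℕ) (e : ℝ → ℝ) : Prop :=
  ∃ ρ > 0, ∀ β K, Symb M T e ρ β K → (∀ q : V2, 0 < q.1 → ρ ≤ |q.2| → β (Phi M T e q) = 0) → Bdd g β

lemma Phi_shift (M T p : ℕ) (e : ℝ → ℝ) (w : ℝ) (q : V2) :
    Phi M (T + p) (fun ξ => e ξ + w * ξ ^ (T + p)) q = Phi M (T + p) e (q.1, w + q.2) := by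
  unfold Phi; ext <;> simp; left; ring

lemma Phi_scale (M T p : ℕ) (e : ℝ → ℝ) (q : V2) :
    Phi M (T + p) e q = Phi M T e (q.1, q.1 ^ p * q.2) := by
  unfold Phi; ext <;> simp; left; ring

lemma Cover {g : V2 → ℝ} (hg : IntegrableOn g HP) {M T p : ℕ} (hM : 0 < M) {e : ℝ → ℝ}
    (he : Measurable e) {Θ : ℝ}
    (hG : ∀ w, |w| ≤ Θ → Good g M (T + p) (fun ξ => e ξ + w * ξ ^ (T + p))) :
    ∃ ρ > 0, ∃ χ : ℝ → ℝ, ContDiff ℝ 1 χ ∧ (∃ R, ∀ x, R ≤ |x| → χ x = 0) ∧ (∀ x, |x| ≤ Θ → χ x = 1) ∧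
      (∀ x, 0 ≤ χ x ∧ χ x ≤ 1) ∧
      ∀ β K, Symb M T e ρ β K → Bdd g (fun p' => β p' * χ (Wy M (T + p) e p')) := by
  have hG' : ∀ w : ℝ, ∃ ρ > 0, |w| ≤ Θ → ∀ β K, Symb M (T + p) (fun ξ => e ξ + w * ξ ^ (T + p)) ρ β K →
      (∀ q : V2, 0 < q.1 → ρ ≤ |q.2| → β (Phi M (T + p) (fun ξ => e ξ + w * ξ ^ (T + p)) q) = 0) → Bdd g β := by
    intro w
    by_cases hw : |w| ≤ Θ
    · obtain ⟨ρ, h1, h2⟩ := hG w hw; exact ⟨ρ, h1, fun _ => h2⟩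
    · exact ⟨1, one_pos, fun h => absurd h hw⟩
  choose r hr hGr using hG'
  obtain ⟨t, χ, ht, hχ, hsup, hone, hnn, hle⟩ := pou (isCompact_Icc (a := -Θ) (b := Θ)) hr
  have hchg : ∀ w : ℝ, ∃ D > 0, ∀ ρ' > 0, ∃ ρ1 > 0, ∀ {M T : ℕ} {e : ℝ → ℝ} {M' T' : ℕ} {e' : ℝ → ℝ},
      (∀ q : V2, 0 < q.1 → Phi M' T' e' q = Phi M T e (q.1 ^ 1, q.1 ^ p * w + q.1 ^ p * q.2)) →
      ∀ {β : V2 → ℝ} {K : ℝ}, Symb M T e ρ1 β K → Symb M' T' e' ρ' β (D * K) := fun w =>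
    Symb.chg one_pos (a := fun ξ => ξ ^ p * w) ((analyticAt_id.pow p).mul analyticAt_const)
  choose D hD hDρ using hchg
  choose ρ1 hρ1 hS using fun w => hDρ w (r w) (hr w)
  have hmin : ∃ ρ > 0, ∀ w ∈ t, ρ ≤ ρ1 w := by
    rcases t.eq_empty_or_nonempty with h | h
    · exact ⟨1, one_pos, by simp [h]⟩
    · obtain ⟨w, hw, hw'⟩ := t.exists_min_image ρ1 h
      exact ⟨ρ1 w, hρ1 w, hw'⟩
  obtain ⟨ρ, hρ, hρt⟩ := hmin
  have hR : ∀ w ∈ t, ∀ x, |w| + r w ≤ |x| → χ w x = 0 := by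
    intro w hw x hx
    apply hsup w hw
    have := abs_sub_abs_le_abs_sub x w
    linarith
  refine ⟨ρ, hρ, fun x => ∑ w ∈ t, χ w x, ContDiff.sum hχ, ?_, ?_, fun x => ⟨hnn x, hle x⟩, ?_⟩
  · refine ⟨∑ w ∈ t, (|w| + r w), fun x hx => Finset.sum_eq_zero fun w hw => hR w hw x (le_trans ?_ hx)⟩
    exact Finset.single_le_sum (f := fun w => |w| + r w) (fun w _ => add_nonneg (abs_nonneg w) (hr w).le) hw
  · intro x hx; exact hone x (abs_le.1 hx)
  · intro β K hβ
    have key : ∀ w ∈ t, Bdd g (fun p' => β p' * χ w (Wy M (T + p) e p')) ∧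
        IntegrableOn (fun p' => (β p' * χ w (Wy M (T + p) e p')) * g p') HP := by
      intro w hw
      obtain ⟨C, hC, hCS⟩ := SB_snd (hχ w hw) (hR w hw) w
      have s1 : Symb M (T + p) (fun ξ => e ξ + w * ξ ^ (T + p)) (r w) β (D w * K) := by
        refine hS w ?_ (hβ.mono (hρt w hw))
        intro q hq
        rw [Phi_shift, Phi_scale, pow_one, mul_add]
      have eW : ∀ q : V2, 0 < q.1 →
          Wy M (T + p) e (Phi M (T + p) (fun ξ => e ξ + w * ξ ^ (T + p)) q) = w + q.2 := by
        intro q hq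
        rw [Phi_shift]
        exact Wy_Phi hM (T + p) e (q := (q.1, w + q.2)) hq
      have s2 := s1.sb.mul hCS
      have s3 : Symb M (T + p) (fun ξ => e ξ + w * ξ ^ (T + p)) (r w)
          (fun p' => β p' * χ w (Wy M (T + p) e p')) (2 * (D w * K * C)) := by
        refine ⟨?_, ?_, ?_⟩
        · exact hβ.ms.mul (((hχ w hw).continuous.measurable.comp (measurable_Wy M (T + p) he)).aestronglyMeasurable)
        · intro q hq
          have hev : (fun q => β (Phi M (T + p) (fun ξ => e ξ + w * ξ ^ (T + p)) q) *
              χ w (Wy M (T + p) e (Phi M (T + p) (fun ξ => e ξ + w * ξ ^ (T + p)) q))) =ᶠ[𝓝 q]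
              fun q => β (Phi M (T + p) (fun ξ => e ξ + w * ξ ^ (T + p)) q) * χ w (w + q.2) := by
            filter_upwards [continuousAt_fst.eventually (lt_mem_nhds hq)] with q' hq'
            rw [eW q' hq']
          obtain ⟨a1, a2, a3, a4⟩ := s2 q hq
          refine ⟨a1.congr_of_eventuallyEq hev, ?_, ?_, ?_⟩
          · rw [hev.self_of_nhds]; exact a2
          · rw [hev.fderiv_eq]; exact a3
          · rw [hev.fderiv_eq]; exact a4
        · intro q hq hq2
          rw [s1.sp q hq hq2, zero_mul]
      refine ⟨hGr w (abs_le.2 (ht w hw)) _ _ s3 ?_, int_bg hg s3.ms (s3.bd hM)⟩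
      intro q hq hq2
      rw [eW q hq, hsup w hw _ (by simpa using hq2), mul_zero]
    have := Bdd.sum t (fun w hw => (key w hw).1) (fun w hw => (key w hw).2)
    refine this.congr fun p' _ => ?_
    rw [Finset.mul_sum]

lemma meas_germ {q : ℝ → ℝ} (hq : AnalyticAt ℝ q 0) : ∃ q' : ℝ → ℝ, Measurable q' ∧ q' =ᶠ[𝓝 0] q := by
  obtain ⟨r, hr, h⟩ := Metric.eventually_nhds_iff.1 hq.eventually_analyticAt
  refine ⟨(Metric.ball 0 r).indicator q, ?_, ?_⟩
  · have hc : ContinuousOn q (Metric.ball 0 r) := fun x hx => (h hx).continuousAt.continuousWithinAt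
    classical
    rw [← Set.piecewise_eq_indicator]
    exact hc.measurable_piecewise continuousOn_const measurableSet_ball
  · filter_upwards [Metric.ball_mem_nhds (0:ℝ) hr] with x hx
    exact Set.indicator_of_mem hx _

lemma EB_hom {ψ : ℝ → ℝ} (hψ : Differentiable ℝ ψ) {C : ℝ} (h1 : ∀ x, |ψ x| ≤ C)
    (h2 : ∀ x, |x * deriv ψ x| ≤ C) (p : ℕ) {q : V2} (hq : 0 < q.1) :
    EBat (fun q => ψ (q.2 / q.1 ^ p)) ((p + 1) * C) q := by
  have hC : 0 ≤ C := (abs_nonneg _).trans (h1 0)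
  have hpow : q.1 ^ p ≠ 0 := (pow_pos hq p).ne'
  have hd1 : HasFDerivAt (fun q : V2 => (q.1 ^ p)⁻¹)
      ((-((q.1 ^ p) ^ 2)⁻¹) • ((p * q.1 ^ (p - 1)) • ContinuousLinearMap.fst ℝ ℝ ℝ)) q :=
    (hasDerivAt_inv hpow).comp_hasFDerivAt q ((hasDerivAt_pow p q.1).comp_hasFDerivAt q hasFDerivAt_fst)
  have hd2 : HasFDerivAt (fun q : V2 => q.2 * (q.1 ^ p)⁻¹) _ q := hasFDerivAt_snd.mul hd1
  have hd := (hψ (q.2 * (q.1 ^ p)⁻¹)).hasDerivAt.comp_hasFDerivAt q hd2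
  have hfd : fderiv ℝ (fun q : V2 => ψ (q.2 / q.1 ^ p)) q = _ := hd.fderiv
  refine ⟨hd.differentiableAt, (h1 _).trans ?_, ?_, ?_⟩
  · nlinarith [(Nat.cast_nonneg p : (0:ℝ) ≤ p)]
  · rw [hfd]
    simp only [_root_.smul_apply, add_apply, ContinuousLinearMap.coe_fst', ContinuousLinearMap.coe_snd',
      smul_eq_mul, mul_one, mul_zero, add_zero]
    have e : q.1 * (deriv ψ (q.2 * (q.1 ^ p)⁻¹) * (q.2 * (-((q.1 ^ p) ^ 2)⁻¹ * (p * q.1 ^ (p - 1))))) =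
        -(p * ((q.2 * (q.1 ^ p)⁻¹) * deriv ψ (q.2 * (q.1 ^ p)⁻¹))) := by
      rcases Nat.eq_zero_or_pos p with h | h
      · subst h; simp
      · have : q.1 ^ p = q.1 * q.1 ^ (p - 1) := by rw [← pow_succ']; congr 1; omega
        have h3 : q.1 * q.1 ^ (p - 1) ≠ 0 := by rwa [← this]
        rw [this]
        have h4 := hq.ne'
        have h5 : q.1 ^ (p - 1) ≠ 0 := (pow_pos hq _).ne'
        field_simp
    rw [e, abs_neg, abs_mul, Nat.abs_cast]
    have := h2 (q.2 * (q.1 ^ p)⁻¹)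
    nlinarith [(Nat.cast_nonneg p : (0:ℝ) ≤ p)]
  · rw [hfd]
    simp only [_root_.smul_apply, add_apply, ContinuousLinearMap.coe_fst', ContinuousLinearMap.coe_snd',
      smul_eq_mul, mul_one, mul_zero, zero_add]
    have e : q.2 * (deriv ψ (q.2 * (q.1 ^ p)⁻¹) * (q.1 ^ p)⁻¹) =
        (q.2 * (q.1 ^ p)⁻¹) * deriv ψ (q.2 * (q.1 ^ p)⁻¹) := by ring
    rw [e]
    refine (h2 _).trans ?_
    nlinarith [(Nat.cast_nonneg p : (0:ℝ) ≤ p)]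

lemma stage_shift {g : V2 → ℝ} {M T N : ℕ} (hN : 0 < N) {e q' : ℝ → ℝ} (hq : AnalyticAt ℝ q' 0)
    (hq0 : q' 0 = 0) (h : Good g (M * N) (T * N) (fun ξ => e (ξ ^ N) + ξ ^ (T * N) * q' (ξ ^ N))) :
    Good g M T e := by
  obtain ⟨ρ', hρ', hG⟩ := h
  have han : AnalyticAt ℝ (fun ξ : ℝ => q' (ξ ^ N)) 0 :=
    AnalyticAt.fun_comp (g := q') (f := fun ξ : ℝ => ξ ^ N) (by simpa [hN.ne'] using hq) (analyticAt_id.pow N)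
  obtain ⟨D, hD, hS⟩ := Symb.chg (p := 0) hN han
  obtain ⟨ρ1, hρ1, hS⟩ := hS ρ' hρ'
  have hc : ∀ᶠ x in 𝓝 (0:ℝ), |q' x| < ρ' / 2 := by
    have := hq.continuousAt.abs
    exact this.eventually (gt_mem_nhds (by beta_reduce; rw [hq0, abs_zero]; linarith))
  obtain ⟨ε, hε, hc⟩ := Metric.eventually_nhds_iff.1 hc
  have hPhi : ∀ q : V2, 0 < q.1 →
      Phi (M * N) (T * N) (fun ξ => e (ξ ^ N) + ξ ^ (T * N) * q' (ξ ^ N)) q =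
      Phi M T e (q.1 ^ N, q' (q.1 ^ N) + q.1 ^ 0 * q.2) := by
    intro q _
    unfold Phi
    simp only [← pow_mul, mul_comm N]
    ext
    · rfl
    · simp only; ring
  refine ⟨min ρ1 (min ε (ρ' / 2)), by positivity, fun β K hb hb2 => ?_⟩
  refine hG β (D * K) (hS hPhi (hb.mono (min_le_left _ _))) ?_
  intro q hq1 hq2
  rw [hPhi q hq1]
  by_cases h1 : min ρ1 (min ε (ρ' / 2)) ≤ q.1 ^ N
  · exact hb.sp _ (pow_pos hq1 N) h1
  · push Not at h1
    apply hb2 _ (pow_pos hq1 N)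
    have h2 : |q' (q.1 ^ N)| < ρ' / 2 := by
      apply hc
      rw [dist_eq, sub_zero, abs_of_pos (pow_pos hq1 N)]
      exact h1.trans_le ((min_le_right _ _).trans (min_le_left _ _))
    have h3 : min ρ1 (min ε (ρ' / 2)) ≤ ρ' / 2 := (min_le_right _ _).trans (min_le_right _ _)
    simp only [pow_zero, one_mul]
    have h4 : |q.2| ≤ |q' (q.1 ^ N) + q.2| + |q' (q.1 ^ N)| := by
      have := abs_sub (q' (q.1 ^ N) + q.2) (q' (q.1 ^ N))
      rwa [add_sub_cancel_left] at this
    linarith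

section
variable {ι : Type} [Fintype ι] {fh : ι → V2 → ℝ} {γ : ι → ℝ} {E : Set V2} {g : V2 → ℝ}

lemma outer (ctx : Ctx fh γ E g) {M T p : ℕ} (hM : 0 < M) {e : ℝ → ℝ} (he : Measurable e)
    (hea : AnalyticAt ℝ e 0) {θ : ℝ} (hθ : 0 ≤ θ)
    (hLD : ∀ i, ∃ C, ∀ᶠ q : V2 in 𝓝 0, 0 < q.1 → θ * q.1 ^ p ≤ |q.2| → q.2 ≠ 0 →
      LDat (fun q => fh i (Phi M T e q)) C q) :
    ∃ ρ0 > 0, ∀ ρ, 0 < ρ → ρ ≤ ρ0 → ∀ β K, LSymb M T p e (θ * 2 ^ (p + T + 3)) ρ β K → Bdd g β := by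
  choose C hC using hLD
  obtain ⟨ε, hε, h⟩ := Metric.eventually_nhds_iff.1 (eventually_all.2 hC)
  refine leaf ctx hM he hea hθ (C := ∑ i, |C i|) hε ?_
  intro q h1 h2 h3 h4 h5 i
  refine (h ?_ i h1 h3 h5).mono ((le_abs_self _).trans
    (Finset.single_le_sum (f := fun i => |C i|) (fun j _ => abs_nonneg _) (Finset.mem_univ i)))
  rw [Prod.dist_eq]
  simp [abs_of_pos h1, h2, h4]

lemma stage_leaf (ctx : Ctx fh γ E g) {M T : ℕ} (hM : 0 < M) {e : ℝ → ℝ} (he : Measurable e)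
    (hea : AnalyticAt ℝ e 0)
    (hLD : ∀ i, ∃ C, ∀ᶠ q : V2 in 𝓝 0, 0 < q.1 → (0:ℝ) * q.1 ^ 0 ≤ |q.2| → q.2 ≠ 0 →
      LDat (fun q => fh i (Phi M T e q)) C q) : Good g M T e := by
  obtain ⟨ρ0, h0, h⟩ := outer ctx hM he hea le_rfl hLD
  refine ⟨ρ0, h0, fun β K hb hb2 => h ρ0 h0 le_rfl β K ⟨hb.ms, hb.bd hM, ?_, ?_⟩⟩
  · intro q h1 _ _
    exact hb.sb.eb h1
  · intro q h1 _ h3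
    refine ⟨?_, by simp, ?_⟩
    · by_contra hh; exact h3 (hb.sp q h1 (not_lt.1 hh))
    · by_contra hh; exact h3 (hb2 q h1 (not_lt.1 hh))

lemma stage_comb (ctx : Ctx fh γ E g) {M T p : ℕ} (hM : 0 < M) {e : ℝ → ℝ} (he : Measurable e)
    (hea : AnalyticAt ℝ e 0) {θ : ℝ} (hθ : 0 ≤ θ)
    (hLD : ∀ i, ∃ C, ∀ᶠ q : V2 in 𝓝 0, 0 < q.1 → θ * q.1 ^ p ≤ |q.2| → q.2 ≠ 0 →
      LDat (fun q => fh i (Phi M T e q)) C q)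
    (hG : ∀ w, Good g M (T + p) (fun ξ => e ξ + w * ξ ^ (T + p))) : Good g M T e := by
  obtain ⟨ρ0, h0, hout⟩ := outer ctx hM he hea hθ hLD
  obtain ⟨ρ1, h1, χ, hχ, ⟨R, hR⟩, hχ1, hχb, hin⟩ := Cover ctx.g0 hM he (Θ := θ * 2 ^ (p + T + 3)) (fun w _ => hG w)
  obtain ⟨C, hC, hCb⟩ := cs_deriv hχ hR 0
  refine ⟨min ρ0 ρ1, by positivity, fun β K hb hb2 => ?_⟩
  have hK := hb.sb.nonneg
  have b1 := hin β K (hb.mono (min_le_right _ _))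
  have hW : Measurable fun p' => χ (Wy M (T + p) e p') := hχ.continuous.measurable.comp (measurable_Wy _ _ he)
  have hWP : ∀ q : V2, 0 < q.1 → Wy M (T + p) e (Phi M T e q) = q.2 / q.1 ^ p := by
    intro q hq
    have : Phi M T e q = Phi M (T + p) e (q.1, q.2 / q.1 ^ p) := by
      rw [Phi_scale]; simp only
      rw [mul_div_cancel₀ _ (pow_pos hq p).ne']
    rw [this]; exact Wy_Phi hM _ _ (q := (q.1, q.2 / q.1 ^ p)) hq
  have ms1 : AEStronglyMeasurable (fun p' => β p' * χ (Wy M (T + p) e p')) (volume.restrict HP) :=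
    hb.ms.mul hW.aestronglyMeasurable
  have ms2 : AEStronglyMeasurable (fun p' => β p' * (1 - χ (Wy M (T + p) e p'))) (volume.restrict HP) :=
    hb.ms.mul (measurable_const.sub hW).aestronglyMeasurable
  have bd1 : ∀ p' ∈ HP, |β p' * χ (Wy M (T + p) e p')| ≤ K := by
    intro p' hp'
    rw [abs_mul, abs_of_nonneg (hχb _).1]
    exact (mul_le_of_le_one_right (abs_nonneg _) (hχb _).2).trans (hb.bd hM p' hp')
  have bd2 : ∀ p' ∈ HP, |β p' * (1 - χ (Wy M (T + p) e p'))| ≤ K := by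
    intro p' hp'
    have c1 : 0 ≤ 1 - χ (Wy M (T + p) e p') := by linarith [(hχb (Wy M (T + p) e p')).2]
    have c2 : 1 - χ (Wy M (T + p) e p') ≤ 1 := by linarith [(hχb (Wy M (T + p) e p')).1]
    rw [abs_mul, abs_of_nonneg c1]
    exact (mul_le_of_le_one_right (abs_nonneg _) c2).trans (hb.bd hM p' hp')
  have b2 : Bdd g (fun p' => β p' * (1 - χ (Wy M (T + p) e p'))) := by
    refine hout (min ρ0 ρ1) (by positivity) (min_le_left _ _) _ (2 * (K * ((p + 1) * (C + 1)))) ⟨ms2, ?_, ?_, ?_⟩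
    · intro q hq
      refine (bd2 q hq).trans ?_
      have h1 : (1:ℝ) ≤ (p + 1) * (C + 1) := by
        have : (0:ℝ) ≤ p := Nat.cast_nonneg p
        nlinarith
      nlinarith
    · intro q hq _ _
      have hψd : Differentiable ℝ (fun x => 1 - χ x) := (differentiable_const _).sub (hχ.differentiable one_ne_zero)
      have e2 := EB_hom hψd (C := C + 1) (fun x => by
        rw [abs_of_nonneg (by linarith [(hχb x).2])]; linarith [(hχb x).1]) (fun x => by
          have := (hCb x).2
          rw [sub_zero] at this
          rw [deriv_const_sub, mul_neg, abs_neg, abs_mul]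
          nlinarith [abs_nonneg x, abs_nonneg (deriv χ x)]) p hq
      have e1 := (hb.sb.eb hq).mul e2
      have hev : (fun q => β (Phi M T e q) * (1 - χ (q.2 / q.1 ^ p))) =ᶠ[𝓝 q]
          fun q => β (Phi M T e q) * (1 - χ (Wy M (T + p) e (Phi M T e q))) := by
        filter_upwards [continuous_fst.continuousAt.eventually (lt_mem_nhds hq)] with q' hq'
        rw [hWP q' hq']
      unfold EBat at e1 ⊢
      rw [← hev.fderiv_eq]
      refine ⟨e1.1.congr_of_eventuallyEq hev.symm, ?_, e1.2.2⟩
      have := hev.self_of_nhds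
      rw [← this]; exact e1.2.1
    · intro q hq _ hne
      have n1 : β (Phi M T e q) ≠ 0 := left_ne_zero_of_mul hne
      have n2 := right_ne_zero_of_mul hne
      refine ⟨?_, ?_, ?_⟩
      · by_contra hh; exact n1 (hb.sp q hq (not_lt.1 hh))
      · rw [hWP q hq] at n2
        by_contra hh
        push Not at hh
        apply n2
        rw [hχ1, sub_self]
        rw [abs_div, abs_of_pos (pow_pos hq p), div_le_iff₀ (pow_pos hq p)]
        exact hh.le
      · by_contra hh; exact n1 (hb2 q hq (not_lt.1 hh))
  refine (b1.add b2 (int_bg ctx.g0 ms1 bd1) (int_bg ctx.g0 ms2 bd2)).congr ?_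
  intro p' _; ring

end

lemma shift_rep {F : V2 → ℝ} {m : ℕ} (hF : AnalyticAt ℝ F 0) (ho : OrdY F m) {q : ℝ → ℝ}
    (hq : AnalyticAt ℝ q 0) (hq0 : q 0 = 0) {N : ℕ} (hN : 0 < N) :
    ∃ u : V2 → ℝ, AnalyticAt ℝ u 0 ∧ u 0 ≠ 0 ∧ ∀ᶠ v : V2 in 𝓝 0,
      F (v.1 ^ N, q (v.1 ^ N) + v.2) = ∑ j ∈ Finset.range m,
        Dy^[j] F (v.1 ^ N, q (v.1 ^ N)) / j.factorial * v.2 ^ j + v.2 ^ m * u v := by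
  have h1 : AnalyticAt ℝ (fun x : ℝ => x ^ N) 0 := analyticAt_id.pow N
  have h10 : (fun x : ℝ => x ^ N) 0 = 0 := by simp [hN.ne']
  have h2 : AnalyticAt ℝ (fun ξ : ℝ => q (ξ ^ N)) 0 :=
    AnalyticAt.fun_comp (g := q) (f := fun ξ : ℝ => ξ ^ N) (by simpa [hN.ne'] using hq) h1
  have h20 : (fun ξ : ℝ => q (ξ ^ N)) 0 = 0 := by simp [hN.ne', hq0]
  have hsh := fun j => Dy_comp_shift (F := F) hF h1 h2 h10 h20 j
  have hF' : AnalyticAt ℝ (fun v : V2 => F (v.1 ^ N, q (v.1 ^ N) + v.2)) 0 := by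
    have e1 : AnalyticAt ℝ (fun v : V2 => v.1 ^ N) 0 := analyticAt_fst.pow N
    have e2 : AnalyticAt ℝ (fun v : V2 => q (v.1 ^ N) + v.2) 0 :=
      (AnalyticAt.fun_comp (g := fun ξ : ℝ => q (ξ ^ N)) (f := fun v : V2 => v.1) h2 analyticAt_fst).add analyticAt_snd
    have h00 : ((((0:V2).1) ^ N, q ((0:V2).1 ^ N) + (0:V2).2) : V2) = 0 := by ext <;> simp [hN.ne', hq0]
    exact AnalyticAt.fun_comp (g := F) (f := fun v : V2 => (v.1 ^ N, q (v.1 ^ N) + v.2)) (by rw [h00]; exact hF) (e1.prod e2)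
  obtain ⟨u, hu, hu0, hrep⟩ := taylor2 m hF'
  refine ⟨u, hu, ?_, ?_⟩
  · rw [hu0]
    have := (hsh m).self_of_nhds
    rw [this]
    have h00 : ((((0:V2).1) ^ N, q ((0:V2).1 ^ N) + (0:V2).2) : V2) = 0 := by ext <;> simp [hN.ne', hq0]
    beta_reduce
    rw [h00]
    exact div_ne_zero ho.2 (by positivity)
  · have ht : Tendsto (fun v : V2 => ((v.1, 0) : V2)) (𝓝 0) (𝓝 0) := by
      have : Continuous fun v : V2 => ((v.1, 0) : V2) := by fun_prop
      exact this.tendsto 0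
    have hall : ∀ᶠ v : V2 in 𝓝 0, ∀ j : Fin m, Dy^[j] (fun q_1 : V2 => F (q_1.1 ^ N, q (q_1.1 ^ N) + q_1.2)) (v.1, 0) =
        Dy^[j] F (v.1 ^ N, q (v.1 ^ N) + 0) := eventually_all.2 fun j => ht.eventually (hsh j)
    filter_upwards [hrep, hall] with v hv hv2
    rw [hv]
    congr 1
    apply Finset.sum_congr rfl
    intro j hj
    rw [hv2 ⟨j, Finset.mem_range.1 hj⟩, add_zero]

open Polynomial in
lemma stage_inner {H : V2 → ℝ} {M T a m p : ℕ} (hp : 0 < p) {e : ℝ → ℝ} {b : ℕ → ℝ → ℝ} {u : V2 → ℝ}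
    (hb : ∀ j < m, AnalyticAt ℝ (b j) 0) (hu : AnalyticAt ℝ u 0) (hu0 : u 0 ≠ 0)
    (hrep : ∀ᶠ q : V2 in 𝓝 0, 0 < q.1 → H (Phi M T e q) = q.1 ^ a *
      (∑ j ∈ Finset.range m, q.1 ^ (p * (m - j)) * b j q.1 * q.2 ^ j + q.2 ^ m * u q)) (w : ℝ) :
    ∃ (k : ℕ) (F : V2 → ℝ), k ≤ m ∧ AnalyticAt ℝ F 0 ∧ OrdY F k ∧
      (∀ᶠ q : V2 in 𝓝 0, 0 < q.1 → H (Phi M (T + p) (fun ξ => e ξ + w * ξ ^ (T + p)) q) =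
        q.1 ^ (a + p * m) * F q) ∧
      (k = m → ∀ j < m, b j 0 = u 0 * ((-w) ^ (m - j) * m.choose j)) := by
  set P : ℝ[X] := ∑ j ∈ Finset.range m, C (b j 0) * X ^ j + C (u 0) * X ^ m with hP
  have hco : ∀ j < m, P.coeff j = b j 0 := by
    intro j hj
    rw [hP]
    simp only [coeff_add, finsetSum_coeff, coeff_C_mul, coeff_X_pow]
    rw [Finset.sum_eq_single j]
    · simp [hj.ne]
    · intro k _ hk; simp [hk.symm]
    · intro h; exact absurd (Finset.mem_range.2 hj) h
  have hcm : P.coeff m = u 0 := by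
    rw [hP]
    simp only [coeff_add, finsetSum_coeff, coeff_C_mul, coeff_X_pow]
    rw [Finset.sum_eq_zero]
    · simp
    · intro k hk; have := Finset.mem_range.1 hk; simp [this.ne']
  have hdeg : P.natDegree = m := by
    apply natDegree_eq_of_le_of_coeff_ne_zero
    · rw [hP]
      refine natDegree_add_le_of_degree_le ?_ (natDegree_C_mul_X_pow_le _ _)
      apply natDegree_sum_le_of_forall_le
      intro j hj
      exact (natDegree_C_mul_X_pow_le _ _).trans (Finset.mem_range.1 hj).le
    · rw [hcm]; exact hu0
  have hP0 : P ≠ 0 := by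
    intro h; rw [h] at hcm; exact hu0 (by simpa using hcm.symm)
  obtain ⟨k, R, hk, hR, hPR, hkm⟩ := poly_mult hdeg hP0 w
  set F : V2 → ℝ := fun q => ∑ j ∈ Finset.range m, b j q.1 * (w + q.2) ^ j +
    (w + q.2) ^ m * u (q.1, q.1 ^ p * (w + q.2)) with hFdef
  have h00 : ((((0:V2).1), (0:V2).1 ^ p * (w + (0:V2).2)) : V2) = 0 := by ext <;> simp [hp.ne']
  have hFa : AnalyticAt ℝ F 0 := by
    have hw : AnalyticAt ℝ (fun q : V2 => w + q.2) 0 := analyticAt_const.add analyticAt_snd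
    refine AnalyticAt.add ?_ ((hw.pow m).mul ?_)
    · apply Finset.analyticAt_fun_sum
      intro j hj
      exact (AnalyticAt.fun_comp (g := b j) (f := fun v : V2 => v.1) (hb j (Finset.mem_range.1 hj)) analyticAt_fst).mul (hw.pow j)
    · exact AnalyticAt.fun_comp (g := u) (f := fun q : V2 => (q.1, q.1 ^ p * (w + q.2))) (by rw [h00]; exact hu)
        (analyticAt_fst.prod ((analyticAt_fst.pow p).mul hw))
  refine ⟨k, F, hk, hFa, ?_, ?_, ?_⟩
  · refine OrdY_of hFa (v := fun y => R.eval (w + y)) (by fun_prop) (by simpa using hR) (Eventually.of_forall fun y => ?_)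
    have e1 : F (0, y) = P.eval (w + y) := by
      have hz : (((0:ℝ), (0:ℝ)) : V2) = 0 := rfl
      rw [hFdef, hP]
      simp only [eval_add, eval_finsetSum, eval_mul, eval_C, eval_pow, eval_X, zero_pow hp.ne', zero_mul, hz]
      ring
    rw [e1, hPR]; simp
  · have ht : Tendsto (fun q : V2 => ((q.1, q.1 ^ p * (w + q.2)) : V2)) (𝓝 0) (𝓝 0) := by
      have : Continuous fun q : V2 => ((q.1, q.1 ^ p * (w + q.2)) : V2) := by fun_prop
      have := this.tendsto 0
      rwa [h00] at this
    filter_upwards [ht.eventually hrep] with q hq hq1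
    rw [Phi_shift, Phi_scale]
    simp only at hq ⊢
    rw [hq hq1, pow_add, mul_assoc]
    congr 1
    rw [hFdef]
    simp only [mul_add, Finset.mul_sum]
    congr 1
    · apply Finset.sum_congr rfl
      intro j hj
      have hj := Finset.mem_range.1 hj
      have : p * m = p * (m - j) + p * j := by rw [← mul_add]; congr 1; omega
      rw [this, pow_add, ← mul_add, mul_pow, ← pow_mul]
      ring
    · rw [← mul_add, mul_pow, ← pow_mul]
      ring
  · intro hkm' j hj
    obtain ⟨c, hc⟩ := hkm hkm'
    rw [sub_eq_add_neg, ← C_neg] at hc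
    have h1 : c = u 0 := by
      rw [← hcm, hc, coeff_C_mul, coeff_X_add_C_pow]; simp
    rw [← hco j hj, hc, coeff_C_mul, coeff_X_add_C_pow, h1]

set_option maxHeartbeats 1000000 in
theorem Stage {ι : Type} [Fintype ι] {fh : ι → V2 → ℝ} {γ : ι → ℝ} {E : Set V2} {g : V2 → ℝ}
    (ctx : Ctx fh γ E g) (m : ℕ) : ∀ {M T : ℕ}, 0 < M → ∀ {e : ℝ → ℝ}, Measurable e → AnalyticAt ℝ e 0 →
    ∀ {a : ι → ℕ} {F : ι → V2 → ℝ} {mi : ι → ℕ}, (∀ i, AnalyticAt ℝ (F i) 0) →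
    (∀ i, ∀ᶠ q : V2 in 𝓝 0, 0 < q.1 → fh i (Phi M T e q) = q.1 ^ (a i) * F i q) →
    (∀ i, OrdY (F i) (mi i)) → ∑ i, mi i = m → Good g M T e := by
  classical
  induction m using Nat.strong_induction_on with
  | _ m ih =>
  intro M T hM e he hea a F mi hF hrep hO hsum
  have hq : ∃ q : ℝ → ℝ, Measurable q ∧ AnalyticAt ℝ q 0 ∧ q 0 = 0 ∧ (m = 0 ∨ ∃ i0, 0 < mi i0 ∧
      ∀ᶠ x in 𝓝 (0:ℝ), Dy^[mi i0 - 1] (F i0) (x, q x) = 0) := by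
    rcases Nat.eq_zero_or_pos m with h0 | h0
    · exact ⟨fun _ => 0, measurable_const, analyticAt_const, rfl, Or.inl h0⟩
    · obtain ⟨i0, -, hi0⟩ : ∃ i ∈ Finset.univ, mi i ≠ 0 := by
        by_contra hh; push Not at hh
        exact h0.ne' (hsum ▸ Finset.sum_eq_zero hh)
      have hpos := Nat.pos_of_ne_zero hi0
      have h2 : Dy (Dy^[mi i0 - 1] (F i0)) 0 ≠ 0 := by
        have e := Function.iterate_succ_apply' Dy (mi i0 - 1) (F i0)
        rw [Nat.succ_eq_add_one, Nat.sub_add_cancel hpos] at e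
        rw [← e]; exact (hO i0).2
      obtain ⟨q, hq, hq0, hqz, -⟩ := implicit_an (DyI_an (hF i0) (mi i0 - 1)) ((hO i0).1 _ (by omega)) h2
      obtain ⟨q', hq'm, hq'⟩ := meas_germ hq
      refine ⟨q', hq'm, hq.congr hq'.symm, by rw [hq'.self_of_nhds, hq0], Or.inr ⟨i0, hpos, ?_⟩⟩
      filter_upwards [hqz, hq'] with x h1 h2
      rw [h2, h1]
  obtain ⟨q, hqm, hqa, hq0, hqz⟩ := hq
  set N := m.factorial with hNdef
  have hN : 0 < N := Nat.factorial_pos m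
  apply stage_shift hN hqa hq0
  set e' : ℝ → ℝ := fun ξ => e (ξ ^ N) + ξ ^ (T * N) * q (ξ ^ N) with he'
  have hM' : 0 < M * N := Nat.mul_pos hM hN
  have hpowm : Measurable fun ξ : ℝ => ξ ^ N := measurable_id.pow_const N
  have he'm : Measurable e' := (he.comp hpowm).add ((measurable_id.pow_const _).mul (hqm.comp hpowm))
  have hpa : AnalyticAt ℝ (fun ξ : ℝ => ξ ^ N) 0 := analyticAt_id.pow N
  have he'a : AnalyticAt ℝ e' 0 :=
    (AnalyticAt.fun_comp (g := e) (f := fun ξ : ℝ => ξ ^ N) (by simpa [hN.ne'] using hea) hpa).add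
      ((analyticAt_id.pow _).mul
        (AnalyticAt.fun_comp (g := q) (f := fun ξ : ℝ => ξ ^ N) (by simpa [hN.ne'] using hqa) hpa))
  choose u hua hu0 hurep using fun i => shift_rep (hF i) (hO i) hqa hq0 hN
  have htN : Tendsto (fun x : ℝ => x ^ N) (𝓝 0) (𝓝 0) := by
    have := (continuous_pow (M := ℝ) N).tendsto 0
    rwa [zero_pow hN.ne'] at this
  have htf : Tendsto (fun v : V2 => v.1) (𝓝 0) (𝓝 0) := continuous_fst.tendsto (0:V2)
  have hrep1 : ∀ i, ∀ᶠ v : V2 in 𝓝 0, 0 < v.1 → fh i (Phi (M * N) (T * N) e' v) = v.1 ^ (N * a i) *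
      (∑ j ∈ Finset.range (mi i),
        Dy^[j] (F i) (v.1 ^ N, q (v.1 ^ N)) / j.factorial * v.2 ^ j + v.2 ^ (mi i) * u i v) := by
    intro i
    have ht : Tendsto (fun v : V2 => ((v.1 ^ N, q (v.1 ^ N) + v.2) : V2)) (𝓝 0) (𝓝 0) := by
      have h1 : Tendsto (fun v : V2 => v.1 ^ N) (𝓝 0) (𝓝 0) := htN.comp htf
      have h2 : Tendsto q (𝓝 0) (𝓝 0) := by have := hqa.continuousAt.tendsto; rwa [hq0] at this
      have h3 : Tendsto (fun v : V2 => q (v.1 ^ N) + v.2) (𝓝 0) (𝓝 (0 + 0)) :=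
        (h2.comp h1).add (continuous_snd.tendsto (0:V2))
      rw [add_zero] at h3
      exact h1.prodMk_nhds h3
    filter_upwards [ht.eventually (hrep i), hurep i] with v hv1 hv2 hv
    have hPhi : Phi (M * N) (T * N) e' v = Phi M T e (v.1 ^ N, q (v.1 ^ N) + v.2) := by
      unfold Phi
      simp only [he', ← pow_mul, mul_comm N]
      ext
      · rfl
      · simp only; ring
    rw [hPhi, hv1 (pow_pos hv N), ← hv2, ← pow_mul]
  by_cases hz : ∀ k : (Σ i, Fin (mi i)), ∀ᶠ x in 𝓝 (0:ℝ), Dy^[k.2] (F k.1) (x, q x) / (k.2 : ℕ).factorial = 0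
  · -- leaf
    apply stage_leaf ctx hM' he'm he'a
    intro i
    obtain ⟨C, hC⟩ := LD_u (hua i) (hu0 i)
    refine LD_H (a := N * a i) (m := mi i) (V := u i) (C := C) ?_ (hC.mono fun q h _ _ _ => h)
    have hall : ∀ᶠ v : V2 in 𝓝 0, ∀ j : Fin (mi i), Dy^[j] (F i) (v.1 ^ N, q (v.1 ^ N)) / (j : ℕ).factorial = 0 :=
      eventually_all.2 fun j => (htN.comp htf).eventually (hz ⟨i, j⟩)
    filter_upwards [hrep1 i, hall] with v h1 h2 hv _
    rw [h1 hv, Finset.sum_eq_zero, zero_add]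
    intro j hj
    rw [h2 ⟨j, Finset.mem_range.1 hj⟩, zero_mul]
  · push Not at hz
    have hmi : ∀ i, mi i ≤ m := fun i => hsum ▸ Finset.single_le_sum (f := mi) (fun _ _ => Nat.zero_le _) (Finset.mem_univ i)
    obtain ⟨p, B, hp, hBa, hBrep, hBne, hBz⟩ := NP (κ := Σ i, Fin (mi i))
      (A := fun k x => Dy^[k.2] (F k.1) (x, q x) / (k.2 : ℕ).factorial)
      (fun k => (an_comp2 (DyI_an (hF k.1) k.2) analyticAt_id hqa rfl hq0).div_const)
      (fun k => by
        have : (((0:ℝ), (0:ℝ)) : V2) = 0 := rfl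
        simp only [hq0, this]
        rw [(hO k.1).1 _ k.2.2, zero_div])
      (d := fun k => mi k.1 - k.2) (fun k => Nat.sub_pos_of_lt k.2.2) hN
      (fun k => Nat.dvd_factorial (Nat.sub_pos_of_lt k.2.2) ((Nat.sub_le _ _).trans (hmi _))) (by simpa using hz)
    set b : ι → ℕ → ℝ → ℝ := fun i j => if h : j < mi i then B ⟨i, ⟨j, h⟩⟩ else 0 with hb
    have hbB : ∀ i j (h : j < mi i), b i j = B ⟨i, ⟨j, h⟩⟩ := fun i j h => by simp [hb, h]
    have hba : ∀ i, ∀ j < mi i, AnalyticAt ℝ (b i j) 0 := fun i j h => by rw [hbB i j h]; exact hBa _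
    have hrep2 : ∀ i, ∀ᶠ v : V2 in 𝓝 0, 0 < v.1 → fh i (Phi (M * N) (T * N) e' v) = v.1 ^ (N * a i) *
      (∑ j ∈ Finset.range (mi i), v.1 ^ (p * (mi i - j)) * b i j v.1 * v.2 ^ j + v.2 ^ (mi i) * u i v) := by
      intro i
      have hall := eventually_all.2 fun j : Fin (mi i) => htf.eventually (hBrep ⟨i, j⟩)
      filter_upwards [hrep1 i, hall] with v h1 h2 hv
      rw [h1 hv]
      congr 2
      apply Finset.sum_congr rfl
      intro j hj
      have hj := Finset.mem_range.1 hj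
      rw [h2 ⟨j, hj⟩, hbB i j hj]
    choose θ hθ C hC using fun i => LD_V (hua i) (hu0 i) (hba i) p
    have hLD : ∀ i, ∃ C, ∀ᶠ q : V2 in 𝓝 0, 0 < q.1 → (∑ i, θ i) * q.1 ^ p ≤ |q.2| → q.2 ≠ 0 →
      LDat (fun q => fh i (Phi (M * N) (T * N) e' q)) C q := by
      intro i
      refine LD_H (a := N * a i) (m := mi i) (C := C i) ?_ ((hC i).mono fun q h h1 h2 h3 => h h1 (le_trans ?_ h2) h3)
      · filter_upwards [hrep2 i] with v hv hv1 hv2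
        rw [hv hv1]
        congr 1
        rw [mul_add, add_comm, Finset.mul_sum]
        congr 1
        apply Finset.sum_congr rfl
        intro j hj
        have hj := Finset.mem_range.1 hj
        have e1 : v.2 ^ mi i = v.2 ^ (mi i - j) * v.2 ^ j := by rw [← pow_add]; congr 1; omega
        rw [e1, mul_pow, ← pow_mul, inv_pow]
        field_simp
      · gcongr
        exact Finset.single_le_sum (f := θ) (fun i _ => (hθ i).le) (Finset.mem_univ i)
    refine stage_comb ctx hM' he'm he'a (Finset.sum_nonneg fun i _ => (hθ i).le) hLD ?_
    intro w
    choose k F2 hk hF2 hO2 hrep3 hkm using fun i => stage_inner hp (hba i) (hua i) (hu0 i) (hrep2 i) w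
    refine ih (∑ i, k i) ?_ hM' (he'm.add (measurable_const.mul (measurable_id.pow_const _)))
      (he'a.add (analyticAt_const.mul (analyticAt_id.pow _))) hF2 hrep3 hO2 rfl
    rw [← hsum]
    by_contra hnot
    push Not at hnot
    have hkeq : ∀ i, k i = mi i := by
      intro i
      by_contra hi
      exact absurd (Finset.sum_lt_sum (fun i _ => hk i) ⟨i, Finset.mem_univ i, lt_of_le_of_ne (hk i) hi⟩) (not_lt.2 hnot)
    obtain ⟨κ0, hκ0⟩ := hBne
    have hm0 : m ≠ 0 := by
      have := (Nat.zero_le _).trans_lt (κ0.2.2.trans_le (hmi κ0.1)); omega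
    obtain ⟨i0, hi0, hi0z⟩ := hqz.resolve_left hm0
    have hw : w = 0 := by
      have h1 := hkm i0 (hkeq i0) (mi i0 - 1) (by omega)
      rw [hbB i0 _ (by omega : mi i0 - 1 < mi i0), hBz ⟨i0, ⟨mi i0 - 1, by omega⟩⟩ (by
        filter_upwards [hi0z] with x hx
        rw [hx, zero_div])] at h1
      have e1 : mi i0 - (mi i0 - 1) = 1 := by omega
      rw [e1, pow_one] at h1
      have h2 := mul_eq_zero.1 h1.symm
      have h3 := h2.resolve_left (hu0 i0)
      have h4 : ((mi i0).choose (mi i0 - 1) : ℝ) ≠ 0 := by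
        have := Nat.choose_pos (Nat.sub_le (mi i0) 1)
        positivity
      have h5 := (mul_eq_zero.1 h3).resolve_right h4
      linarith
    apply hκ0
    have h1 := hkm κ0.1 (hkeq κ0.1) κ0.2 κ0.2.2
    rw [hbB κ0.1 κ0.2 κ0.2.2, hw, neg_zero, zero_pow (Nat.sub_ne_zero_of_lt κ0.2.2), zero_mul, mul_zero] at h1
    exact h1

theorem Root {ι : Type} [Fintype ι] {fh : ι → V2 → ℝ} {γ : ι → ℝ} {E : Set V2} {g : V2 → ℝ}
    (ctx : Ctx fh γ E g) {M : ℕ} (hM : 0 < M) {G : ι → ℝ → V2 → ℝ} (hG : ∀ i w, AnalyticAt ℝ (G i w) 0)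
    (hne : ∀ i w, ¬ ∀ᶠ q in 𝓝 0, G i w q = 0)
    (hrep : ∀ i w, ∀ᶠ q : V2 in 𝓝 0, 0 < q.1 → fh i (q.1 ^ M, q.1 ^ M * (w + q.2)) = G i w q) :
    ∃ ρ > 0, ∀ β K, Symb M 0 (fun _ => 0) ρ β K →
      (∀ q : V2, 0 < q.1 → 2 ≤ |q.2| → β (q.1 ^ M, q.1 ^ M * q.2) = 0) → Bdd g β := by
  have hgood : ∀ w, Good g M (0 + 0) (fun ξ => (fun _ => (0:ℝ)) ξ + w * ξ ^ (0 + 0)) := by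
    intro w
    choose a F m hF hO hr using fun i => root (hG i w) (hne i w)
    refine Stage ctx (∑ i, m i) hM (by fun_prop) (by fun_prop) hF ?_ hO rfl (a := a)
    intro i
    filter_upwards [hr i, hrep i w] with q h1 h2 hq
    rw [← h1, ← h2 hq]
    simp [Phi]
  obtain ⟨ρ, hρ, χ, hχ, -, hχ1, -, h⟩ := Cover ctx.g0 hM (measurable_const) (Θ := 2) (fun w _ => hgood w)
  refine ⟨ρ, hρ, fun β K hb hb2 => (h β K hb).congr ?_⟩
  intro p' hp'
  have h1 : 0 < p'.1 ^ ((M:ℝ)⁻¹) := Real.rpow_pos_of_pos hp' _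
  by_cases hw : |Wy M (0 + 0) (fun _ => 0) p'| ≤ 2
  · rw [hχ1 _ hw, mul_one]
  · have h2 := hb2 (p'.1 ^ ((M:ℝ)⁻¹), Wy M 0 (fun _ => 0) p') h1 (not_le.1 hw).le
    have h3 := Phi_Wy hM 0 (fun _ => 0) (p := p') hp'
    unfold Phi at h3
    simp only [pow_zero, zero_add, one_mul] at h3 h2
    rw [h3] at h2
    rw [h2, zero_mul]

lemma half_le_log {L : ℝ} (hL : 2 ≤ L) : 1 / 2 ≤ Real.log L :=
  (by have := Real.log_two_gt_d9; linarith : (1:ℝ) / 2 ≤ Real.log 2).trans (Real.log_le_log (by norm_num) hL)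

lemma rpow_neg_half {L : ℝ} (hL : 0 ≤ L) : L ^ (-(1/2:ℝ)) = (√L)⁻¹ := by
  rw [Real.rpow_neg hL, Real.sqrt_eq_rpow]

lemma dyad {X : Type} [MeasurableSpace X] (μ : Measure X) {s : X → ℝ} (hs : Measurable s)
    (h0 : ∀ᵐ x ∂μ, 0 ≤ s x ∧ s x < 1) {B D : ℝ} (hB : 0 ≤ B) (hD : 0 ≤ D)
    (hF : ∀ ρ, 0 < ρ → ρ ≤ 2 → μ {x | s x < ρ} ≤ ENNReal.ofReal (B * (√ρ * (D + |Real.log ρ|)))) :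
    ∃ C, ∀ L ≥ (2:ℝ), ∫⁻ x, ENNReal.ofReal (1 / (1 + √(L * s x))) ∂μ ≤
      ENNReal.ofReal (C * (L ^ (-(1/2:ℝ)) * Real.log L ^ 2)) := by
  refine ⟨16 * (B * (D + 1)), fun L hL => ?_⟩
  have hL0 : 0 < L := by linarith
  have hlog := half_le_log hL
  obtain ⟨n, hn1, hn2⟩ := exists_nat_pow_near (by linarith : 1 ≤ L) (by norm_num : (1:ℝ) < 2)
  have hsL : 0 < √L := sqrt_pos.2 hL0
  have hms : ∀ k : ℕ, MeasurableSet {x | s x < 2 ^ (k + 1) / L} := fun k => measurableSet_lt hs measurable_const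
  have hpt : ∀ᵐ x ∂μ, ENNReal.ofReal (1 / (1 + √(L * s x))) ≤ ∑ k ∈ Finset.range (n + 1),
      ENNReal.ofReal ((√(2 ^ k))⁻¹) * ({x | s x < 2 ^ (k + 1) / L}.indicator 1 x) := by
    filter_upwards [h0] with x hx
    have key : ∃ k ≤ n, s x < 2 ^ (k + 1) / L ∧ 1 / (1 + √(L * s x)) ≤ (√(2 ^ k))⁻¹ := by
      by_cases h1 : L * s x < 1
      · refine ⟨0, Nat.zero_le _, ?_, ?_⟩
        · rw [lt_div_iff₀ hL0, zero_add, pow_one]; linarith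
        · simp only [pow_zero, Real.sqrt_one, inv_one]
          rw [div_le_one (by positivity)]; linarith [sqrt_nonneg (L * s x)]
      · push Not at h1
        obtain ⟨k, hk1, hk2⟩ := exists_nat_pow_near h1 (by norm_num : (1:ℝ) < 2)
        refine ⟨k, ?_, ?_, ?_⟩
        · have : (2:ℝ) ^ k < 2 ^ (n + 1) := by nlinarith
          have := (pow_lt_pow_iff_right₀ (by norm_num : (1:ℝ) < 2)).1 this
          omega
        · rw [lt_div_iff₀ hL0]; linarith
        · rw [one_div]
          apply inv_anti₀ (sqrt_pos.2 (by positivity))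
          linarith [sqrt_le_sqrt hk1]
    obtain ⟨k, hk, hk1, hk2⟩ := key
    refine (ENNReal.ofReal_le_ofReal hk2).trans ?_
    refine le_trans ?_ (Finset.single_le_sum (f := fun k => ENNReal.ofReal ((√(2 ^ k))⁻¹) * ({x | s x < 2 ^ (k + 1) / L}.indicator 1 x))
      (fun _ _ => zero_le) (Finset.mem_range.2 (Nat.lt_succ_of_le hk)))
    rw [Set.indicator_of_mem (by exact hk1)]; simp
  refine (lintegral_mono_ae hpt).trans ?_
  rw [lintegral_finsetSum _ (fun k _ => (measurable_one.indicator (hms k)).const_mul _)]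
  have hterm : ∀ k ∈ Finset.range (n + 1), ∫⁻ x, ENNReal.ofReal ((√(2 ^ k))⁻¹) * ({x | s x < 2 ^ (k + 1) / L}.indicator 1 x) ∂μ
      ≤ ENNReal.ofReal (4 * (B * (D + 1)) * ((√L)⁻¹ * Real.log L)) := by
    intro k hk
    have hk := Nat.lt_succ_iff.1 (Finset.mem_range.1 hk)
    rw [lintegral_const_mul _ (measurable_one.indicator (hms k)), lintegral_indicator_one (hms k)]
    have h2k : (2:ℝ) ^ k ≤ L := (pow_le_pow_right₀ (by norm_num) hk).trans hn1
    have hρ2 : (2:ℝ) ^ (k + 1) / L ≤ 2 := by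
      rw [div_le_iff₀ hL0, pow_succ]; linarith
    have hρ0 : 0 < (2:ℝ) ^ (k + 1) / L := by positivity
    have hlρ : |Real.log (2 ^ (k + 1) / L)| ≤ 2 * Real.log L := by
      have hl2 : Real.log 2 ≤ Real.log L := Real.log_le_log (by norm_num) hL
      rw [abs_le]
      constructor
      · have : Real.log (1 / L) ≤ Real.log (2 ^ (k + 1) / L) := by
          apply Real.log_le_log (by positivity)
          gcongr; exact one_le_pow₀ (by norm_num)
        rw [one_div, Real.log_inv] at this; linarith
      · linarith [Real.log_le_log hρ0 hρ2]
    have hsq : (√(2 ^ k))⁻¹ * √(2 ^ (k + 1) / L) ≤ 2 * (√L)⁻¹ := by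
      rw [sqrt_div (by positivity), pow_succ, Real.sqrt_mul (by positivity)]
      have : √(2:ℝ) ≤ 2 := by rw [Real.sqrt_le_left (by norm_num)]; norm_num
      have h3 : 0 < √((2:ℝ) ^ k) := sqrt_pos.2 (by positivity)
      have : (√(2 ^ k))⁻¹ * (√(2 ^ k) * √2 / √L) = √2 * (√L)⁻¹ := by field_simp
      rw [this]; gcongr
    calc _ ≤ ENNReal.ofReal ((√(2 ^ k))⁻¹) * ENNReal.ofReal (B * (√(2 ^ (k + 1) / L) * (D + |Real.log (2 ^ (k + 1) / L)|))) := by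
          gcongr; exact hF _ hρ0 hρ2
      _ = ENNReal.ofReal ((√(2 ^ k))⁻¹ * (B * (√(2 ^ (k + 1) / L) * (D + |Real.log (2 ^ (k + 1) / L)|)))) := by
          rw [← ENNReal.ofReal_mul (by positivity)]
      _ ≤ _ := by
          apply ENNReal.ofReal_le_ofReal
          calc (√(2 ^ k))⁻¹ * (B * (√(2 ^ (k + 1) / L) * (D + |Real.log (2 ^ (k + 1) / L)|)))
              = B * (((√(2 ^ k))⁻¹ * √(2 ^ (k + 1) / L)) * (D + |Real.log (2 ^ (k + 1) / L)|)) := by ring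
            _ ≤ B * ((2 * (√L)⁻¹) * ((2 * D + 2) * Real.log L)) := by
                gcongr
                nlinarith
            _ = _ := by ring
  refine (Finset.sum_le_sum hterm).trans ?_
  rw [Finset.sum_const, Finset.card_range, ← ENNReal.ofReal_nsmul]
  apply ENNReal.ofReal_le_ofReal
  rw [rpow_neg_half hL0.le, nsmul_eq_mul]
  have hnl : ((n + 1 : ℕ) : ℝ) ≤ 4 * Real.log L := by
    have h1 : n * Real.log 2 ≤ Real.log L := by
      rw [← Real.log_pow]; exact Real.log_le_log (by positivity) hn1
    have h2 : (1:ℝ) / 2 ≤ Real.log 2 := half_le_log le_rfl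
    push_cast
    have : (n:ℝ) * (1 / 2) ≤ n * Real.log 2 := by gcongr
    linarith
  have hpos : 0 ≤ 4 * (B * (D + 1)) * ((√L)⁻¹ * Real.log L) := by positivity
  calc _ ≤ 4 * Real.log L * (4 * (B * (D + 1)) * ((√L)⁻¹ * Real.log L)) := by gcongr
    _ = _ := by ring

def Bx (r : ℝ) : Set V2 := {p | |p.1| < r ∧ |p.2| < r}

lemma measurableSet_Bx (r : ℝ) : MeasurableSet (Bx r) :=
  (measurableSet_lt (measurable_fst.abs) measurable_const).inter (measurableSet_lt (measurable_snd.abs) measurable_const)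

lemma Bx_sub {U : Set V2} (hU : U ∈ 𝓝 (0:V2)) : ∃ r > 0, Bx r ⊆ U := by
  obtain ⟨r, hr, h⟩ := Metric.mem_nhds_iff.1 hU
  refine ⟨r, hr, fun p hp => h ?_⟩
  rw [Metric.mem_ball, dist_zero_right, Prod.norm_def]
  exact max_lt hp.1 hp.2

lemma unit_abs {v : V2} (hv : nrm2 v = 1) : v.1 ^ 2 + v.2 ^ 2 = 1 ∧ |v.1| ≤ 1 ∧ |v.2| ≤ 1 := by
  have h : v.1 ^ 2 + v.2 ^ 2 = 1 := by
    unfold nrm2 at hv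
    rwa [Real.sqrt_eq_one] at hv
  refine ⟨h, ?_, ?_⟩ <;> rw [← sq_le_one_iff_abs_le_one] <;> nlinarith [sq_nonneg v.1, sq_nonneg v.2]

lemma dot_abs {p v : V2} {r : ℝ} (h1 : |p.1| < r) (h2 : |p.2| < r) (hv1 : |v.1| ≤ 1) (hv2 : |v.2| ≤ 1) :
    |dot2 p v| < 2 * r := by
  unfold dot2
  refine (abs_add_le _ _).trans_lt ?_
  rw [abs_mul, abs_mul]
  nlinarith [abs_nonneg p.1, abs_nonneg p.2]

lemma strip_int {g : V2 → ℝ} (hg : ∀ p, 0 ≤ g p) {U : Set V2} (hU : U ∈ 𝓝 (0:V2))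
    (hi : IntegrableOn g U) {v : V2} (hv : nrm2 v = 1) {δ : ℝ} {e : ℕ} (hS : StripBound g v δ e) (hδ : 1 / 2 ≤ δ) :
    ∃ r > 0, ∃ C, ∀ L ≥ (2:ℝ), ∫⁻ p in Bx r, ENNReal.ofReal (g p / (1 + √(L * |dot2 p v|))) ≤
      ENNReal.ofReal (C * (L ^ (-(1/2:ℝ)) * Real.log L ^ 2)) := by
  obtain ⟨hδ0, he, cv, hcv, hS⟩ := hS
  obtain ⟨rU, hrU, hBU⟩ := Bx_sub hU
  obtain ⟨hv2, hva, hvb⟩ := unit_abs hv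
  set c := min (min (cv / 2) (rU / 2)) (1 / 2) with hc
  have hc0 : 0 < c := by positivity
  have hccv : c < cv := by
    have : c ≤ cv / 2 := (min_le_left _ _).trans (min_le_left _ _)
    linarith
  have hcU : c ≤ rU / 2 := (min_le_left _ _).trans (min_le_right _ _)
  have hc1 : c ≤ 1 / 2 := min_le_right _ _
  obtain ⟨a, ha, b, hb, hab⟩ := hS c hc0 hccv
  have hmd : Measurable fun p : V2 => |dot2 p v| := by unfold dot2; fun_prop
  have hmd' : Measurable fun p : V2 => |dot2 p (perp2 v)| := by unfold dot2 perp2; fun_prop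
  have hpa : |(perp2 v).1| ≤ 1 := hvb
  have hpb : |(perp2 v).2| ≤ 1 := by simpa [perp2] using hva
  have hstripU : ∀ r ≤ c, strip2 v r c ⊆ U := by
    intro r hr p hp
    apply hBU
    obtain ⟨h1, h2⟩ := hp
    have h1 := h1.trans_le hr
    have e1 : p.1 = dot2 p v * v.1 + dot2 p (perp2 v) * v.2 := by
      unfold dot2 perp2; linear_combination (-p.1) * hv2
    have e2 : p.2 = dot2 p v * v.2 + dot2 p (perp2 v) * (-v.1) := by
      unfold dot2 perp2; linear_combination (-p.2) * hv2
    constructor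
    · have : |dot2 (dot2 p v, dot2 p (perp2 v)) v| < 2 * c := dot_abs h1 h2 hva hvb
      rw [e1]; unfold dot2 at this ⊢; simp only at this ⊢; linarith
    · have : |dot2 (dot2 p v, dot2 p (perp2 v)) (perp2 v)| < 2 * c := dot_abs h1 h2 hpa hpb
      rw [e2]; unfold dot2 perp2 at this ⊢; simp only at this ⊢; linarith
  have hFs : ∀ r, 0 < r → r < c → ∫⁻ p in strip2 v r c, ENNReal.ofReal (g p) ≤
      ENNReal.ofReal (b * (√r * (1 + |Real.log r|))) := by
    intro r hr hrc
    rw [← ofReal_integral_eq_lintegral_ofReal (hi.mono_set (hstripU r hrc.le)) (Eventually.of_forall hg)]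
    apply ENNReal.ofReal_le_ofReal
    refine ((hab r hr hrc).2).trans ?_
    rw [mul_assoc]
    gcongr
    · rw [Real.sqrt_eq_rpow]
      exact Real.rpow_le_rpow_of_exponent_ge hr (by linarith) hδ
    · interval_cases e <;> simp
  refine ⟨c / 4, by positivity, ?_⟩
  set μ := (volume.restrict (Bx (c / 4))).withDensity (fun p => ENNReal.ofReal (g p)) with hμ
  have hBsub : Bx (c / 4) ⊆ U := fun p hp => hBU ⟨hp.1.trans_le (by linarith), hp.2.trans_le (by linarith)⟩
  have hgm : AEMeasurable (fun p => ENNReal.ofReal (g p)) (volume.restrict (Bx (c / 4))) :=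
    (hi.mono_set hBsub).aestronglyMeasurable.aemeasurable.ennreal_ofReal
  have hF1 : ∀ ρ, 0 < ρ → μ {p | |dot2 p v| < ρ} ≤ ENNReal.ofReal (b * (√(min ρ (c/2)) * (1 + |Real.log (min ρ (c/2))|))) := by
    intro ρ hρ
    have hms : MeasurableSet {p | |dot2 p v| < ρ} := measurableSet_lt hmd measurable_const
    rw [hμ, withDensity_apply _ hms, Measure.restrict_restrict hms]
    refine le_trans (lintegral_mono_set ?_) (hFs (min ρ (c/2)) (by positivity) ((min_le_right _ _).trans_lt (by linarith)))
    rintro p ⟨h1, h2⟩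
    have h3 := dot_abs h2.1 h2.2 hva hvb
    have h4 := dot_abs h2.1 h2.2 hpa hpb
    exact ⟨lt_min h1 (by linarith), by linarith⟩
  obtain ⟨C, hC⟩ := dyad μ hmd (by
      rw [hμ]
      apply (withDensity_absolutelyContinuous _ _).ae_le
      refine (ae_restrict_iff' (measurableSet_Bx _)).2 <| Eventually.of_forall fun p hp => ⟨abs_nonneg _, ?_⟩
      have := dot_abs hp.1 hp.2 hva hvb
      linarith) hb.le (D := 1 + |Real.log (c / 2)|) (by positivity) (by
      intro ρ hρ hρ2
      refine (hF1 ρ hρ).trans (ENNReal.ofReal_le_ofReal ?_)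
      rcases le_total ρ (c / 2) with h | h
      · rw [min_eq_left h]; gcongr; linarith [abs_nonneg (Real.log (c / 2))]
      · rw [min_eq_right h]
        have h1 := sqrt_le_sqrt h
        have h2 : 1 + |Real.log (c / 2)| ≤ 1 + |Real.log (c / 2)| + |Real.log ρ| := le_add_of_nonneg_right (abs_nonneg _)
        exact mul_le_mul_of_nonneg_left (mul_le_mul h1 h2 (by positivity) (by positivity)) hb.le)
  refine ⟨C, fun L hL => le_trans (le_of_eq ?_) (hC L hL)⟩
  have hmm : Measurable fun p : V2 => ENNReal.ofReal (1 / (1 + √(L * |dot2 p v|))) := by fun_prop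
  rw [hμ, lintegral_withDensity_eq_lintegral_mul₀ hgm hmm.aemeasurable]
  apply lintegral_congr
  intro p
  rw [Pi.mul_apply, ← ENNReal.ofReal_mul (hg p), mul_one_div]

lemma root_small {N : ℕ} (hN : 0 < N) {ε x : ℝ} (hε : 0 < ε) (h0 : 0 ≤ x) (hx : x < ε ^ N) :
    0 ≤ x ^ ((N:ℝ)⁻¹) ∧ x ^ ((N:ℝ)⁻¹) < ε ∧ (x ^ ((N:ℝ)⁻¹)) ^ N = x := by
  refine ⟨by positivity, ?_, Real.rpow_inv_natCast_pow h0 hN.ne'⟩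
  rw [← Real.pow_rpow_inv_natCast hε.le hN.ne']
  exact Real.rpow_lt_rpow h0 hx (by positivity)

lemma bdryB {h : ℝ → ℝ} (hh : AnalyticAt ℝ h 0) (h0 : h 0 = 0) {N : ℕ} (hN : 0 < N) {σ s : ℝ}
    (hσ : σ = 1 ∨ σ = -1) (hs : s * s = 1) :
    ∃ Mj > 0, ∃ H : ℝ → ℝ, AnalyticAt ℝ H 0 ∧ ∃ r > 0, ∀ x y : ℝ, 0 < x → x < r → |y| < r → 0 ≤ σ * y →
      s * x = h (|y| ^ ((N:ℝ)⁻¹)) → y = H (x ^ (((Mj:ℕ):ℝ)⁻¹)) := by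
  by_cases hz : ∀ᶠ t in 𝓝 (0:ℝ), h t = 0
  · obtain ⟨ε, hε, hz⟩ := Metric.eventually_nhds_iff.1 hz
    refine ⟨1, one_pos, fun _ => 0, analyticAt_const, ε ^ N, by positivity, fun x y hx _ hy _ he => ?_⟩
    obtain ⟨h1, h2, -⟩ := root_small hN hε (abs_nonneg y) hy
    rw [hz (by rw [Real.dist_0_eq_abs, abs_of_nonneg h1]; exact h2)] at he
    exfalso
    rcases mul_eq_zero.1 he with h | h
    · rw [h] at hs; norm_num at hs
    · linarith
  obtain ⟨k, B, hB, hB0, hfac⟩ := fac1 hh hz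
  have hk : 0 < k := by
    rcases Nat.eq_zero_or_pos k with rfl | h
    · exact absurd (by simpa [h0] using hfac.self_of_nhds) hB0.symm
    · exact h
  set G : ℝ → ℝ := fun t => Real.exp (Real.log (B t ^ 2) / (2 * k)) with hG
  have hGa : AnalyticAt ℝ G 0 := ((hB.pow 2).log (by have := hB0; simp only [Pi.pow_apply]; positivity)).div_const.rexp
  have hGk : ∀ t, B t ≠ 0 → G t ^ (2 * k) = B t ^ 2 := by
    intro t ht
    rw [hG]; beta_reduce
    rw [← Real.exp_nat_mul]; push_cast
    rw [mul_div_cancel₀ _ (by positivity), Real.exp_log (by positivity)]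
  have hA : AnalyticAt ℝ (fun v : V2 => v.2 * G v.2 - v.1) 0 :=
    (analyticAt_snd.mul (AnalyticAt.fun_comp (g := G) (f := Prod.snd) hGa analyticAt_snd)).sub analyticAt_fst
  have hD : Dy (fun v : V2 => v.2 * G v.2 - v.1) 0 ≠ 0 := by
    have e1 : HasFDerivAt (fun v : V2 => v.2) (ContinuousLinearMap.snd ℝ ℝ ℝ) 0 := hasFDerivAt_snd
    have e2 : HasFDerivAt (fun v : V2 => G v.2) (deriv G 0 • ContinuousLinearMap.snd ℝ ℝ ℝ) 0 :=
      HasDerivAt.comp_hasFDerivAt (0:V2) (h₂ := G) hGa.differentiableAt.hasDerivAt e1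
    have e3 := (e1.mul e2).sub (hasFDerivAt_fst (𝕜 := ℝ) (p := (0:V2)))
    unfold Dy
    erw [e3.fderiv]
    simp [hG, (Real.exp_pos _).ne']
  obtain ⟨q, hq, -, -, hiff⟩ := implicit_an hA (by simp) hD
  have hfB := hfac.and (hB.continuousAt.eventually_ne hB0)
  obtain ⟨ε, hε, hev⟩ := Metric.eventually_nhds_iff.1 hiff
  obtain ⟨ε', hε', hev'⟩ := Metric.eventually_nhds_iff.1 hfB
  set η := min ε ε'
  have hη : 0 < η := lt_min hε hε'
  refine ⟨k, hk, fun ξ => σ * q ξ ^ N, (analyticAt_const.mul (hq.pow N)), min (η ^ N) (η ^ k), by positivity, fun x y hx hxr hy hσy he => ?_⟩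
  obtain ⟨a1, a2, a3⟩ := root_small hN hη (abs_nonneg y) (hy.trans_le (min_le_left _ _))
  obtain ⟨b1, b2, b3⟩ := root_small hk hη hx.le (hxr.trans_le (min_le_right _ _))
  set t := |y| ^ ((N:ℝ)⁻¹)
  set ξ := x ^ ((k:ℝ)⁻¹)
  obtain ⟨c1, c2⟩ := hev' (y := t) (by rw [Real.dist_0_eq_abs, abs_of_nonneg a1]; exact a2.trans_le (min_le_right _ _))
  have c3 := hev (y := (ξ, t)) (by
    rw [dist_zero_right, Prod.norm_def]
    simp only [norm_eq_abs, abs_of_nonneg a1, abs_of_nonneg b1]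
    exact max_lt (b2.trans_le (min_le_left _ _)) (a2.trans_le (min_le_left _ _)))
  have hGp : 0 < G t := Real.exp_pos _
  have key : t * G t = ξ := by
    have : (t * G t) ^ (2 * k) = ξ ^ (2 * k) := by
      rw [mul_pow, hGk t c2, mul_comm 2 k, pow_mul, pow_mul, b3, ← mul_pow, ← c1, ← he, mul_pow, sq s, hs, one_mul]
    exact (pow_left_inj₀ (by positivity) b1 (by omega)).1 this
  have := c3.1 (by simp only; rw [key, sub_self])
  simp only at this
  beta_reduce
  rw [this, a3]
  rcases hσ with rfl | rfl
  · rw [abs_of_nonneg (by linarith)]; ring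
  · rw [abs_of_nonpos (by linarith)]; ring

def LL (s : ℝ) (b : Bool) : V2 →L[ℝ] V2 :=
  if b then (ContinuousLinearMap.snd ℝ ℝ ℝ).prod (s • ContinuousLinearMap.fst ℝ ℝ ℝ)
  else (s • ContinuousLinearMap.fst ℝ ℝ ℝ).prod (ContinuousLinearMap.snd ℝ ℝ ℝ)

lemma LL_true (s : ℝ) (p : V2) : LL s true p = (p.2, s * p.1) := rfl
lemma LL_false (s : ℝ) (p : V2) : LL s false p = (s * p.1, p.2) := rfl

lemma abs_sgn {s : ℝ} (hs : s * s = 1) (x : ℝ) : |s * x| = |x| := by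
  rw [abs_mul, show |s| = 1 by rw [← sq_eq_sq₀ (abs_nonneg _) zero_le_one, sq_abs]; linarith, one_mul]

lemma bdry {r₀ : ℝ} (hr₀ : 0 < r₀) {C : Set V2} (hC : IsPuiseuxBdryCurve r₀ C) {s : ℝ} (hs : s * s = 1) (b : Bool) :
    ∃ Mj > 0, ∃ H : ℝ → ℝ, AnalyticAt ℝ H 0 ∧ ∃ r > 0, ∀ p ∈ Sml r, LL s b p ∈ C →
      p.2 = H (p.1 ^ (((Mj:ℕ):ℝ)⁻¹)) := by
  obtain ⟨N, h, I, σ, hN, hσ, -, hI, hh, h0, hC, -⟩ := hC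
  have hh0 : AnalyticAt ℝ h 0 := hh 0 (hI ⟨le_rfl, by positivity⟩)
  have hA : (∀ p, 0 < p.1 → LL s b p ∈ C → p.2 = h (p.1 ^ ((N:ℝ)⁻¹))) →
      ∃ Mj > 0, ∃ H : ℝ → ℝ, AnalyticAt ℝ H 0 ∧ ∃ r > 0, ∀ p ∈ Sml r, LL s b p ∈ C →
      p.2 = H (p.1 ^ (((Mj:ℕ):ℝ)⁻¹)) := fun H => ⟨N, hN, h, hh0, 1, one_pos, fun p hp => H p hp.1⟩
  have hB : (∀ p, 0 < p.1 → LL s b p ∈ C → 0 ≤ σ * p.2 ∧ s * p.1 = h (|p.2| ^ ((N:ℝ)⁻¹))) →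
      ∃ Mj > 0, ∃ H : ℝ → ℝ, AnalyticAt ℝ H 0 ∧ ∃ r > 0, ∀ p ∈ Sml r, LL s b p ∈ C →
      p.2 = H (p.1 ^ (((Mj:ℕ):ℝ)⁻¹)) := by
    intro HB
    obtain ⟨Mj, hMj, H, hH, r, hr, h1⟩ := bdryB hh0 h0 hN hσ hs
    exact ⟨Mj, hMj, H, hH, r, hr, fun p hp hpC => h1 p.1 p.2 hp.1 hp.2.1 hp.2.2 (HB p hp.1 hpC).1 (HB p hp.1 hpC).2⟩
  rcases hC with rfl | rfl <;> cases b
  · apply hA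
    rintro p hp ⟨-, -, h3⟩
    rw [LL_false] at h3; simpa [abs_sgn hs, abs_of_pos hp] using h3
  · apply hB
    rintro p hp ⟨-, h2, h3⟩
    exact ⟨h2, h3⟩
  · apply hB
    rintro p hp ⟨-, h2, h3⟩
    exact ⟨h2, h3⟩
  · apply hA
    rintro p hp ⟨-, -, h3⟩
    rw [LL_true] at h3; simpa [abs_sgn hs, abs_of_pos hp] using h3

lemma LL_inj {s : ℝ} (hs : s * s = 1) (b : Bool) : Function.Injective (LL s b) := by
  have hs0 : s ≠ 0 := by rintro rfl; norm_num at hs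
  intro p q h
  cases b
  · rw [LL_false, LL_false, Prod.mk.injEq] at h
    exact Prod.ext (mul_left_cancel₀ hs0 h.1) h.2
  · rw [LL_true, LL_true, Prod.mk.injEq] at h
    exact Prod.ext (mul_left_cancel₀ hs0 h.2) h.1

lemma LL_emb {s : ℝ} (hs : s * s = 1) (b : Bool) : MeasurableEmbedding (LL s b) :=
  (LL s b).continuous.measurableEmbedding (LL_inj hs b)

lemma LL_mp {s : ℝ} (hs : s * s = 1) (b : Bool) : MeasurePreserving (LL s b) volume volume := by
  have h1 : MeasurePreserving (fun x : ℝ => s * x) volume volume := by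
    rcases mul_self_eq_one_iff.1 hs with rfl | rfl
    · simp only [one_mul]; exact MeasurePreserving.id (volume : Measure ℝ)
    · simpa using Measure.measurePreserving_neg (volume : Measure ℝ)
  have h2 : MeasurePreserving (Prod.map (fun x : ℝ => s * x) (id : ℝ → ℝ)) volume volume :=
    h1.prod (MeasurePreserving.id _)
  cases b
  · exact h2
  · exact Measure.measurePreserving_swap.comp h2

lemma LL_Bx {s : ℝ} (hs : s * s = 1) (b : Bool) {r : ℝ} {p : V2} (hp : |p.1| < r ∧ |p.2| < r) : LL s b p ∈ Bx r := by
  cases b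
  · rw [LL_false]; exact ⟨by simpa [abs_sgn hs] using hp.1, hp.2⟩
  · rw [LL_true]; exact ⟨hp.2, by simpa [abs_sgn hs] using hp.1⟩

lemma LL_dot {s : ℝ} (hs : s * s = 1) (b : Bool) (p q : V2) : dot2 (LL s b p) (LL s b q) = dot2 p q := by
  cases b <;> simp only [LL_false, LL_true, dot2] <;> linear_combination p.1 * q.1 * hs

lemma nrm2_sq (p : V2) : nrm2 p ^ 2 = dot2 p p := by
  unfold nrm2 dot2; rw [sq_sqrt (by positivity)]; ring

lemma LL_nrm {s : ℝ} (hs : s * s = 1) (b : Bool) (p : V2) : nrm2 (LL s b p) = nrm2 p := by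
  refine (sq_eq_sq₀ (sqrt_nonneg _) (sqrt_nonneg _)).1 ?_
  exact (nrm2_sq _).trans ((LL_dot hs b p p).trans (nrm2_sq _).symm)

lemma fin_min {κ : Type} [Finite κ] {R : κ → ℝ} (h : ∀ j, 0 < R j) {R0 : ℝ} (h0 : 0 < R0) : ∃ r > 0, r ≤ R0 ∧ ∀ j, r ≤ R j := by
  have e : ∀ᶠ r in 𝓝[>] (0:ℝ), 0 < r ∧ r ≤ R0 ∧ ∀ j, r ≤ R j := by
    have e1 : ∀ x > (0:ℝ), ∀ᶠ r in 𝓝[>] (0:ℝ), 0 < r ∧ r ≤ x := fun x hx => Ioc_mem_nhdsGT hx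
    filter_upwards [e1 R0 h0, eventually_all.2 fun j => e1 (R j) (h j)] with r h1 h2
    exact ⟨h1.1, h1.2, fun j => (h2 j).2⟩
  obtain ⟨r, h1, h2, h3⟩ := e.exists
  exact ⟨r, h1, h2, h3⟩

lemma isOpen_disk2 (r : ℝ) : IsOpen (disk2 r) :=
  isOpen_lt (by fun_prop) continuous_const

lemma bdry_frame {E : Set V2} (hE : IsStdDomain E) {s : ℝ} (hs : s * s = 1) (b : Bool) :
    ∃ (κ : Type) (_ : Fintype κ) (Mj : κ → ℕ) (H : κ → ℝ → ℝ), (∀ j, 0 < Mj j) ∧ (∀ j, AnalyticAt ℝ (H j) 0) ∧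
      ∃ r > 0, ∀ p ∈ Sml r, LL s b p ∈ frontier E → ∃ j, p.2 = H j (p.1 ^ ((Mj j:ℝ)⁻¹)) := by
  have hsm : ∀ r₀ > 0, ∀ p ∈ Bx (r₀ / 2), p ∈ disk2 r₀ := by
    rintro r₀ hr₀ p ⟨h1, h2⟩
    have h1 := sq_lt_sq' (abs_lt.1 h1).1 (abs_lt.1 h1).2
    have h2 := sq_lt_sq' (abs_lt.1 h2).1 (abs_lt.1 h2).2
    show p.1 ^ 2 + p.2 ^ 2 < r₀ ^ 2
    nlinarith
  have hSB : ∀ r, ∀ p ∈ Sml r, LL s b p ∈ Bx r := fun r p hp =>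
    LL_Bx hs b ⟨by rw [abs_of_pos hp.1]; exact hp.2.1, hp.2.2⟩
  rcases hE with ⟨r₀, hr₀, rfl⟩ | ⟨r₀, hr₀, m, Es, Cs, rfl, -, hEs, hCs, -⟩
  · refine ⟨Empty, inferInstance, Empty.elim, Empty.elim, fun j => j.elim, fun j => j.elim, r₀ / 2, by positivity, fun p hp hf => ?_⟩
    rw [(isOpen_disk2 r₀).frontier_eq] at hf
    exact absurd (hsm r₀ hr₀ _ (hSB _ p hp)) hf.2
  · choose Mj hMj H hH R hR hp using fun j : Fin m × Fin 2 => bdry hr₀ (hCs j.1 j.2) hs b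
    obtain ⟨r, hr, hr1, hr2⟩ := fin_min hR (by positivity : 0 < r₀ / 2)
    refine ⟨Fin m × Fin 2, inferInstance, Mj, H, hMj, hH, r, hr, fun p hpr hf => ?_⟩
    rw [(isOpen_iUnion fun i => (hEs i).1).frontier_eq, closure_iUnion_of_finite] at hf
    obtain ⟨i, hi⟩ := mem_iUnion.1 hf.1
    have hfi : LL s b p ∈ frontier (Es i) := by
      rw [(hEs i).1.frontier_eq]; exact ⟨hi, fun h => hf.2 (mem_iUnion.2 ⟨i, h⟩)⟩
    have hSm : ∀ x, r ≤ x → p ∈ Sml x := fun x hx => ⟨hpr.1, hpr.2.1.trans_le hx, hpr.2.2.trans_le hx⟩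
    rcases (hEs i).2.2.2 hfi with (h | h) | h
    · exact ⟨(i, 0), hp (i, 0) p (hSm _ (hr2 _)) h⟩
    · exact ⟨(i, 1), hp (i, 1) p (hSm _ (hr2 _)) h⟩
    · exact absurd (hsm r₀ hr₀ _ (hSB _ p (hSm _ hr1))) (not_lt_of_ge (le_of_eq h.symm))

lemma nonvan {F : V2 → ℝ} (hF : AnalyticAt ℝ F 0) (hne : ¬ ∀ᶠ p in 𝓝 0, F p = 0) {M : ℕ} (hM : 0 < M) (w : ℝ) :
    ¬ ∀ᶠ q : V2 in 𝓝 0, F (q.1 ^ M, q.1 ^ M * (w + q.2)) = 0 := by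
  intro hz
  apply hne
  obtain ⟨r, hr, hFr⟩ := Metric.eventually_nhds_iff_ball.1 hF.eventually_analyticAt
  have hc : Continuous fun q : V2 => (q.1 ^ M, q.1 ^ M * (w + q.2)) := by fun_prop
  have h00 : (fun q : V2 => (q.1 ^ M, q.1 ^ M * (w + q.2))) 0 = 0 := by
    simp [zero_pow hM.ne']
  have hb : ∀ᶠ q : V2 in 𝓝 0, (q.1 ^ M, q.1 ^ M * (w + q.2)) ∈ ball (0:V2) r :=
    hc.continuousAt.eventually (by rw [h00]; exact ball_mem_nhds _ hr)
  have hl : Tendsto (fun ξ : ℝ => ((ξ, 0) : V2)) (𝓝[>] 0) (𝓝 0) := by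
    have : Continuous fun ξ : ℝ => ((ξ, 0) : V2) := by fun_prop
    exact (this.tendsto 0).mono_left nhdsWithin_le_nhds
  obtain ⟨ξ, ⟨h1, h2⟩, h3⟩ := ((hl.eventually (hz.eventually_nhds.and hb)).and self_mem_nhdsWithin).exists
  have hξ : 0 < ξ := h3
  have hξM : 0 < ξ ^ M := by positivity
  set P : V2 := (ξ ^ M, ξ ^ M * (w + 0)) with hP
  have hΛ : ContinuousAt (fun p : V2 => (p.1 ^ ((M:ℝ)⁻¹), p.2 / p.1 - w)) P := by
    refine ContinuousAt.prodMk ?_ ((continuousAt_snd.div continuousAt_fst hξM.ne').sub continuousAt_const)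
    exact continuousAt_fst.rpow_const (Or.inl hξM.ne')
  have hΛP : (P.1 ^ ((M:ℝ)⁻¹), P.2 / P.1 - w) = (ξ, (0:ℝ)) := by
    rw [hP]; simp only
    rw [Real.pow_rpow_inv_natCast hξ.le hM.ne', mul_div_cancel_left₀ _ hξM.ne']; simp
  have hzP : ∀ᶠ p in 𝓝 P, F p = 0 := by
    have e1 : ∀ᶠ p : V2 in 𝓝 P, 0 < p.1 := continuousAt_fst.eventually (lt_mem_nhds hξM)
    have e2 := hΛ.eventually (hΛP.symm ▸ h1 : ∀ᶠ x : V2 in 𝓝 (P.1 ^ ((M:ℝ)⁻¹), P.2 / P.1 - w), _)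
    filter_upwards [e1, e2] with p hp1 hp2
    rw [Real.rpow_inv_natCast_pow hp1.le hM.ne'] at hp2
    rwa [add_sub_cancel, mul_div_cancel₀ _ hp1.ne'] at hp2
  have hAn : AnalyticOnNhd ℝ F (ball 0 r) := fun x hx => hFr x hx
  have := hAn.eqOn_zero_of_preconnected_of_eventuallyEq_zero (convex_ball _ _).isPreconnected h2 hzP
  filter_upwards [ball_mem_nhds _ hr] with p hp using this hp

lemma nontriv_LL {F : V2 → ℝ} (hne : ¬ ∀ᶠ p in 𝓝 (0:V2), F p = 0) {s : ℝ} (hs : s * s = 1) (b : Bool) :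
    ¬ ∀ᶠ p in 𝓝 (0:V2), F (LL s b p) = 0 := by
  intro h
  apply hne
  have hc : Continuous fun p : V2 => if b then (s * p.2, p.1) else (s * p.1, p.2) := by
    cases b <;> simp only [if_true, Bool.false_eq_true, if_false] <;> fun_prop
  have h0 := hc.tendsto 0
  have h1 : (if b then (s * (0:V2).2, (0:V2).1) else (s * (0:V2).1, (0:V2).2)) = (0:V2) := by cases b <;> simp
  rw [h1] at h0
  filter_upwards [h0.eventually h] with p hp
  cases b
  · simpa [LL_false, ← mul_assoc, hs] using hp
  · simpa [LL_true, ← mul_assoc, hs] using hp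

lemma stdFun_nonneg {n : ℕ} (f : Fin n → V2 → ℝ) (γ : Fin n → ℝ) (E : Set V2) (p : V2) : 0 ≤ stdFun n f γ E p :=
  Set.indicator_nonneg (fun _ _ => Finset.prod_nonneg fun _ _ => by positivity) p

set_option maxHeartbeats 1000000 in
theorem Sector {n : ℕ} {f : Fin n → V2 → ℝ} {γ : Fin n → ℝ} {E : Set V2} (hsf : StandardForm n f γ E)
    {δ : V2 → ℝ} {e : V2 → ℕ}
    (hstrip : ∀ v : V2, nrm2 v = 1 → StripBound (stdFun n f γ E) v (δ v) (e v) ∧ 1/2 ≤ δ v)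
    {s : ℝ} (hs : s * s = 1) (b : Bool) :
    ∃ M : ℕ, 0 < M ∧ ∃ ρ > 0, ∀ β K, Symb M 0 (fun _ => 0) ρ β K →
      (∀ q : V2, 0 < q.1 → 2 ≤ |q.2| → β (q.1 ^ M, q.1 ^ M * q.2) = 0) →
      Bdd (fun p => stdFun n f γ E (LL s b p)) β := by
  obtain ⟨V, hV, hf⟩ := hsf.analytic
  obtain ⟨U, hU, hi⟩ := hsf.integ
  obtain ⟨R, hR, hRU⟩ := Bx_sub hU
  obtain ⟨κ, _, Mj, H, hMj, hH, rf, hrf, hfr⟩ := bdry_frame hsf.domain hs b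
  have hSB : ∀ r, ∀ p ∈ Sml r, LL s b p ∈ Bx r := fun r p hp =>
    LL_Bx hs b ⟨by rw [abs_of_pos hp.1]; exact hp.2.1, hp.2.2⟩
  set g := stdFun n f γ E with hg
  set gt := (Sml R).indicator (fun p => g (LL s b p)) with hgt
  have hgn : ∀ p, 0 ≤ g p := stdFun_nonneg f γ E
  have hgtle : ∀ p, gt p ≤ g (LL s b p) := fun p => Set.indicator_le_self' (fun _ _ => hgn _) p
  have hgtn : ∀ p, 0 ≤ gt p := fun p => Set.indicator_nonneg (fun _ _ => hgn _) p
  set fh : Fin n ⊕ κ → V2 → ℝ := Sum.elim (fun i p => f i (LL s b p)) (fun j p => p.2 - H j (p.1 ^ ((Mj j:ℝ)⁻¹))) with hfh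
  have ctx : Ctx fh (Sum.elim γ (fun _ => 0)) (LL s b ⁻¹' E) gt := by
    refine ⟨?_, hgtn, ⟨min R rf, lt_min hR hrf, fun p hp => ⟨?_, fun h => ?_⟩⟩, fun c1 => ?_⟩
    · have h1 : IntegrableOn (g ∘ LL s b) (LL s b ⁻¹' U) := ((LL_mp hs b).integrableOn_comp_preimage (LL_emb hs b)).2 hi
      have h2 : IntegrableOn (g ∘ LL s b) (Sml R) := h1.mono_set fun p hp => hRU (hSB R p hp)
      exact ((integrable_indicator_iff (measurableSet_Sml R)).2 h2).integrableOn
    · rw [hgt, Set.indicator_of_mem (show p ∈ Sml R from ⟨hp.1, hp.2.1.trans_le (min_le_left _ _), hp.2.2.trans_le (min_le_left _ _)⟩)]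
      rw [hg, stdFun, Set.indicator, Set.indicator]
      simp [hfh]
      rfl
    · obtain ⟨j, hj⟩ := hfr p ⟨hp.1, hp.2.1.trans_le (min_le_right _ _), hp.2.2.trans_le (min_le_right _ _)⟩
        ((LL s b).continuous.frontier_preimage_subset E h)
      exact ⟨Sum.inr j, by simp only [hfh, Sum.elim_inr]; rw [← hj, sub_self]⟩
    · set N := √(1 + c1 ^ 2) with hN
      have hN2 : N ^ 2 = 1 + c1 ^ 2 := sq_sqrt (by positivity)
      have hN1 : 1 ≤ N := Real.one_le_sqrt.2 (by nlinarith [sq_nonneg c1])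
      set v0 : V2 := (-c1 / N, 1 / N) with hv0
      have hv : nrm2 (LL s b v0) = 1 := by
        rw [LL_nrm hs]; unfold nrm2; rw [Real.sqrt_eq_one, hv0]
        simp only; field_simp; rw [hN2]; ring
      obtain ⟨r, hr, C, hC⟩ := strip_int hgn hU hi hv (hstrip _ hv).1 (hstrip _ hv).2
      refine ⟨r, hr, C, fun L hL => le_trans ?_ (hC L hL)⟩
      rw [← (LL_mp hs b).setLIntegral_comp_preimage_emb (LL_emb hs b) _ (Bx r)]
      refine le_trans (lintegral_mono fun p => ?_) (lintegral_mono_set (hSB r))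
      apply ENNReal.ofReal_le_ofReal
      rw [LL_dot hs]
      have hd : |dot2 p v0| ≤ |p.2 - c1 * p.1| := by
        have : dot2 p v0 = (p.2 - c1 * p.1) / N := by unfold dot2; rw [hv0]; simp only; ring
        rw [this, abs_div, abs_of_pos (by linarith : 0 < N)]
        exact div_le_self (abs_nonneg _) hN1
      have h3 : √(L * |dot2 p v0|) ≤ √(L * |p.2 - c1 * p.1|) :=
        sqrt_le_sqrt (mul_le_mul_of_nonneg_left hd (by linarith))
      exact div_le_div₀ (hgn _) (hgtle p) (by positivity) (by linarith)
  set M := ∏ j, Mj j with hM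
  have hM0 : 0 < M := Finset.prod_pos fun j _ => hMj j
  choose k hk using fun j => Finset.dvd_prod_of_mem Mj (Finset.mem_univ j)
  have hL0 : LL s b (0:V2) = 0 := map_zero _
  have hfa : ∀ i, AnalyticAt ℝ (fun p => f i (LL s b p)) 0 := fun i =>
    AnalyticAt.fun_comp (g := f i) (f := LL s b) (by rw [hL0]; exact hf i 0 (mem_of_mem_nhds hV)) ((LL s b).analyticAt 0)
  set G : Fin n ⊕ κ → ℝ → V2 → ℝ := Sum.elim (fun i w q => f i (LL s b (q.1 ^ M, q.1 ^ M * (w + q.2))))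
    (fun j w q => q.1 ^ M * (w + q.2) - H j (q.1 ^ k j)) with hG
  have hk0 : ∀ j, 0 < k j := fun j => Nat.pos_of_mul_pos_left (by rw [← hk j]; exact hM0)
  have a1 : AnalyticAt ℝ (fun q : V2 => q.1 ^ M) 0 := analyticAt_fst.pow M
  have a2 : ∀ w, AnalyticAt ℝ (fun q : V2 => q.1 ^ M * (w + q.2)) 0 := fun w => a1.mul (analyticAt_const.add analyticAt_snd)
  obtain ⟨ρ, hρ, hroot⟩ := Root ctx hM0 (G := G) (by
      rintro (i | j) w
      · refine AnalyticAt.fun_comp (g := fun p => f i (LL s b p)) (f := fun q : V2 => (q.1 ^ M, q.1 ^ M * (w + q.2))) ?_ (a1.prod (a2 w))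
        simp only [Prod.fst_zero, zero_pow hM0.ne', zero_mul]; exact hfa i
      · refine (a2 w).sub (AnalyticAt.fun_comp (g := H j) (f := fun q : V2 => q.1 ^ k j) ?_ (analyticAt_fst.pow _))
        simpa [zero_pow (hk0 j).ne'] using hH j) (by
      rintro (i | j) w
      · exact nonvan (hfa i) (nontriv_LL (hsf.nontriv i) hs b) hM0 w
      · intro hz
        have t1 : Tendsto (fun x : ℝ => ((x, 0) : V2)) (𝓝[>] 0) (𝓝 0) :=
          ((by fun_prop : Continuous fun x : ℝ => ((x, 0) : V2)).tendsto 0).mono_left nhdsWithin_le_nhds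
        have t2 : Tendsto (fun x : ℝ => ((x, x) : V2)) (𝓝[>] 0) (𝓝 0) :=
          ((by fun_prop : Continuous fun x : ℝ => ((x, x) : V2)).tendsto 0).mono_left nhdsWithin_le_nhds
        obtain ⟨x, ⟨h1, h2⟩, h3⟩ := (((t1.eventually hz).and (t2.eventually hz)).and self_mem_nhdsWithin).exists
        have h3 : 0 < x := h3
        simp only [hG, Sum.elim_inr] at h1 h2
        have : x ^ M * x = 0 := by linear_combination h2 - h1
        have : 0 < x ^ M * x := by positivity
        linarith) (by
      rintro (i | j) w
      · exact Eventually.of_forall fun q _ => rfl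
      · refine Eventually.of_forall fun q hq => ?_
        simp only [hfh, hG, Sum.elim_inr]
        congr 2
        rw [hM, hk j, mul_comm, pow_mul, Real.pow_rpow_inv_natCast (by positivity) (hMj j).ne'])
  refine ⟨M, hM0, min ρ (min 1 (R / 2)), by positivity, fun β K hβ hsp => ?_⟩
  have hB := hroot β K ⟨hβ.ms, hβ.sb, fun q hq h => hβ.sp q hq ((min_le_left _ _).trans h)⟩ hsp
  obtain ⟨C, hC⟩ := hB
  refine ⟨C, fun t u => le_of_eq_of_le ?_ (hC t u)⟩
  congr 1
  unfold oscInt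
  refine setIntegral_congr_fun measurableSet_HP fun p hp => ?_
  have hp0 : 0 < p.1 := hp
  have : β p * g (LL s b p) = β p * gt p := by
    by_cases hpR : p ∈ Sml R
    · rw [hgt, Set.indicator_of_mem hpR]
    · have : β p = 0 := by
        set ξ := p.1 ^ ((M:ℝ)⁻¹) with hξ
        have hξ0 : 0 < ξ := by positivity
        have e1 : ξ ^ M = p.1 := Real.rpow_inv_natCast_pow hp0.le hM0.ne'
        have e2 : p = (ξ ^ M, ξ ^ M * (p.2 / p.1)) := by rw [e1, mul_div_cancel₀ _ hp0.ne']
        by_contra hne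
        have h1 : ¬ 2 ≤ |p.2 / p.1| := fun h => hne (by rw [e2]; exact hsp (ξ, p.2 / p.1) hξ0 h)
        have h2 : ¬ min ρ (min 1 (R / 2)) ≤ ξ := fun h => hne (by
          have := hβ.sp (ξ, p.2 / p.1) hξ0 h
          simp only [Phi, pow_zero, one_mul, zero_add] at this
          rw [e2]; exact this)
        push Not at h1 h2
        have h3 : ξ < 1 := h2.trans_le ((min_le_right _ _).trans (min_le_left _ _))
        have h4 : ξ < R / 2 := h2.trans_le ((min_le_right _ _).trans (min_le_right _ _))
        have h5 : ξ ^ M ≤ ξ := pow_le_of_le_one hξ0.le h3.le hM0.ne'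
        rw [abs_div, abs_of_pos hp0, div_lt_iff₀ hp0] at h1
        exact hpR ⟨hp0, by linarith, by linarith⟩
      rw [this, zero_mul, zero_mul]
  simp only [this]

def kap (w : ℝ) : ℝ := Real.smoothTransition (3 / (1 + w ^ 2) - 1)

lemma kap_cd : ContDiff ℝ 1 kap := by
  refine (Real.smoothTransition.contDiff (n := 1)).comp (ContDiff.sub (contDiff_const.div (by fun_prop) fun x => ?_) contDiff_const)
  positivity

lemma kap_zero (w : ℝ) (h : 2 ≤ |w|) : kap w = 0 := by
  apply Real.smoothTransition.zero_of_nonpos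
  have : 4 ≤ w ^ 2 := by rw [← sq_abs]; nlinarith
  rw [sub_nonpos, div_le_one (by positivity)]; linarith

lemma kap_bd (w : ℝ) : |kap w| ≤ 1 := by
  rw [kap, abs_of_nonneg (Real.smoothTransition.nonneg _)]; exact Real.smoothTransition.le_one _

lemma kap_add {x y : ℝ} (hx : x ≠ 0) (hy : y ≠ 0) : kap (y / x) + kap (x / y) = 1 := by
  have e : 3 / (1 + (x / y) ^ 2) - 1 = 1 - (3 / (1 + (y / x) ^ 2) - 1) := by
    have : x ^ 2 + y ^ 2 ≠ 0 := by positivity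
    have : y ^ 2 + x ^ 2 ≠ 0 := by positivity
    field_simp; ring
  unfold kap
  rw [e]
  set τ := 3 / (1 + (y / x) ^ 2) - 1
  have h := (Real.smoothTransition.pos_denom τ).ne'
  unfold Real.smoothTransition
  rw [sub_sub_cancel, add_comm (expNegInvGlue (1 - τ)), ← add_div, div_self h]

def AB (a : V2 → ℝ) (A r : ℝ) : Prop := (∀ p, p ≠ 0 → DifferentiableAt ℝ a p ∧ ‖fderiv ℝ a p‖ * nrm2 p ≤ A) ∧
  (∀ p, |a p| ≤ A) ∧ ∀ p, r ≤ nrm2 p → a p = 0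

lemma abs_le_nrm2 (p : V2) : |p.1| ≤ nrm2 p ∧ |p.2| ≤ nrm2 p :=
  ⟨Real.abs_le_sqrt (by nlinarith [sq_nonneg p.2]), Real.abs_le_sqrt (by nlinarith [sq_nonneg p.1])⟩

lemma AB_mk {φ α : V2 → ℝ} {x₀ y₀ r A : ℝ} (hr : 0 < r) (hA : 0 < A) (hφ : IsBump φ x₀ y₀ r) (hα : AlphaBound α A) :
    ∃ A1, AB (fun p => φ ((x₀, y₀) + p) * α p) A1 r := by
  obtain ⟨h1, h2, -, h4⟩ := hφ
  obtain ⟨k1, k2, k3⟩ := hα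
  set ψ : V2 → ℝ := fun p => φ ((x₀, y₀) + p) with hψ
  have c1 : ContDiff ℝ 1 ψ := (h1.of_le (by norm_num)).comp (contDiff_const.add contDiff_id)
  have c2 : HasCompactSupport ψ := h2.comp_homeomorph (Homeomorph.addLeft ((x₀, y₀) : V2))
  have c3 : Continuous (fderiv ℝ ψ) := c1.continuous_fderiv (by norm_num)
  obtain ⟨B, hB⟩ := c1.continuous.bounded_above_of_compact_support c2
  have hn : Continuous nrm2 := by unfold nrm2; fun_prop
  obtain ⟨B', hB'⟩ := (c3.norm.mul hn).bounded_above_of_compact_support ((c2.fderiv (𝕜 := ℝ)).norm.mul_right)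
  have hB0 : 0 ≤ B := (norm_nonneg _).trans (hB 0)
  have hB0' : 0 ≤ B' := (norm_nonneg _).trans (hB' 0)
  refine ⟨B * A + A * B', fun p hp => ?_, fun p => ?_, fun p hp => ?_⟩
  · have hd1 : DifferentiableAt ℝ ψ p := c1.differentiable (by norm_num) p
    have hd2 : DifferentiableAt ℝ α p := (k1.contDiffAt (isOpen_compl_singleton.mem_nhds hp)).differentiableAt (by norm_num)
    refine ⟨hd1.mul hd2, ?_⟩
    rw [fderiv_fun_mul hd1 hd2]
    have hnp : 0 < nrm2 p := by
      refine sqrt_pos.2 ?_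
      by_contra h
      apply hp
      have := sq_nonneg p.1
      have := sq_nonneg p.2
      exact Prod.ext (pow_eq_zero_iff (two_ne_zero)|>.1 (by linarith)) (pow_eq_zero_iff (two_ne_zero)|>.1 (by linarith))
    have e1 : ‖ψ p • fderiv ℝ α p + α p • fderiv ℝ ψ p‖ ≤ B * (A * (nrm2 p)⁻¹) + A * ‖fderiv ℝ ψ p‖ := by
      refine (norm_add_le _ _).trans ?_
      rw [norm_smul, norm_smul]
      exact add_le_add (mul_le_mul (hB p) (k3 p hp) (norm_nonneg _) hB0) (mul_le_mul_of_nonneg_right (k2 p) (norm_nonneg _))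
    have e2 : ‖fderiv ℝ ψ p‖ * nrm2 p ≤ B' := (le_abs_self _).trans (hB' p)
    calc _ ≤ (B * (A * (nrm2 p)⁻¹) + A * ‖fderiv ℝ ψ p‖) * nrm2 p := mul_le_mul_of_nonneg_right e1 hnp.le
      _ = B * A + A * (‖fderiv ℝ ψ p‖ * nrm2 p) := by field_simp
      _ ≤ _ := by gcongr
  · rw [abs_mul]
    have := mul_le_mul (hB p) (k2 p) (abs_nonneg _) hB0
    have h3 : 0 ≤ A * B' := by positivity
    exact this.trans (le_add_of_nonneg_right h3)
  · have : φ ((x₀, y₀) + p) = 0 := by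
      by_contra hne
      have := h4 (subset_tsupport φ (Function.mem_support.2 hne))
      simp only [Set.mem_ofPred_eq, Prod.fst_add, Prod.snd_add, add_sub_cancel_left] at this
      have h5 : r ^ 2 ≤ nrm2 p ^ 2 := pow_le_pow_left₀ hr.le hp 2
      rw [nrm2, sq_sqrt (by positivity)] at h5
      linarith
    beta_reduce; rw [this, zero_mul]

lemma AB.ms {a : V2 → ℝ} {A r : ℝ} (h : AB a A r) : AEStronglyMeasurable a volume := by
  have : ContinuousOn a {(0:V2)}ᶜ := fun p hp => (h.1 p hp).1.continuousAt.continuousWithinAt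
  have := this.aestronglyMeasurable (μ := volume) (measurableSet_singleton _).compl
  rwa [Measure.restrict_eq_self_of_ae_mem (s := {(0:V2)}ᶜ) (compl_mem_ae_iff.2 (measure_singleton _))] at this

lemma AB.sb {a : V2 → ℝ} {A r : ℝ} (h : AB a A r) {s : ℝ} (hs : s * s = 1) (b : Bool) (M : ℕ) :
    SB (fun q => a (LL s b (q.1 ^ M, q.1 ^ M * q.2))) ((M + 2) * A) := by
  intro q hq
  have hA : 0 ≤ A := (abs_nonneg _).trans (h.2.1 0)
  set P : V2 := (q.1 ^ M, q.1 ^ M * q.2) with hP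
  have hM : 0 < q.1 ^ M := by positivity
  have hP0 : LL s b P ≠ 0 := fun h0 => hM.ne' (congrArg Prod.fst (LL_inj hs b (h0.trans (map_zero _).symm) : P = 0))
  obtain ⟨d1, d2⟩ := h.1 _ hP0
  rw [LL_nrm hs] at d2
  obtain ⟨n1, n2⟩ := abs_le_nrm2 P
  have dX : HasFDerivAt (fun q : V2 => q.1 ^ M) ((M * q.1 ^ (M - 1)) • ContinuousLinearMap.fst ℝ ℝ ℝ) q :=
    HasDerivAt.comp_hasFDerivAt q (hasDerivAt_pow M q.1) hasFDerivAt_fst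
  have dP := dX.prodMk (dX.mul (hasFDerivAt_snd (𝕜 := ℝ) (p := q)))
  have dL := ((LL s b).hasFDerivAt (x := P)).comp q dP
  have dA := d1.hasFDerivAt.comp q dL
  have hLn : ∀ v, ‖LL s b v‖ = ‖v‖ := by
    intro v
    cases b
    · rw [LL_false, Prod.norm_def, Prod.norm_def]; simp only [norm_eq_abs, abs_sgn hs]
    · rw [LL_true, Prod.norm_def, Prod.norm_def, max_comm]; simp only [norm_eq_abs, abs_sgn hs]
  have hv : ∀ (c : ℝ) (v : V2) (k : ℝ), |c| * ‖v‖ ≤ k * nrm2 P → 0 ≤ k → |c * fderiv ℝ a (LL s b P) (LL s b v)| ≤ k * A := by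
    intro c v k h1 hk
    have h2 := (fderiv ℝ a (LL s b P)).le_opNorm (LL s b v)
    rw [hLn, norm_eq_abs] at h2
    rw [abs_mul]
    calc _ ≤ |c| * (‖fderiv ℝ a (LL s b P)‖ * ‖v‖) := by gcongr
      _ = ‖fderiv ℝ a (LL s b P)‖ * (|c| * ‖v‖) := by ring
      _ ≤ ‖fderiv ℝ a (LL s b P)‖ * (k * nrm2 P) := by gcongr
      _ = k * (‖fderiv ℝ a (LL s b P)‖ * nrm2 P) := by ring
      _ ≤ _ := by gcongr
  have hMA : (0:ℝ) ≤ M * A := by positivity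
  have hfd : fderiv ℝ (fun q : V2 => a (LL s b (q.1 ^ M, q.1 ^ M * q.2))) q = _ := dA.fderiv
  refine ⟨dA.differentiableAt, ?_, ?_, ?_⟩
  · refine (h.2.1 _).trans ?_; linarith
  · rw [hfd]
    have e : q.1 * (M * q.1 ^ (M - 1)) = M * q.1 ^ M := by
      rcases Nat.eq_zero_or_pos M with rfl | h0
      · simp
      · rw [← Nat.sub_add_cancel h0, Nat.add_sub_cancel, pow_succ]; ring
    refine (hv q.1 (M * q.1 ^ (M - 1), q.2 * (M * q.1 ^ (M - 1))) M ?_ (by positivity)).trans' (le_of_eq ?_) |>.trans (by linarith)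
    · rw [Prod.norm_def, mul_max_of_nonneg _ _ (abs_nonneg _)]
      simp only [norm_eq_abs]
      rw [← abs_mul, ← abs_mul, e, show q.1 * (q.2 * (M * q.1 ^ (M - 1))) = M * (q.1 ^ M * q.2) by rw [mul_left_comm, e]; ring, abs_mul, abs_mul _ (q.1 ^ M * q.2), Nat.abs_cast]
      exact max_le (mul_le_mul_of_nonneg_left n1 (by positivity)) (mul_le_mul_of_nonneg_left n2 (by positivity))
    · simp
  · rw [hfd]
    have e3 : ∀ z, (1 + |q.2|) * |z| = |(1 + |q.2|) * z| := fun z => by rw [abs_mul, abs_of_nonneg (by positivity : 0 ≤ 1 + |q.2|)]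
    rw [e3]
    refine (hv (1 + |q.2|) (0, q.1 ^ M) 2 ?_ (by norm_num)).trans' (le_of_eq ?_) |>.trans (by linarith)
    · rw [Prod.norm_def]
      simp only [norm_zero, norm_eq_abs]
      rw [max_eq_right (abs_nonneg (q.1 ^ M))]
      rw [abs_of_nonneg (by positivity : 0 ≤ 1 + |q.2|), abs_of_pos hM]
      simp only [hP, abs_mul, abs_of_pos hM] at n1 n2
      simp only [hP]
      linarith
    · simp

lemma symb_mk {a : V2 → ℝ} {A r : ℝ} (h : AB a A r) {s : ℝ} (hs : s * s = 1) (b : Bool) {M : ℕ} (hM : 0 < M) {ρ : ℝ}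
    (hρ : 0 < ρ) (hr : r ≤ ρ ^ M) : ∃ K, Symb M 0 (fun _ => 0) ρ (fun p => a (LL s b p) * kap (p.2 / p.1)) K := by
  obtain ⟨C, -, hC⟩ := SB_snd kap_cd kap_zero 0
  have hm := (h.sb hs b M).mul hC
  have e : ∀ q : V2, 0 < q.1 → a (LL s b (Phi M 0 (fun _ => 0) q)) * kap ((Phi M 0 (fun _ => 0) q).2 / (Phi M 0 (fun _ => 0) q).1) =
      a (LL s b (q.1 ^ M, q.1 ^ M * q.2)) * kap (0 + q.2) := by
    intro q hq
    simp only [Phi, pow_zero, one_mul, zero_add]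
    rw [mul_div_cancel_left₀ _ (pow_pos hq M).ne']
  refine ⟨2 * ((M + 2) * A * C), ?_, fun q hq => ?_, fun q hq hqρ => ?_⟩
  · have h1 := h.ms.comp_measurePreserving (LL_mp hs b)
    have h2 : Measurable fun p : V2 => kap (p.2 / p.1) := kap_cd.continuous.measurable.comp (measurable_snd.div measurable_fst)
    exact (h1.mul h2.aestronglyMeasurable).restrict
  · obtain ⟨m1, m2, m3, m4⟩ := hm q hq
    have ev : (fun q => (fun p : V2 => a (LL s b p) * kap (p.2 / p.1)) (Phi M 0 (fun _ => 0) q)) =ᶠ[𝓝 q]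
        fun q => a (LL s b (q.1 ^ M, q.1 ^ M * q.2)) * kap (0 + q.2) := by
      filter_upwards [continuousAt_fst.eventually (lt_mem_nhds hq)] with x hx using e x hx
    rw [ev.fderiv_eq]
    exact ⟨m1.congr_of_eventuallyEq ev, by rw [ev.self_of_nhds]; exact m2, m3, m4⟩
  · have : a (LL s b (q.1 ^ M, q.1 ^ M * q.2)) = 0 := by
      apply h.2.2
      rw [LL_nrm hs]
      refine le_trans ?_ (abs_le_nrm2 _).1
      rw [abs_of_pos (pow_pos hq M)]
      exact hr.trans (pow_le_pow_left₀ hρ.le hqρ M)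
    beta_reduce
    rw [e q hq, this, zero_mul]

lemma ae_ne0 : ∀ᵐ p : V2, p.1 ≠ 0 ∧ p.2 ≠ 0 := by
  have h : ∀ᵐ x : ℝ, x ≠ 0 := compl_mem_ae_iff.2 (measure_singleton 0)
  have h1 : ∀ᵐ p : V2, p.1 ≠ 0 := (Measure.quasiMeasurePreserving_fst (μ := (volume : Measure ℝ)) (ν := (volume : Measure ℝ))).ae h
  have h2 : ∀ᵐ p : V2, p.2 ≠ 0 := (Measure.quasiMeasurePreserving_snd (μ := (volume : Measure ℝ)) (ν := (volume : Measure ℝ))).ae h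
  exact h1.and h2

lemma split_HP {G : V2 → ℂ} (hG : Integrable G) : ∫ p, G p = (∫ p in HP, G p) + ∫ p in HP, G (LL (-1) false p) := by
  have e1 : (∫ p in HPᶜ, G p) = ∫ p in {p : V2 | p.1 < 0}, G p := by
    apply setIntegral_congr_set
    filter_upwards [ae_ne0] with p hp
    refine propext ⟨fun h => lt_of_le_of_ne (not_lt.1 h) hp.1, fun h h' => ?_⟩
    exact absurd (h : p.1 < 0) (not_lt.2 (le_of_lt h'))
  have e2 : HP = LL (-1) false ⁻¹' {p : V2 | p.1 < 0} := by
    ext p; simp [HP, LL_false]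
  rw [← integral_add_compl measurableSet_HP hG, e1]
  congr 1
  conv_rhs => rw [e2]
  exact ((LL_mp (by norm_num) false).setIntegral_preimage_emb (LL_emb (by norm_num) false) G _).symm

lemma split_b {F : V2 → ℂ} (hF : Integrable F) (b : Bool) :
    ∫ p, F p = (∫ p in HP, F (LL 1 b p)) + ∫ p in HP, F (LL (-1) b p) := by
  have h1 : (1:ℝ) * 1 = 1 := by norm_num
  have key := split_HP (((LL_mp h1 b).integrable_comp_emb (LL_emb h1 b)).2 hF)
  rw [← (LL_mp h1 b).integral_comp (LL_emb h1 b) F]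
  have : ∀ p, LL 1 b (LL (-1) false p) = LL (-1) b p := by
    intro p; cases b <;> simp [LL_false, LL_true]
  simp only [Function.comp, this] at key
  exact key

def Fb (a g : V2 → ℝ) (t u : ℝ) (b : Bool) (p : V2) : ℂ :=
  ((a p * g p : ℝ) : ℂ) * (((if b then kap (p.1 / p.2) else kap (p.2 / p.1) : ℝ) : ℂ) *
    Complex.exp (Complex.I * ((t : ℂ) * (p.1 : ℂ) + (u : ℂ) * (p.2 : ℂ))))

lemma piece {a g : V2 → ℝ} {s : ℝ} (hs : s * s = 1) (b : Bool)
    (hB : Bdd (fun p => g (LL s b p)) (fun p => a (LL s b p) * kap (p.2 / p.1))) :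
    ∃ C, ∀ t u, ‖∫ p in HP, Fb a g t u b (LL s b p)‖ ≤ C * RR t u := by
  obtain ⟨C, hC⟩ := hB
  refine ⟨C, fun t u => ?_⟩
  have hk : ∀ x y : ℝ, kap (y / (s * x)) = kap (y / x) := by
    intro x y
    unfold kap
    rw [div_pow, div_pow, mul_pow, sq s, hs, one_mul]
  cases b
  · have e : RR (s * t) u = RR t u := by unfold RR; rw [show (s * t, u) = LL s false (t, u) from rfl, LL_nrm hs]
    rw [← e]
    refine le_of_eq_of_le ?_ (hC (s * t) u)
    congr 1; unfold oscInt
    congr 1; funext p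
    simp only [Fb, LL_false, Bool.false_eq_true, if_false]
    rw [hk]; push_cast
    rw [show (s:ℂ) * t * p.1 = t * (s * p.1) by ring]; ring
  · have e : RR (s * u) t = RR t u := by
      unfold RR; rw [← LL_nrm hs true (s * u, t), LL_true, ← mul_assoc, hs, one_mul]
    rw [← e]
    refine le_of_eq_of_le ?_ (hC (s * u) t)
    congr 1; unfold oscInt
    congr 1; funext p
    simp only [Fb, LL_true, if_true]
    rw [hk]; push_cast
    rw [show (s:ℂ) * u * p.1 + t * p.2 = t * p.2 + u * (s * p.1) by ring]; ring

lemma Fb_int {a g : V2 → ℝ} (h : Integrable fun p => a p * g p) (t u : ℝ) (b : Bool) : Integrable (Fb a g t u b) := by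
  refine (h.ofReal (𝕜 := ℂ)).mul_bdd (c := 1) ?_ (Eventually.of_forall fun p => ?_)
  · have hk := kap_cd.continuous.measurable
    have h1 : Measurable fun p : V2 => (if b then kap (p.1 / p.2) else kap (p.2 / p.1) : ℝ) := by
      cases b
      · exact hk.comp (measurable_snd.div measurable_fst)
      · exact hk.comp (measurable_fst.div measurable_snd)
    exact ((Complex.measurable_ofReal.comp h1).mul (by fun_prop)).aestronglyMeasurable
  · have e : Complex.I * ((t : ℂ) * (p.1 : ℂ) + (u : ℂ) * (p.2 : ℂ)) = ((t * p.1 + u * p.2 : ℝ) : ℂ) * Complex.I := by push_cast; ring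
    rw [norm_mul, e, Complex.norm_exp_ofReal_mul_I, mul_one, Complex.norm_real, norm_eq_abs]
    split_ifs <;> exact kap_bd _

lemma osc_sum {a g : V2 → ℝ} (h : Integrable fun p => a p * g p) (t u : ℝ) :
    oscInt (fun p => a p * g p) Set.univ t u = (∫ p, Fb a g t u false p) + ∫ p, Fb a g t u true p := by
  rw [← integral_add (Fb_int h t u false) (Fb_int h t u true), oscInt, setIntegral_univ]
  apply integral_congr_ae
  filter_upwards [ae_ne0] with p hp
  have := kap_add hp.1 hp.2
  simp only [Fb, Bool.false_eq_true, if_false, if_true]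
  rw [← mul_add, ← add_mul, ← Complex.ofReal_add, this, Complex.ofReal_one, one_mul]

/-- **Theorem 1.5.** In the local multiplier setup, if the strip exponent `δ_v` is at least
`1/2` for every unit direction `v`, then for bump functions `φ` with sufficiently small
support there is `C` with
`|K_φ(t,u)| ≤ C (2+|(t,u)|)^{−1/2} (ln(2+|(t,u)|))^{2}` for all `(t,u)`. -/
theorem kernel_bound_half {n : ℕ} (f : Fin n → ℝ × ℝ → ℝ)
    (γ : Fin n → ℝ) (E : Set (ℝ × ℝ)) (hsf : StandardForm n f γ E)
    (x₀ y₀ A : ℝ) (hA : 0 < A) (α m : ℝ × ℝ → ℝ) (hα : AlphaBound α A)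
    (U : Set (ℝ × ℝ)) (hU : U ∈ 𝓝 (0:ℝ×ℝ))
    (hm : ∀ p ∈ U, m ((x₀, y₀) + p) = α p * stdFun n f γ E p)
    (δ : ℝ × ℝ → ℝ) (e : ℝ × ℝ → ℕ)
    (hstrip : ∀ v : ℝ × ℝ, nrm2 v = 1 →
      StripBound (stdFun n f γ E) v (δ v) (e v) ∧ 1/2 ≤ δ v) :
    ∃ r₁ > (0:ℝ), ∀ φ : ℝ × ℝ → ℝ, IsBump φ x₀ y₀ r₁ →
      ∃ C > (0:ℝ), ∀ t u : ℝ,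
        ‖Kphi φ m t u‖ ≤ C * (2 + nrm2 (t, u)) ^ (-(1/2 : ℝ)) *
          (Real.log (2 + nrm2 (t, u))) ^ 2 := by
  have hs1 : (1:ℝ) * 1 = 1 := by norm_num
  have hs2 : (-1:ℝ) * (-1) = 1 := by norm_num
  obtain ⟨M1, hM1, ρ1, hρ1, S1⟩ := Sector hsf hstrip hs1 false
  obtain ⟨M2, hM2, ρ2, hρ2, S2⟩ := Sector hsf hstrip hs2 false
  obtain ⟨M3, hM3, ρ3, hρ3, S3⟩ := Sector hsf hstrip hs1 true
  obtain ⟨M4, hM4, ρ4, hρ4, S4⟩ := Sector hsf hstrip hs2 true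
  obtain ⟨U', hU', hI⟩ := hsf.integ
  obtain ⟨R, hR, hRU⟩ := Bx_sub (inter_mem hU hU')
  have hr0 : 0 < min R (min (min (ρ1 ^ M1) (ρ2 ^ M2)) (min (ρ3 ^ M3) (ρ4 ^ M4))) := by positivity
  set r := min R (min (min (ρ1 ^ M1) (ρ2 ^ M2)) (min (ρ3 ^ M3) (ρ4 ^ M4))) with hr
  have rR : r ≤ R := min_le_left _ _
  have r1 : r ≤ ρ1 ^ M1 := (min_le_right _ _).trans ((min_le_left _ _).trans (min_le_left _ _))
  have r2 : r ≤ ρ2 ^ M2 := (min_le_right _ _).trans ((min_le_left _ _).trans (min_le_right _ _))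
  have r3 : r ≤ ρ3 ^ M3 := (min_le_right _ _).trans ((min_le_right _ _).trans (min_le_left _ _))
  have r4 : r ≤ ρ4 ^ M4 := (min_le_right _ _).trans ((min_le_right _ _).trans (min_le_right _ _))
  clear_value r
  refine ⟨r, hr0, fun φ hφ => ?_⟩
  set g := stdFun n f γ E with hg
  obtain ⟨A1, hAB⟩ := AB_mk hr0 hA hφ hα
  set a : ℝ × ℝ → ℝ := fun p => φ ((x₀, y₀) + p) * α p with ha
  have hin : ∀ p, nrm2 p < r → p ∈ Bx R := fun p hp =>
    ⟨(abs_le_nrm2 p).1.trans_lt (hp.trans_le rR), (abs_le_nrm2 p).2.trans_lt (hp.trans_le rR)⟩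
  have hφ0 : ∀ p, r ≤ nrm2 p → φ ((x₀, y₀) + p) = 0 := by
    intro p hp
    by_contra hne
    have := hφ.2.2.2 (subset_tsupport φ (Function.mem_support.2 hne))
    simp only [Set.mem_ofPred_eq, Prod.fst_add, Prod.snd_add, add_sub_cancel_left] at this
    have h5 : r ^ 2 ≤ nrm2 p ^ 2 := pow_le_pow_left₀ hr0.le hp 2
    rw [nrm2, sq_sqrt (by positivity)] at h5
    linarith
  have hint : Integrable fun p => a p * g p := by
    have h1 : Integrable ((Bx R).indicator g) :=
      (integrable_indicator_iff (measurableSet_Bx R)).2 (hI.mono_set (hRU.trans inter_subset_right))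
    have h2 := h1.bdd_mul (c := A1) hAB.ms (Eventually.of_forall fun p => hAB.2.1 p)
    refine h2.congr (Eventually.of_forall fun p => ?_)
    rcases lt_or_ge (nrm2 p) r with hp | hp
    · simp only [Set.indicator_of_mem (hin p hp)]
    · simp only [hAB.2.2 p hp, zero_mul]
  have hsup : ∀ (s : ℝ) (b : Bool) (M : ℕ) (q : ℝ × ℝ), 0 < q.1 → 2 ≤ |q.2| →
      (fun p : ℝ × ℝ => a (LL s b p) * kap (p.2 / p.1)) (q.1 ^ M, q.1 ^ M * q.2) = 0 := by
    intro s b M q hq h2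
    beta_reduce
    rw [mul_div_cancel_left₀ _ (pow_pos hq M).ne', kap_zero _ h2, mul_zero]
  obtain ⟨K1, k1⟩ := symb_mk hAB hs1 false hM1 hρ1 r1
  obtain ⟨K2, k2⟩ := symb_mk hAB hs2 false hM2 hρ2 r2
  obtain ⟨K3, k3⟩ := symb_mk hAB hs1 true hM3 hρ3 r3
  obtain ⟨K4, k4⟩ := symb_mk hAB hs2 true hM4 hρ4 r4
  obtain ⟨C1, c1⟩ := piece hs1 false (S1 _ _ k1 (hsup _ _ _))
  obtain ⟨C2, c2⟩ := piece hs2 false (S2 _ _ k2 (hsup _ _ _))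
  obtain ⟨C3, c3⟩ := piece hs1 true (S3 _ _ k3 (hsup _ _ _))
  obtain ⟨C4, c4⟩ := piece hs2 true (S4 _ _ k4 (hsup _ _ _))
  refine ⟨|C1 + C2 + (C3 + C4)| + 1, by positivity, fun t u => ?_⟩
  have hK : ‖Kphi φ m t u‖ = ‖oscInt (fun p => a p * g p) Set.univ t u‖ := by
    unfold Kphi oscInt
    rw [setIntegral_univ, setIntegral_univ, ← integral_add_left_eq_self _ ((x₀, y₀) : ℝ × ℝ)]
    have hz : ‖Complex.exp (((t * x₀ + u * y₀ : ℝ) : ℂ) * Complex.I)‖ = 1 := Complex.norm_exp_ofReal_mul_I _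
    rw [← one_mul ‖∫ p, ((a p * g p : ℝ) : ℂ) * _‖, ← hz, ← norm_mul, ← integral_const_mul]
    congr 2
    funext p
    have e1 : φ ((x₀, y₀) + p) * m ((x₀, y₀) + p) = a p * g p := by
      rcases lt_or_ge (nrm2 p) r with hp | hp
      · rw [hm p (hRU (hin p hp)).1, ha]; ring
      · rw [hφ0 p hp, hAB.2.2 p hp, zero_mul, zero_mul]
    beta_reduce
    rw [e1, mul_left_comm, ← Complex.exp_add]
    congr 2
    simp only [Prod.fst_add, Prod.snd_add]
    push_cast; ring
  rw [hK, osc_sum hint, split_b (Fb_int hint t u false) false, split_b (Fb_int hint t u true) true, mul_assoc]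
  refine (norm_add_le _ _).trans ((add_le_add ((norm_add_le _ _).trans (add_le_add (c1 t u) (c2 t u)))
    ((norm_add_le _ _).trans (add_le_add (c3 t u) (c4 t u)))).trans ?_)
  have h0 := RR_nonneg t u
  change _ ≤ _ * RR t u
  rw [← add_mul, ← add_mul, ← add_mul]
  exact mul_le_mul_of_nonneg_right ((le_abs_self _).trans (by linarith)) h0
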